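/- arXiv:2103.08075 — 4 statements merged into one kernel-verified Lean document; each statement's English description precedes it below -/
import Mathlib

section
/- Let p ∈ [1,∞) and let (Ω, Σ, μ) be a measure space such that the Banach space L^p(μ) (of real- or complex-valued p-integrable functions) is separable and infinite-dimensional. Then for every ε ∈ (0,1), L^p(μ) admits a bounded linear operator that is ε-hypercyclic but not hypercyclic. -/
open Filter Topology ENNReal MeasureTheory

/-- A biorthogonal system indexed by countably many bilateral chains, on which all bounded
weighted backward shifts along the chains act. -/
structure ShiftSystem (𝕜 : Type*) [RCLike 𝕜] {X : Type*} [NormedAddCommGroup X]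
    [NormedSpace 𝕜 X] (e : ℕ × ℤ → X) (c : ℕ × ℤ → X →L[𝕜] 𝕜) : Prop where
  norm_e : ∀ j, ‖e j‖ ≤ 1
  norm_c : ∀ j x, ‖c j x‖ ≤ ‖x‖
  c_e : ∀ i j, c i (e j) = if i = j then 1 else 0
  shift : ∀ (w : ℕ × ℤ → 𝕜) (M : ℝ), (∀ j, ‖w j‖ ≤ M) → ∃ D : X →L[𝕜] X,
    (∀ x, ‖D x‖ ≤ M * ‖x‖) ∧ (∀ k m x, c (k, m) (D x) = w (k, m) * c (k, m + 1) x) ∧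
    (∀ k m, D (e (k, m + 1)) = w (k, m) • e (k, m)) ∧ ∀ x, (∀ j, c j x = 0) → D x = 0
  dense : ∀ x, ∀ τ > 0, ∃ y, ‖x - y‖ < τ ∧ ∃ k, ∀ k' ≥ k, ∀ m, c (k', m) y = 0

/-- The data from which an ε-hypercyclic, non-hypercyclic operator `Da + Df + N` is assembled:
`Da` shifts along the positive halves of the chains, `Df` along the negative halves, and `N` is a
nuclear operator emitting the target `u k` at the position `1` of the `k`-th chain. -/
structure Blueprint {𝕜 : Type*} [RCLike 𝕜] {X : Type*} [NormedAddCommGroup X]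
    [NormedSpace 𝕜 X] (e : ℕ × ℤ → X) (c : ℕ × ℤ → X →L[𝕜] 𝕜) (ε : ℝ) (u : ℕ → X) where
  /-- nilpotency index on the first `k` chains -/
  H : ℕ → ℕ
  /-- exponent of the emission coefficient of the `k`-th chain -/
  q : ℕ → ℕ
  /-- length of the positive half of the `k`-th chain -/
  n : ℕ → ℕ
  /-- shift on the positive halves -/
  Da : X →L[𝕜] X
  /-- shift on the negative halves -/
  Df : X →L[𝕜] X
  /-- emission of the targets -/
  N : X →L[𝕜] X
  norm_e : ∀ j, ‖e j‖ ≤ 1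
  norm_c : ∀ j x, ‖c j x‖ ≤ ‖x‖
  c_e : ∀ i j, c i (e j) = if i = j then 1 else 0
  u_mem : ∀ k, ∀ k' ≥ k, ∀ m, c (k', m) (u k) = 0
  n_eq : ∀ k, n k = q k + k + 1 + H k
  H_zero : H 0 = 1
  H_succ : ∀ k, H (k + 1) = 2 * H k + n k + 1
  q_spec : ∀ k, ‖u k‖ * 18 ^ H k * 2 ^ (k + 1) ≤ 2 ^ q k
  norm_Da : ∀ x, ‖Da x‖ ≤ 2 * ‖x‖
  norm_Df : ∀ x, ‖Df x‖ ≤ 6 * ‖x‖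
  hasSum_N : ∀ x, HasSum (fun k => (((2 : 𝕜) ^ q k)⁻¹ * c (k, 1) x) • u k) (N x)
  c_Da : ∀ k m x, c (k, m) (Da x) = (if 1 ≤ m ∧ m < n k then 2 else 0) * c (k, m + 1) x
  c_Df : ∀ k m x, c (k, m) (Df x) =
    (if m = 0 then ((ε * ‖u k‖ : ℝ) : 𝕜) * ((2 : 𝕜) ^ q k)⁻¹ else
      if -(H k : ℤ) < m ∧ m < 0 then 6 else 0) * c (k, m + 1) x
  Da_e : ∀ k m, Da (e (k, m + 1)) = (if 1 ≤ m ∧ m < n k then (2 : 𝕜) else 0) • e (k, m)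
  Df_e : ∀ k m, Df (e (k, m + 1)) =
    (if m = 0 then ((ε * ‖u k‖ : ℝ) : 𝕜) * ((2 : 𝕜) ^ q k)⁻¹ else
      if -(H k : ℤ) < m ∧ m < 0 then 6 else 0) • e (k, m)
  Da_eq_zero : ∀ x, (∀ j, c j x = 0) → Da x = 0
  Df_eq_zero : ∀ x, (∀ j, c j x = 0) → Df x = 0

theorem ContinuousLinearMap.norm_pow_apply_le {𝕜 X : Type*} [NontriviallyNormedField 𝕜]
    [NormedAddCommGroup X] [NormedSpace 𝕜 X] (A : X →L[𝕜] X) {C : ℝ} (hC : 0 ≤ C)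
    (hA : ∀ x, ‖A x‖ ≤ C * ‖x‖) (n : ℕ) (x : X) : ‖(A ^ n) x‖ ≤ C ^ n * ‖x‖ := by
  induction n with
  | zero => simp
  | succ n ih =>
    rw [pow_succ', mul_apply_eq_comp, pow_succ', mul_assoc]
    exact (hA _).trans (by gcongr)

/-- Duhamel's formula for powers of a sum. -/
theorem add_pow_eq_pow_add_sum {R : Type*} [Ring R] (D N : R) (n : ℕ) :
    (D + N) ^ n = D ^ n + ∑ r ∈ Finset.range n, (D + N) ^ r * N * D ^ (n - 1 - r) := by
  induction n with
  | zero => simp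
  | succ n ih =>
    have h : ∑ r ∈ Finset.range n, (D + N) ^ r * N * D ^ (n + 1 - 1 - r) =
        (∑ r ∈ Finset.range n, (D + N) ^ r * N * D ^ (n - 1 - r)) * D := by
      rw [Finset.sum_mul]
      refine Finset.sum_congr rfl fun r hr => ?_
      have : n + 1 - 1 - r = (n - 1 - r) + 1 := by
        have := Finset.mem_range.1 hr; omega
      rw [this, pow_succ]; simp only [mul_assoc]
    rw [Finset.sum_range_succ, h, pow_succ (D + N) n, mul_add, pow_succ D n]
    nth_rewrite 1 [ih]
    simp [add_mul, add_assoc]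

namespace Blueprint

variable {𝕜 : Type*} [RCLike 𝕜] {X : Type*} [NormedAddCommGroup X] [NormedSpace 𝕜 X]
  {e : ℕ × ℤ → X} {c : ℕ × ℤ → X →L[𝕜] 𝕜} {ε : ℝ} {u : ℕ → X}

/-- The total shift. -/
def D (B : Blueprint e c ε u) : X →L[𝕜] X := B.Da + B.Df

/-- The assembled operator. -/
def T (B : Blueprint e c ε u) : X →L[𝕜] X := B.D + B.N

/-- The weights of the total shift. -/
def w (B : Blueprint e c ε u) (k : ℕ) (m : ℤ) : 𝕜 :=
  (if 1 ≤ m ∧ m < B.n k then 2 else 0) +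
    (if m = 0 then ((ε * ‖u k‖ : ℝ) : 𝕜) * ((2 : 𝕜) ^ B.q k)⁻¹ else
      if -(B.H k : ℤ) < m ∧ m < 0 then 6 else 0)

variable (B : Blueprint e c ε u)

theorem T_apply (x : X) : B.T x = B.D x + B.N x := rfl

theorem c_D (k m x) : c (k, m) (B.D x) = B.w k m * c (k, m + 1) x := by
  simp only [D, _root_.add_apply, map_add, B.c_Da, B.c_Df, w, add_mul]

theorem D_e (k m) : B.D (e (k, m + 1)) = B.w k m • e (k, m) := by
  simp only [D, _root_.add_apply, B.Da_e, B.Df_e, w, add_smul]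

theorem one_le_H (k : ℕ) : 1 ≤ B.H k := by
  cases k with
  | zero => exact B.H_zero.ge
  | succ k => rw [B.H_succ]; omega

theorem H_strictMono : StrictMono B.H :=
  strictMono_nat_of_lt_succ fun k => by rw [B.H_succ]; omega

theorem w_of_le {k : ℕ} {m : ℤ} (hm : 1 ≤ m) (h : (B.n k : ℤ) ≤ m) : B.w k m = 0 := by
  simp only [w]
  rw [if_neg (by omega), if_neg (by omega), if_neg (by omega), add_zero]

theorem bounds_of_w_ne_zero {k : ℕ} {m : ℤ} (h : B.w k m ≠ 0) :
    -(B.H k : ℤ) < m ∧ m < B.n k := by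
  have hH := B.one_le_H k
  have hn := B.n_eq k
  by_contra hc
  apply h
  simp only [w]
  rw [if_neg (by omega), if_neg (by omega), if_neg (by omega), add_zero]

theorem norm_u_coeff_le (k : ℕ) : ((2 : ℝ) ^ B.q k)⁻¹ * ‖u k‖ ≤
    (18 ^ B.H k)⁻¹ * (1 / 2) ^ (k + 1) := by
  have h := B.q_spec k
  rw [inv_mul_le_iff₀ (by positivity), one_div, inv_pow]
  field_simp
  linarith

theorem norm_term_le (k : ℕ) (x : X) : ‖(((2 : 𝕜) ^ B.q k)⁻¹ * c (k, 1) x) • u k‖ ≤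
    (18 ^ B.H k)⁻¹ * (1 / 2) ^ (k + 1) * ‖x‖ := by
  have h2 : ‖((2 : 𝕜) ^ B.q k)⁻¹‖ = ((2 : ℝ) ^ B.q k)⁻¹ := by simp
  rw [norm_smul, norm_mul, h2, mul_right_comm]
  exact mul_le_mul (B.norm_u_coeff_le k) (B.norm_c _ _) (norm_nonneg _) (by positivity)

theorem norm_N (x : X) : ‖B.N x‖ ≤ ‖x‖ := by
  rw [← (B.hasSum_N x).tsum_eq]
  refine tsum_of_norm_bounded (g := fun k => ‖x‖ / 2 / 2 ^ k) (hasSum_geometric_two' ‖x‖) fun k => ?_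
  refine (B.norm_term_le k x).trans ?_
  have : ((18 : ℝ) ^ B.H k)⁻¹ ≤ 1 := inv_le_one_of_one_le₀ (one_le_pow₀ (by norm_num))
  calc (18 ^ B.H k : ℝ)⁻¹ * (1 / 2) ^ (k + 1) * ‖x‖ ≤ 1 * (1 / 2) ^ (k + 1) * ‖x‖ := by gcongr
    _ = ‖x‖ / 2 / 2 ^ k := by rw [one_div, inv_pow, pow_succ]; field_simp

theorem norm_D (x : X) : ‖B.D x‖ ≤ 9 * ‖x‖ := by
  have := norm_add_le (B.Da x) (B.Df x)
  have h1 := B.norm_Da x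
  have h2 := B.norm_Df x
  have h3 := norm_nonneg x
  simp only [D, _root_.add_apply]; linarith

theorem norm_T (x : X) : ‖B.T x‖ ≤ 9 * ‖x‖ := by
  have := norm_add_le (B.Da x + B.Df x) (B.N x)
  have := norm_add_le (B.Da x) (B.Df x)
  have h1 := B.norm_Da x
  have h2 := B.norm_Df x
  have h3 := B.norm_N x
  simp only [T, D, _root_.add_apply]; linarith

theorem c_N_eq_zero {k : ℕ} {x : X} (hx : ∀ k' ≥ k + 1, ∀ m, c (k', m) x = 0) {k' : ℕ}
    (hk : k ≤ k') (m : ℤ) : c (k', m) (B.N x) = 0 := by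
  have h := (B.hasSum_N x).mapL (c (k', m))
  refine h.unique ?_
  convert hasSum_zero using 1
  funext i
  rcases le_or_gt i k with hi | hi
  · simp [B.u_mem i k' (hi.trans hk)]
  · simp [hx i hi]

theorem c_T_eq_zero {k : ℕ} {x : X} (hx : ∀ k' ≥ k, ∀ m, c (k', m) x = 0) :
    ∀ k' ≥ k, ∀ m, c (k', m) (B.T x) = 0 := by
  intro k' hk m
  have h1 := B.c_N_eq_zero (k := k) (x := x) (fun i hi => hx i (by omega)) hk m
  simp [T, h1, B.c_D, hx k' hk]

theorem c_T_pow_eq_zero {k : ℕ} {x : X} (hx : ∀ k' ≥ k, ∀ m, c (k', m) x = 0) (n : ℕ) :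
    ∀ k' ≥ k, ∀ m, c (k', m) ((B.T ^ n) x) = 0 := by
  induction n with
  | zero => simpa using hx
  | succ n ih =>
    rw [pow_succ', mul_apply_eq_comp]
    exact B.c_T_eq_zero ih

theorem bounds_of_c_T_pow_ne_zero {k : ℕ} {x : X} (hx : ∀ k' ≥ k + 1, ∀ m, c (k', m) x = 0)
    (n : ℕ) (m : ℤ) (h : c (k, m) ((B.T ^ n) x) ≠ 0) :
    n = 0 ∨ (-(B.H k : ℤ) < m ∧ m + n ≤ B.n k) := by
  induction n generalizing m with
  | zero => exact Or.inl rfl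
  | succ n ih =>
    right
    rw [pow_succ', mul_apply_eq_comp] at h
    rw [T_apply, map_add,
      B.c_N_eq_zero (B.c_T_pow_eq_zero hx n) le_rfl m, add_zero, B.c_D] at h
    have h1 := B.bounds_of_w_ne_zero (left_ne_zero_of_mul h)
    rcases ih (m + 1) (right_ne_zero_of_mul h) with h2 | h2
    · subst h2; push_cast; omega
    · push_cast; omega

theorem T_pow_H_eq_zero (k : ℕ) {x : X} (hx : ∀ k' ≥ k, ∀ m, c (k', m) x = 0) :
    (B.T ^ B.H k) x = 0 := by
  induction k generalizing x with
  | zero =>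
    have hx' : ∀ j, c j x = 0 := fun j => hx j.1 (Nat.zero_le _) j.2
    have hN : B.N x = 0 := by
      refine (B.hasSum_N x).unique ?_
      simp only [hx', mul_zero, zero_smul]
      exact hasSum_zero
    simp [B.H_zero, T, D, hN, B.Da_eq_zero x hx', B.Df_eq_zero x hx']
  | succ k ih =>
    have : B.H (k + 1) = B.H k + (B.H k + B.n k + 1) := by rw [B.H_succ]; ring
    rw [this, pow_add, mul_apply_eq_comp]
    apply ih
    intro k' hk m
    rcases hk.eq_or_lt with rfl | hk
    · by_contra hne
      have := B.bounds_of_c_T_pow_ne_zero hx _ m hne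
      omega
    · exact B.c_T_pow_eq_zero hx _ k' hk m

theorem T_pow_eq_zero {k n : ℕ} (hn : B.H k ≤ n) {x : X}
    (hx : ∀ k' ≥ k, ∀ m, c (k', m) x = 0) : (B.T ^ n) x = 0 := by
  obtain ⟨r, rfl⟩ := Nat.exists_eq_add_of_le' hn
  rw [pow_add, mul_apply_eq_comp, B.T_pow_H_eq_zero k hx, map_zero]

theorem N_e (k : ℕ) (m : ℤ) : B.N (e (k, m)) = if m = 1 then ((2 : 𝕜) ^ B.q k)⁻¹ • u k else 0 := by
  refine (B.hasSum_N _).unique ?_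
  convert hasSum_ite_eq k (if m = 1 then ((2 : 𝕜) ^ B.q k)⁻¹ • u k else 0) using 1
  funext i
  rw [B.c_e]
  by_cases hi : i = k
  · subst hi
    by_cases hm : m = 1
    · simp [hm]
    · simp [hm, Ne.symm hm]
  · simp [hi]

theorem T_pow_e (k s r : ℕ) (h : s + r + 1 = B.n k) :
    (B.T ^ s) (e (k, B.n k)) = (2 : 𝕜) ^ s • e (k, (r : ℤ) + 1) := by
  induction s generalizing r with
  | zero => simp [← h]
  | succ s ih =>
    rw [pow_succ', mul_apply_eq_comp, ih (r + 1) (by omega), map_smul]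
    have hw : B.w k ((r : ℤ) + 1) = 2 := by
      simp only [w]
      rw [if_pos (by omega), if_neg (by omega), if_neg (by omega), add_zero]
    rw [T_apply, B.N_e, if_neg (by push_cast; omega), add_zero]
    push_cast
    rw [B.D_e, hw, smul_smul, pow_succ]

theorem T_pow_n_e (k : ℕ) : (B.T ^ B.n k) (e (k, B.n k)) =
    ((2 : 𝕜) ^ (B.n k - 1) * ((2 : 𝕜) ^ B.q k)⁻¹) •
      (u k + ((ε * ‖u k‖ : ℝ) : 𝕜) • e (k, 0)) := by
  have hn := B.n_eq k
  have h1 : B.n k = (B.n k - 1) + 1 := by omega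
  have hw : B.w k 0 = ((ε * ‖u k‖ : ℝ) : 𝕜) * ((2 : 𝕜) ^ B.q k)⁻¹ := by simp [w]
  have h2 := B.D_e k 0
  rw [hw] at h2
  nth_rewrite 1 [h1]
  rw [pow_succ', mul_apply_eq_comp, B.T_pow_e k (B.n k - 1) 0 (by omega), map_smul]
  rw [T_apply, B.N_e, if_pos (by simp), Nat.cast_zero, h2, mul_smul]
  simp only [smul_add, smul_smul]
  rw [add_comm]
  congr 2
  ring

theorem c_e_eq_zero_of_lt (B : Blueprint e c ε u) {k j : ℕ} (h : k < j) (i : ℤ) :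
    ∀ k' ≥ j, ∀ m, c (k', m) (e (k, i)) = 0 := by
  intro k' hk m
  rw [B.c_e, if_neg (by simp; omega)]

theorem n_add_le_H {j k : ℕ} (h : j < k) : B.n j + j + 1 ≤ B.H k := by
  have h1 := B.H_strictMono.monotone (Nat.succ_le_of_lt h)
  have h2 := B.H_succ j
  have h3 := B.H_strictMono.le_apply (x := j)
  simp only [Nat.succ_eq_add_one] at h1
  omega

theorem exists_orbit_near [CompleteSpace X] : ∃ x, ∀ j, ‖(B.T ^ B.n j) x -
    (u j + ((ε * ‖u j‖ : ℝ) : 𝕜) • e (j, 0))‖ ≤ (1 / 2) ^ j := by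
  set f : ℕ → X := fun k => ((2 : 𝕜) ^ (k + B.H k))⁻¹ • e (k, B.n k) with hf
  have hfn : ∀ k, ‖f k‖ ≤ (1 / 2) ^ k := fun k => by
    have h2 : ‖((2 : 𝕜) ^ (k + B.H k))⁻¹‖ = (1 / 2) ^ (k + B.H k) := by simp
    rw [hf, norm_smul, h2, pow_add, mul_assoc]
    refine mul_le_of_le_one_right (by positivity) ?_
    exact mul_le_one₀ (pow_le_one₀ (by norm_num) (by norm_num)) (norm_nonneg _) (B.norm_e _)
  have hs : Summable f := .of_norm_bounded summable_geometric_two hfn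
  refine ⟨∑' k, f k, fun j => ?_⟩
  have h1 := (hs.hasSum.mapL (B.T ^ B.n j)).sub
    (hasSum_ite_eq j (u j + ((ε * ‖u j‖ : ℝ) : 𝕜) • e (j, 0)))
  rw [← h1.tsum_eq]
  refine tsum_of_norm_bounded (hasSum_geometric_two' ((1 / 2 : ℝ) ^ j)) fun k => ?_
  have hnn : (0 : ℝ) ≤ (1 / 2) ^ j / 2 / 2 ^ k := by positivity
  rcases lt_trichotomy k j with h | h | h
  · rw [if_neg h.ne, sub_zero, hf, map_smul, B.T_pow_eq_zero (k := j) _ (B.c_e_eq_zero_of_lt h _)]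
    · simpa using hnn
    · have := B.n_eq j; omega
  · subst h
    rw [if_pos rfl, hf, map_smul, B.T_pow_n_e, smul_smul]
    have hn : B.n k - 1 = (k + B.H k) + B.q k := by have := B.n_eq k; omega
    have : ((2 : 𝕜) ^ (k + B.H k))⁻¹ * ((2 : 𝕜) ^ (B.n k - 1) * ((2 : 𝕜) ^ B.q k)⁻¹) = 1 := by
      rw [hn, pow_add _ (k + B.H k)]; field_simp
    rw [this, one_smul, sub_self, norm_zero]
    exact hnn
  · have hH := B.n_add_le_H h
    have hn := B.n_eq k
    obtain ⟨r, hr⟩ : ∃ r, B.n j + r + 1 = B.n k := ⟨B.n k - B.n j - 1, by omega⟩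
    rw [if_neg h.ne', sub_zero, hf, map_smul, B.T_pow_e k _ r hr, smul_smul, norm_smul]
    have h2 : ‖((2 : 𝕜) ^ (k + B.H k))⁻¹ * (2 : 𝕜) ^ B.n j‖ =
      ((2 : ℝ) ^ (k + B.H k))⁻¹ * 2 ^ B.n j := by simp
    rw [h2]
    calc ((2 : ℝ) ^ (k + B.H k))⁻¹ * 2 ^ B.n j * ‖e (k, (r : ℤ) + 1)‖
        ≤ ((2 : ℝ) ^ (k + (B.n j + j + 1)))⁻¹ * 2 ^ B.n j * 1 := by
          gcongr
          · norm_num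
          · exact B.norm_e _
      _ = _ := by rw [one_div, inv_pow]; simp only [pow_add]; field_simp

theorem exists_eps_hypercyclic [CompleteSpace X] (hε : 0 < ε) (hε1 : ε ≤ 1)
    (hu : ∀ v, v ≠ 0 → ∀ τ > 0, ∀ K, ∃ k ≥ K, ‖u k - v‖ ≤ τ) :
    ∃ x, ∀ v, v ≠ 0 → ∃ n : ℕ, ‖(B.T ^ n) x - v‖ ≤ 2 * ε * ‖v‖ := by
  obtain ⟨x, hx⟩ := B.exists_orbit_near
  refine ⟨x, fun v hv => ?_⟩
  have hv' : 0 < ‖v‖ := norm_pos_iff.2 hv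
  have hτ : 0 < ε * ‖v‖ / 4 := by positivity
  obtain ⟨K, hK⟩ := exists_pow_lt_of_lt_one hτ (by norm_num : (1 / 2 : ℝ) < 1)
  obtain ⟨k, hk, huk⟩ := hu v hv _ hτ K
  refine ⟨B.n k, ?_⟩
  have h1 : (1 / 2 : ℝ) ^ k ≤ ε * ‖v‖ / 4 :=
    (pow_le_pow_of_le_one (by norm_num) (by norm_num) hk).trans hK.le
  have h2 : ‖((ε * ‖u k‖ : ℝ) : 𝕜) • e (k, 0)‖ ≤ ε * ‖u k‖ := by
    rw [norm_smul, RCLike.norm_ofReal, abs_of_nonneg (by positivity)]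
    exact mul_le_of_le_one_right (by positivity) (B.norm_e _)
  have h3 : ‖u k‖ ≤ ‖v‖ + ε * ‖v‖ / 4 := by
    have := norm_add_le v (u k - v)
    rw [add_sub_cancel] at this
    linarith
  have h4 : ‖(B.T ^ B.n k) x - v‖ ≤ ‖(B.T ^ B.n k) x -
      (u k + ((ε * ‖u k‖ : ℝ) : 𝕜) • e (k, 0))‖ + ‖u k - v‖ +
      ‖((ε * ‖u k‖ : ℝ) : 𝕜) • e (k, 0)‖ := by
    refine le_trans (le_of_eq ?_) (norm_add₃_le)
    congr 1; abel
  have h5 := hx k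
  have h6 : ε * ‖u k‖ ≤ ε * (‖v‖ + ε * ‖v‖ / 4) := by gcongr
  have h7 : ε * (ε * ‖v‖) ≤ 1 * (ε * ‖v‖) := by gcongr
  nlinarith

theorem exists_H_le_lt {n : ℕ} (hn : 1 ≤ n) : ∃ k, B.H k ≤ n ∧ n < B.H (k + 1) := by
  have h : ∃ k, n < B.H (k + 1) := ⟨n, (Nat.lt_succ_self n).trans_le B.H_strictMono.le_apply⟩
  classical
  refine ⟨Nat.find h, ?_, Nat.find_spec h⟩
  rcases hk : Nat.find h with _ | k
  · rw [B.H_zero]; exact hn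
  · exact not_lt.1 (Nat.find_min h (m := k) (by omega))

theorem c_D_pow_eq_zero (k s : ℕ) (m : ℤ) (h1 : 1 ≤ m) (h2 : m ≤ B.n k) (h3 : (B.n k : ℤ) < m + s)
    (x : X) : c (k, m) ((B.D ^ s) x) = 0 := by
  induction s generalizing m with
  | zero => push_cast at h3; omega
  | succ s ih =>
    rw [pow_succ', mul_apply_eq_comp, B.c_D]
    rcases le_or_gt (B.n k : ℤ) m with h | h
    · rw [B.w_of_le h1 h, zero_mul]
    · rw [ih (m + 1) (by omega) (by omega) (by push_cast at h3; omega), mul_zero]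

theorem c_neg_D_pow (k i s : ℕ) (hi : i < B.H k) (x : X) :
    c (k, -(i : ℤ)) ((B.D ^ (i + 1 + s)) x) =
      6 ^ i * ((ε * ‖u k‖ : ℝ) : 𝕜) * (((2 : 𝕜) ^ B.q k)⁻¹ * c (k, 1) ((B.D ^ s) x)) := by
  induction i with
  | zero =>
    rw [zero_add, add_comm, pow_succ', mul_apply_eq_comp, Nat.cast_zero, neg_zero, B.c_D]
    have hw : B.w k 0 = ((ε * ‖u k‖ : ℝ) : 𝕜) * ((2 : 𝕜) ^ B.q k)⁻¹ := by simp [w]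
    rw [hw, pow_zero, zero_add]; ring
  | succ i ih =>
    have h1 : i + 1 + 1 + s = (i + 1 + s) + 1 := by ring
    have h2 : -((i + 1 : ℕ) : ℤ) + 1 = -(i : ℤ) := by push_cast; ring
    have hw : B.w k (-((i + 1 : ℕ) : ℤ)) = 6 := by
      simp only [w]
      rw [if_neg (by omega), if_neg (by omega), if_pos (by omega), zero_add]
    rw [h1, pow_succ', mul_apply_eq_comp, B.c_D, h2, ih (by omega), hw]
    ring

theorem c_D_pow_of_pos {n : ℕ} (hn : 1 ≤ n) (x : X) : c (0, -1) ((B.D ^ n) x) = 0 := by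
  obtain ⟨s, rfl⟩ := Nat.exists_eq_add_of_le' hn
  have hw : B.w 0 (-1) = 0 := by simp [w, B.H_zero]
  rw [pow_succ', mul_apply_eq_comp, B.c_D, hw, zero_mul]

/-- The first chain's coordinate `-1` grows at most like `3 ^ r` along orbits. -/
theorem norm_c_T_pow_le (r : ℕ) (x : X) : ‖c (0, -1) ((B.T ^ r) x)‖ ≤ 3 ^ r * ‖x‖ := by
  set A : X →L[𝕜] X := B.Da + B.N with hA
  have hAn : ∀ y, ‖A y‖ ≤ 3 * ‖y‖ := fun y => by
    have h1 := norm_add_le (B.Da y) (B.N y)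
    have h2 := B.norm_Da y
    have h3 := B.norm_N y
    rw [hA, _root_.add_apply]; linarith
  have key : (∀ k, ∀ m ≥ 1, c (k, m) ((B.T ^ r) x - (A ^ r) x) = 0) ∧
      c (0, -1) ((B.T ^ r) x - (A ^ r) x) = 0 := by
    induction r with
    | zero => simp
    | succ r ih =>
      have h1 : (B.T ^ (r + 1)) x - (A ^ (r + 1)) x =
          B.Da ((B.T ^ r) x - (A ^ r) x) + B.Df ((B.T ^ r) x) := by
        have hN : B.N ((B.T ^ r) x - (A ^ r) x) = 0 := by
          refine (B.hasSum_N _).unique ?_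
          simp only [ih.1 _ 1 le_rfl, mul_zero, zero_smul]
          exact hasSum_zero
        rw [map_sub, sub_eq_zero] at hN
        rw [pow_succ', pow_succ', mul_apply_eq_comp, mul_apply_eq_comp, T_apply, hN, hA, map_sub]
        simp only [D, _root_.add_apply]
        abel
      rw [h1]
      constructor
      · intro k m hm
        rw [map_add, B.c_Da, B.c_Df, ih.1 k (m + 1) (by omega), if_neg (by omega : ¬ m = 0),
          if_neg (by omega : ¬ (-(B.H k : ℤ) < m ∧ m < 0))]
        simp
      · rw [map_add, B.c_Da, B.c_Df, B.H_zero]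
        simp
  have h := key.2
  rw [map_sub, sub_eq_zero] at h
  rw [h]
  exact (B.norm_c _ _).trans (A.norm_pow_apply_le (by norm_num) hAn r x)

theorem norm_T_pow_N_sub_le {k n r : ℕ} (hk : B.H k ≤ n) (hr : r < n) (z : X) :
    ‖(B.T ^ r) (B.N ((B.D ^ (n - 1 - r)) z)) -
      (((2 : 𝕜) ^ B.q k)⁻¹ * c (k, 1) ((B.D ^ (n - 1 - r)) z)) • (B.T ^ r) (u k)‖ ≤
      9 ^ (n - 1) * (18 ^ B.H (k + 1))⁻¹ * ‖z‖ := by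
  set y := (B.D ^ (n - 1 - r)) z with hy
  have hyn : ‖y‖ ≤ 9 ^ (n - 1 - r) * ‖z‖ :=
    B.D.norm_pow_apply_le (by norm_num) B.norm_D _ _
  have hpow : (9 : ℝ) ^ (n - 1) = 9 ^ r * 9 ^ (n - 1 - r) := by
    rw [← pow_add]; congr 1; omega
  have h1 := ((B.hasSum_N y).mapL (B.T ^ r)).sub (hasSum_ite_eq k
    ((((2 : 𝕜) ^ B.q k)⁻¹ * c (k, 1) y) • (B.T ^ r) (u k)))
  rw [← h1.tsum_eq]
  refine tsum_of_norm_bounded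
    (hasSum_geometric_two' (9 ^ (n - 1) * (18 ^ B.H (k + 1))⁻¹ * ‖z‖)) fun i => ?_
  rcases lt_trichotomy i k with h | h | h
  · rw [if_neg h.ne, sub_zero, map_smul]
    have hH := B.H_strictMono.monotone (Nat.succ_le_of_lt h)
    have hs := B.H_succ i
    simp only [Nat.succ_eq_add_one] at hH
    have hn := B.n_eq i
    rcases le_or_gt (B.n i) (n - 1 - r) with hc | hc
    · rw [hy, B.c_D_pow_eq_zero i _ 1 le_rfl (by omega) (by omega), mul_zero, zero_smul, norm_zero]
      positivity
    · rw [B.T_pow_eq_zero (k := i) (by omega) (B.u_mem i), smul_zero, norm_zero]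
      positivity
  · subst h
    rw [if_pos rfl, map_smul, sub_self, norm_zero]
    positivity
  · rw [if_neg h.ne', sub_zero]
    calc _ ≤ 9 ^ r * ((18 ^ B.H i)⁻¹ * (1 / 2) ^ (i + 1) * ‖y‖) :=
          (B.T.norm_pow_apply_le (by norm_num) B.norm_T _ _).trans
            (by gcongr; exact B.norm_term_le i y)
      _ ≤ 9 ^ r * ((18 ^ B.H (k + 1))⁻¹ * (1 / 2) ^ (i + 1) * (9 ^ (n - 1 - r) * ‖z‖)) := by
          gcongr
          · norm_num
          · exact B.H_strictMono.monotone h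
      _ = _ := by rw [hpow, one_div, inv_pow, pow_succ]; field_simp

/-- Up to an error of norm at most `‖z‖`, only the `k`-th emission is visible in `T ^ n z` when
`H k ≤ n < H (k + 1)`. -/
theorem norm_T_pow_sub_le {k n : ℕ} (hk : B.H k ≤ n) (hk' : n < B.H (k + 1)) (z : X) :
    ‖(B.T ^ n) z - (B.D ^ n) z - ∑ r ∈ Finset.range n,
      (((2 : 𝕜) ^ B.q k)⁻¹ * c (k, 1) ((B.D ^ (n - 1 - r)) z)) • (B.T ^ r) (u k)‖ ≤ ‖z‖ := by
  have h1 : (B.T ^ n) z = (B.D ^ n) z +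
      ∑ r ∈ Finset.range n, (B.T ^ r) (B.N ((B.D ^ (n - 1 - r)) z)) := by
    rw [T, add_pow_eq_pow_add_sum B.D B.N n, _root_.add_apply, _root_.sum_apply]
    rfl
  rw [h1, add_sub_cancel_left, ← Finset.sum_sub_distrib]
  calc _ ≤ ∑ r ∈ Finset.range n, (9 : ℝ) ^ (n - 1) * (18 ^ B.H (k + 1))⁻¹ * ‖z‖ :=
        norm_sum_le_of_le _ fun r hr => B.norm_T_pow_N_sub_le hk (Finset.mem_range.1 hr) z
    _ = (n * 9 ^ (n - 1)) * (18 ^ B.H (k + 1))⁻¹ * ‖z‖ := by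
        rw [Finset.sum_const, Finset.card_range, nsmul_eq_mul]; ring
    _ ≤ 18 ^ B.H (k + 1) * (18 ^ B.H (k + 1))⁻¹ * ‖z‖ := by
        gcongr
        calc (n : ℝ) * 9 ^ (n - 1) ≤ 2 ^ n * 9 ^ n := by
              gcongr
              · exact_mod_cast Nat.lt_two_pow_self.le
              · norm_num
              · omega
          _ = 18 ^ n := by rw [← mul_pow]; norm_num
          _ ≤ 18 ^ B.H (k + 1) := pow_le_pow_right₀ (by norm_num) hk'.le
    _ = ‖z‖ := by rw [mul_inv_cancel₀ (by positivity), one_mul]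

theorem one_le_of_T_pow (hε : 0 < ε) {n : ℕ} (hn : 1 ≤ n) (z : X) :
    1 ≤ (‖(B.T ^ n) z - e (0, -1)‖ + ‖z‖) * (1 + 2 / ε) := by
  obtain ⟨k, hk, hk'⟩ := B.exists_H_le_lt hn
  set δ := ‖(B.T ^ n) z - e (0, -1)‖ with hδ
  set g : ℕ → 𝕜 := fun r => ((2 : 𝕜) ^ B.q k)⁻¹ * c (k, 1) ((B.D ^ (n - 1 - r)) z) with hg
  set R := (B.T ^ n) z - (B.D ^ n) z - ∑ r ∈ Finset.range n, g r • (B.T ^ r) (u k) with hR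
  have hRn : ‖R‖ ≤ ‖z‖ := B.norm_T_pow_sub_le hk hk' z
  have hdec : (B.T ^ n) z = (B.D ^ n) z + ∑ r ∈ Finset.range n, g r • (B.T ^ r) (u k) + R := by
    rw [hR]; abel
  have hgi : ∀ i < B.H k, 6 ^ i * (ε * ‖u k‖) * ‖g i‖ ≤ δ + ‖z‖ := by
    intro i hi
    have h1 : c (k, -(i : ℤ)) ((B.D ^ n) z) = 6 ^ i * ((ε * ‖u k‖ : ℝ) : 𝕜) * g i := by
      have h2 := B.c_neg_D_pow k i (n - 1 - i) hi z
      rwa [show i + 1 + (n - 1 - i) = n by omega] at h2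
    have h2 : c (k, -(i : ℤ)) (e (0, -1)) = 0 := by
      rw [B.c_e, if_neg]
      rintro h
      simp only [Prod.mk.injEq] at h
      obtain ⟨rfl, h⟩ := h
      rw [B.H_zero] at hi
      omega
    have h3 : c (k, -(i : ℤ)) (∑ r ∈ Finset.range n, g r • (B.T ^ r) (u k)) = 0 := by
      rw [map_sum]
      refine Finset.sum_eq_zero fun r _ => ?_
      rw [map_smul, B.c_T_pow_eq_zero (B.u_mem k) r k le_rfl, smul_zero]
    have h4 : c (k, -(i : ℤ)) ((B.T ^ n) z - e (0, -1)) - c (k, -(i : ℤ)) R =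
        6 ^ i * ((ε * ‖u k‖ : ℝ) : 𝕜) * g i := by
      rw [map_sub, h2, hdec, map_add, map_add, h3, h1]; ring
    have h5 : ‖6 ^ i * ((ε * ‖u k‖ : ℝ) : 𝕜) * g i‖ = 6 ^ i * (ε * ‖u k‖) * ‖g i‖ := by
      rw [norm_mul, norm_mul, RCLike.norm_ofReal, abs_of_nonneg (by positivity)]
      simp
    rw [← h5, ← h4]
    exact (norm_sub_le _ _).trans
      (add_le_add (B.norm_c _ _) ((B.norm_c _ _).trans hRn))
  have hterm : ∀ r ∈ Finset.range n, ‖c (0, -1) (g r • (B.T ^ r) (u k))‖ ≤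
      (δ + ‖z‖) / ε * (1 / 2) ^ r := by
    intro r _
    rcases lt_or_ge r (B.H k) with hr | hr
    · have h1 := hgi r hr
      rw [map_smul, norm_smul]
      calc ‖g r‖ * ‖c (0, -1) ((B.T ^ r) (u k))‖ ≤ ‖g r‖ * (3 ^ r * ‖u k‖) := by
            gcongr; exact B.norm_c_T_pow_le r _
        _ = (6 ^ r * (ε * ‖u k‖) * ‖g r‖) / ε * (1 / 2) ^ r := by
            rw [show (6 : ℝ) = 3 * 2 by norm_num, mul_pow, one_div, inv_pow]; field_simp
        _ ≤ _ := by gcongr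
    · rw [B.T_pow_eq_zero hr (B.u_mem k), smul_zero, map_zero, norm_zero]
      positivity
  have hsum : ‖c (0, -1) (∑ r ∈ Finset.range n, g r • (B.T ^ r) (u k))‖ ≤
      (δ + ‖z‖) / ε * 2 := by
    rw [map_sum]
    refine (norm_sum_le_of_le _ hterm).trans ?_
    rw [← Finset.mul_sum]
    gcongr
    exact sum_geometric_two_le n
  have h1 : (1 : 𝕜) = c (0, -1) (∑ r ∈ Finset.range n, g r • (B.T ^ r) (u k)) + c (0, -1) R -
      c (0, -1) ((B.T ^ n) z - e (0, -1)) := by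
    have h0 := congrArg (c (0, -1)) hdec
    rw [map_add, map_add, B.c_D_pow_of_pos hn, zero_add] at h0
    rw [map_sub _ ((B.T ^ n) z) (e (0, -1)), B.c_e, if_pos rfl, h0]
    ring
  calc (1 : ℝ) = ‖(1 : 𝕜)‖ := norm_one.symm
    _ ≤ (δ + ‖z‖) / ε * 2 + ‖z‖ + δ := by
        rw [h1]
        refine (norm_sub_le _ _).trans (add_le_add ((norm_add_le _ _).trans ?_) (B.norm_c _ _))
        exact add_le_add hsum ((B.norm_c _ _).trans hRn)
    _ = _ := by ring

theorem not_dense_orbit (hε : 0 < ε) (x : X) :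
    ¬ Dense (Set.range fun n : ℕ => (B.T ^ n) x) := by
  intro hd
  have he : 1 ≤ ‖e (0, -1)‖ := by
    have h := B.norm_c (0, -1) (e (0, -1))
    rwa [B.c_e, if_pos rfl, norm_one] at h
  have : Nontrivial X := ⟨e (0, -1), 0, fun h => by rw [h, norm_zero] at he; norm_num at he⟩
  have (y : X) : Filter.NeBot (𝓝[≠] y) := Module.punctured_nhds_neBot 𝕜 X y
  have hη : 0 < (1 + 2 / ε)⁻¹ / 2 := by positivity
  obtain ⟨_, ⟨m, rfl⟩, hm⟩ := hd.exists_dist_lt 0 hη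
  have hd' := hd.sdiff_finite ((Set.finite_le_nat m).image fun n => (B.T ^ n) x)
  obtain ⟨_, ⟨⟨n, rfl⟩, hn⟩, hn'⟩ := hd'.exists_dist_lt (e (0, -1)) hη
  have hmn : m < n := by
    by_contra h
    exact hn ⟨n, not_lt.1 h, rfl⟩
  have h := B.one_le_of_T_pow hε (n := n - m) (by omega) ((B.T ^ m) x)
  rw [← mul_apply_eq_comp, ← pow_add, Nat.sub_add_cancel hmn.le] at h
  rw [dist_comm, dist_eq_norm] at hn'
  rw [dist_zero_left] at hm
  have hp : 0 < 1 + 2 / ε := by positivity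
  have : (1 + 2 / ε)⁻¹ * (1 + 2 / ε) = 1 := inv_mul_cancel₀ hp.ne'
  nlinarith

end Blueprint

namespace ShiftSystem

variable {𝕜 : Type*} [RCLike 𝕜] {X : Type*} [NormedAddCommGroup X] [NormedSpace 𝕜 X]
  {e : ℕ × ℤ → X} {c : ℕ × ℤ → X →L[𝕜] 𝕜}

theorem nonempty_blueprint [CompleteSpace X] (S : ShiftSystem 𝕜 e c) {ε : ℝ} (hε : 0 < ε)
    (hε1 : ε ≤ 1) {u : ℕ → X} (hu : ∀ k, ∀ k' ≥ k, ∀ m, c (k', m) (u k) = 0) :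
    Nonempty (Blueprint e c ε u) := by
  have hQ : ∀ k h : ℕ, ∃ q : ℕ, ‖u k‖ * 18 ^ h * 2 ^ (k + 1) ≤ 2 ^ q := fun k h =>
    (pow_unbounded_of_one_lt (‖u k‖ * 18 ^ h * 2 ^ (k + 1)) (one_lt_two (α := ℝ))).imp fun _ h => h.le
  choose Q hQ using hQ
  obtain ⟨H, hH0, hHs⟩ : ∃ H : ℕ → ℕ, H 0 = 1 ∧
      ∀ k, H (k + 1) = 2 * H k + (Q k (H k) + k + 1 + H k) + 1 :=
    ⟨fun k => Nat.rec 1 (fun k h => 2 * h + (Q k h + k + 1 + h) + 1) k, rfl, fun _ => rfl⟩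
  let q : ℕ → ℕ := fun k => Q k (H k)
  let n : ℕ → ℕ := fun k => q k + k + 1 + H k
  have hq : ∀ k, ((2 : ℝ) ^ q k)⁻¹ * ‖u k‖ ≤ (1 / 2) ^ (k + 1) := fun k => by
    have h1 := hQ k (H k)
    have h2 : ‖u k‖ * 1 * 2 ^ (k + 1) ≤ ‖u k‖ * 18 ^ H k * 2 ^ (k + 1) := by
      gcongr
      exact one_le_pow₀ (by norm_num)
    rw [inv_mul_le_iff₀ (by positivity), one_div, inv_pow]
    field_simp
    linarith
  obtain ⟨Da, hDa1, hDa2, hDa3, hDa4⟩ := S.shift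
    (fun j : ℕ × ℤ => if 1 ≤ j.2 ∧ j.2 < n j.1 then 2 else 0) 2 (fun j => by
      split_ifs <;> simp)
  obtain ⟨Df, hDf1, hDf2, hDf3, hDf4⟩ := S.shift
    (fun j : ℕ × ℤ => if j.2 = 0 then ((ε * ‖u j.1‖ : ℝ) : 𝕜) * ((2 : 𝕜) ^ q j.1)⁻¹ else
      if -(H j.1 : ℤ) < j.2 ∧ j.2 < 0 then 6 else 0) 6 (fun j => by
      split_ifs
      · have h1 : ‖((ε * ‖u j.1‖ : ℝ) : 𝕜) * ((2 : 𝕜) ^ q j.1)⁻¹‖ =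
            ε * (((2 : ℝ) ^ q j.1)⁻¹ * ‖u j.1‖) := by
          rw [norm_mul, RCLike.norm_ofReal, abs_of_nonneg (by positivity)]
          simp only [norm_inv, norm_pow, RCLike.norm_ofNat]
          ring
        have h2 : ((1 : ℝ) / 2) ^ (j.1 + 1) ≤ 1 := pow_le_one₀ (by norm_num) (by norm_num)
        rw [h1]
        calc ε * (((2 : ℝ) ^ q j.1)⁻¹ * ‖u j.1‖) ≤ 1 * 1 := by
              gcongr
              exact (hq _).trans h2
          _ ≤ 6 := by norm_num
      · simp
      · simp)
  have hN : Summable fun k => (((2 : 𝕜) ^ q k)⁻¹ • c (k, 1)).smulRight (u k) := by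
    refine .of_norm_bounded ((summable_nat_add_iff 1).2 summable_geometric_two) fun k => ?_
    refine (ContinuousLinearMap.opNorm_le_bound _ (by positivity) fun x => ?_).trans (hq k)
    simp only [ContinuousLinearMap.smulRight_apply, _root_.smul_apply, norm_smul, norm_inv,
      norm_pow, RCLike.norm_ofNat]
    rw [mul_right_comm]
    gcongr
    exact S.norm_c _ _
  exact ⟨{
    H := H
    q := q
    n := n
    Da := Da
    Df := Df
    N := ∑' k, (((2 : 𝕜) ^ q k)⁻¹ • c (k, 1)).smulRight (u k)
    norm_e := S.norm_e
    norm_c := S.norm_c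
    c_e := S.c_e
    u_mem := hu
    n_eq := fun _ => rfl
    H_zero := hH0
    H_succ := hHs
    q_spec := fun k => hQ k (H k)
    norm_Da := hDa1
    norm_Df := hDf1
    hasSum_N := fun x => hN.hasSum.mapL (ContinuousLinearMap.apply 𝕜 X x)
    c_Da := hDa2
    c_Df := hDf2
    Da_e := hDa3
    Df_e := hDf3
    Da_eq_zero := hDa4
    Df_eq_zero := hDf4 }⟩

theorem exists_targets [TopologicalSpace.SeparableSpace X] (S : ShiftSystem 𝕜 e c) :
    ∃ u : ℕ → X, (∀ k, ∀ k' ≥ k, ∀ m, c (k', m) (u k) = 0) ∧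
      ∀ v, ∀ τ > 0, ∀ K, ∃ k ≥ K, ‖u k - v‖ ≤ τ := by
  classical
  have := UniformSpace.secondCountable_of_separable X
  let Y := {x : X // ∃ k, ∀ k' ≥ k, ∀ m, c (k', m) x = 0}
  have : Nonempty Y := ⟨0, 0, by simp⟩
  let y : ℕ → Y := TopologicalSpace.denseSeq Y
  refine ⟨fun k => if ∀ k' ≥ k, ∀ m, c (k', m) (y k.unpair.1 : X) = 0 then y k.unpair.1 else 0,
    fun k => ?_, fun v τ hτ K => ?_⟩
  · dsimp only
    split_ifs with h
    · exact h
    · simp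
  · obtain ⟨v', hv', hk⟩ := S.dense v (τ / 2) (by positivity)
    obtain ⟨i, hi⟩ := (TopologicalSpace.denseRange_denseSeq Y).exists_dist_lt ⟨v', hk⟩
      (by positivity : 0 < τ / 2)
    obtain ⟨k, hk⟩ := (y i).2
    refine ⟨Nat.pair i (max K k), (le_max_left _ _).trans (Nat.right_le_pair _ _), ?_⟩
    have h : ∀ k' ≥ Nat.pair i (max K k), ∀ m, c (k', m) (y i : X) = 0 := fun k' hk' =>
      hk k' (((le_max_right _ _).trans (Nat.right_le_pair _ _)).trans hk')
    simp only [Nat.unpair_pair]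
    rw [if_pos h]
    rw [Subtype.dist_eq, dist_eq_norm] at hi
    have h1 := norm_sub_le_norm_sub_add_norm_sub v v' (y i : X)
    rw [norm_sub_rev]
    change ‖v' - (y i : X)‖ < _ at hi
    linarith

theorem exists_eps_hypercyclic_not_hypercyclic [CompleteSpace X]
    [TopologicalSpace.SeparableSpace X] (S : ShiftSystem 𝕜 e c) {ε : ℝ}
    (hε : ε ∈ Set.Ioo (0 : ℝ) 1) :
    ∃ T : X →L[𝕜] X,
      (∃ x, ∀ u, u ≠ 0 → ∃ n : ℕ, ‖(T ^ n) x - u‖ ≤ ε * ‖u‖) ∧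
      ¬ ∃ x, Dense (Set.range fun n : ℕ => (T ^ n) x) := by
  obtain ⟨u, hu, hu'⟩ := S.exists_targets
  have h0 : 0 < ε / 2 := half_pos hε.1
  have h1 : ε / 2 ≤ 1 := by linarith [hε.2]
  obtain ⟨B⟩ := S.nonempty_blueprint h0 h1 hu
  have h := B.exists_eps_hypercyclic h0 h1 fun v _ => hu' v
  rw [mul_div_cancel₀ ε two_ne_zero] at h
  exact ⟨B.T, h, fun ⟨x, hx⟩ => B.not_dense_orbit h0 x hx⟩

end ShiftSystem

theorem lp.enorm_rpow_eq_tsum {J E : Type*} [NormedAddCommGroup E] {p : ℝ≥0∞}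
    [Fact (1 ≤ p)] (hp : 0 < p.toReal) (a : lp (fun _ : J => E) p) :
    ‖a‖ₑ ^ p.toReal = ∑' j, ‖a j‖ₑ ^ p.toReal := by
  have h (x : ℝ) (hx : 0 ≤ x) : ENNReal.ofReal x ^ p.toReal = ENNReal.ofReal (x ^ p.toReal) :=
    ENNReal.ofReal_rpow_of_nonneg hx hp.le
  simp only [← ofReal_norm, h _ (norm_nonneg _)]
  rw [lp.norm_rpow_eq_tsum hp, ENNReal.ofReal_tsum_of_nonneg (fun _ => by positivity)
    ((lp.memℓp a).summable hp)]

/-- Weighted composition with an injective map on `ℓᵖ`. -/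
theorem lp.exists_weightedComp {𝕜 J : Type*} [RCLike 𝕜] {p : ℝ≥0∞} [Fact (1 ≤ p)] (hp : p ≠ ⊤)
    {σ : J → J} (hσ : σ.Injective) (w : J → 𝕜) {M : ℝ} (hM : 0 ≤ M) (hw : ∀ j, ‖w j‖ ≤ M) :
    ∃ S : lp (fun _ : J => 𝕜) p →L[𝕜] lp (fun _ : J => 𝕜) p,
      (∀ a, ‖S a‖ ≤ M * ‖a‖) ∧ ∀ a j, S a j = w j * a (σ j) := by
  have hP : 0 < p.toReal := ENNReal.toReal_pos (zero_lt_one.trans_le Fact.out).ne' hp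
  have key : ∀ (a : lp (fun _ : J => 𝕜) p) (s : Finset J),
      ∑ j ∈ s, ‖w j * a (σ j)‖ ^ p.toReal ≤ (M * ‖a‖) ^ p.toReal := by
    intro a s
    calc ∑ j ∈ s, ‖w j * a (σ j)‖ ^ p.toReal ≤ ∑ j ∈ s, M ^ p.toReal * ‖a (σ j)‖ ^ p.toReal := by
          refine Finset.sum_le_sum fun j _ => ?_
          rw [norm_mul, Real.mul_rpow (norm_nonneg _) (norm_nonneg _)]
          gcongr
          exact hw j
      _ = M ^ p.toReal * ∑ j ∈ s.map ⟨σ, hσ⟩, ‖a j‖ ^ p.toReal := by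
          rw [← Finset.mul_sum, Finset.sum_map]; rfl
      _ ≤ M ^ p.toReal * ‖a‖ ^ p.toReal := by
          gcongr
          exact lp.sum_rpow_le_norm_rpow hP a _
      _ = _ := (Real.mul_rpow hM (norm_nonneg _)).symm
  let L : lp (fun _ : J => 𝕜) p →ₗ[𝕜] lp (fun _ : J => 𝕜) p :=
    { toFun := fun a => ⟨fun j => w j * a (σ j), memℓp_gen' (key a)⟩
      map_add' := fun a b => by
        ext j
        exact mul_add _ _ _
      map_smul' := fun r a => by
        ext j
        exact mul_left_comm _ _ _ }
  exact ⟨L.mkContinuous M fun a => lp.norm_le_of_forall_sum_le hP (by positivity) (key a),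
    fun a => lp.norm_le_of_forall_sum_le hP (by positivity) (key a), fun _ _ => rfl⟩

/-- A norm-one complemented copy of `ℓᵖ(ℕ × ℤ)` carries a shift system. -/
theorem ShiftSystem.of_retract {𝕜 : Type*} [RCLike 𝕜] {X : Type*} [NormedAddCommGroup X]
    [NormedSpace 𝕜 X] {p : ℝ≥0∞} [Fact (1 ≤ p)] (hp : p ≠ ⊤)
    (ι : lp (fun _ : ℕ × ℤ => 𝕜) p →L[𝕜] X) (π : X →L[𝕜] lp (fun _ : ℕ × ℤ => 𝕜) p)
    (hι : ∀ a, ‖ι a‖ ≤ ‖a‖) (hπ : ∀ x, ‖π x‖ ≤ ‖x‖) (hπι : ∀ a, π (ι a) = a) :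
    ShiftSystem 𝕜 (fun j => ι (lp.single p j (1 : 𝕜)))
      (fun j => (lp.evalCLM 𝕜 (fun _ : ℕ × ℤ => 𝕜) p j).comp π) where
  norm_e j := by
    refine (hι _).trans ?_
    rw [lp.norm_single (zero_lt_one.trans_le Fact.out), norm_one]
  norm_c j x := (lp.norm_apply_le_norm (zero_lt_one.trans_le Fact.out).ne' (π x) j).trans (hπ x)
  c_e i j := by
    change π (ι (lp.single p j (1 : 𝕜))) i = _
    rw [hπι, lp.single_apply, Pi.single_apply]
  shift w M hw := by
    obtain ⟨S, hS, hS'⟩ := lp.exists_weightedComp (𝕜 := 𝕜) hp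
      (σ := fun j : ℕ × ℤ => (j.1, j.2 + 1))
      (fun i j h => by simpa [Prod.ext_iff] using h) w ((norm_nonneg _).trans (hw 0)) hw
    have hM : 0 ≤ M := (norm_nonneg _).trans (hw 0)
    refine ⟨ι.comp (S.comp π), fun x => ?_, fun k m x => ?_, fun k m => ?_, fun x hx => ?_⟩
    · exact (hι _).trans ((hS _).trans (by gcongr; exact hπ x))
    · change π (ι (S (π x))) (k, m) = w (k, m) * π x (k, m + 1)
      rw [hπι, hS']
    · change ι (S (π (ι _))) = _
      rw [hπι, ← map_smul]
      congr 1
      ext j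
      rw [hS', lp.coeFn_smul, Pi.smul_apply, lp.single_apply, lp.single_apply, Pi.single_apply,
        Pi.single_apply]
      obtain ⟨i, l⟩ := j
      by_cases h : (i, l) = (k, m)
      · simp only [Prod.mk.injEq] at h
        simp [h.1, h.2]
      · rw [if_neg h, if_neg (by simpa [Prod.ext_iff] using h)]
        simp
    · have : π x = 0 := by
        ext j
        exact hx j
      change ι (S (π x)) = 0
      rw [this, map_zero, map_zero]
  dense x τ hτ := by
    obtain ⟨s, hs⟩ := ((lp.hasSum_single hp (π x)).eventually (Metric.ball_mem_nhds _ hτ)).exists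
    refine ⟨x - ι (π x) + ι (∑ j ∈ s, lp.single p j (π x j)), ?_, s.sup (fun j => j.1 + 1), ?_⟩
    · have h : x - (x - ι (π x) + ι (∑ j ∈ s, lp.single p j (π x j))) =
          ι (π x - ∑ j ∈ s, lp.single p j (π x j)) := by
        rw [map_sub]; abel
      rw [h]
      change dist (∑ j ∈ s, lp.single p j (π x j)) (π x) < τ at hs
      rw [dist_comm, dist_eq_norm] at hs
      exact (hι _).trans_lt hs
    · intro k hk m
      change π (x - ι (π x) + ι (∑ j ∈ s, lp.single p j (π x j))) (k, m) = 0
      rw [map_add, map_sub, hπι, hπι, sub_self, zero_add, lp.coeFn_sum, Finset.sum_apply]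
      refine Finset.sum_eq_zero fun j hj => ?_
      rw [lp.single_apply, Pi.single_apply, if_neg]
      rintro rfl
      have := Finset.le_sup (f := fun j : ℕ × ℤ => j.1 + 1) hj
      simp only at this
      omega

/-- Functions constant on each of countably many disjoint sets of positive finite measure form an
isometric copy of `ℓᵖ` in `Lᵖ`. -/
theorem MeasureTheory.Lp.exists_embedding_lp {𝕜 Ω J : Type*} [RCLike 𝕜] [Countable J]
    [MeasurableSpace Ω] {μ : Measure Ω} {p : ℝ≥0∞} [Fact (1 ≤ p)] (hp : p ≠ ⊤) {E : J → Set Ω}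
    (hE : ∀ j, MeasurableSet (E j)) (hd : Pairwise (Function.onFun Disjoint E))
    (h0 : ∀ j, μ (E j) ≠ 0) (ht : ∀ j, μ (E j) ≠ ⊤) :
    ∃ ι : lp (fun _ : J => 𝕜) p →L[𝕜] Lp 𝕜 p μ, (∀ a, ‖ι a‖ ≤ ‖a‖) ∧ ∀ a j,
      ∀ᵐ ω ∂μ.restrict (E j), ι a ω = a j * (((μ (E j)).toReal ^ (-(1 / p.toReal)) : ℝ) : 𝕜) := by
  have hp0 : p ≠ 0 := (zero_lt_one.trans_le Fact.out).ne'
  have hP : 0 < p.toReal := ENNReal.toReal_pos hp0 hp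
  let : MeasurableSpace (Option J) := ⊤
  obtain ⟨idx, hidx⟩ : ∃ idx : Ω → Option J, ∀ j ω, idx ω = some j ↔ ω ∈ E j := by
    have : ∀ ω, ∃ o : Option J, ∀ j, o = some j ↔ ω ∈ E j := fun ω => by
      by_cases h : ∃ j, ω ∈ E j
      · obtain ⟨j, hj⟩ := h
        refine ⟨some j, fun i => ⟨fun h => ?_, fun hi => ?_⟩⟩
        · obtain rfl : j = i := by simpa using h
          exact hj
        · by_contra hne
          exact (Set.disjoint_left.1 (hd fun h => hne (congrArg some h)) hj) hi
      · exact ⟨none, fun j => ⟨fun h => by simp at h, fun hj => (h ⟨j, hj⟩).elim⟩⟩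
    choose idx h using this
    exact ⟨idx, fun j ω => h ω j⟩
  have hpre : ∀ j, idx ⁻¹' {some j} = E j := fun j => by
    ext ω; simp [hidx]
  have hmeas : Measurable idx := by
    refine measurable_to_countable' fun o => ?_
    rcases o with _ | j
    · have : idx ⁻¹' {none} = (⋃ j, E j)ᶜ := by
        ext ω
        simp only [Set.mem_preimage, Set.mem_singleton_iff, Set.mem_compl_iff, Set.mem_iUnion,
          ← hidx, Option.eq_none_iff_forall_ne_some, not_exists]
      rw [this]
      exact (MeasurableSet.iUnion hE).compl
    · rw [hpre]; exact hE j
  let t : J → 𝕜 := fun j => (((μ (E j)).toReal ^ (-(1 / p.toReal)) : ℝ) : 𝕜)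
  have ht' : ∀ j, ‖t j‖ₑ ^ p.toReal * μ (E j) = 1 := fun j => by
    have hpos : 0 < (μ (E j)).toReal := ENNReal.toReal_pos (h0 j) (ht j)
    have h1 : ‖t j‖ₑ = μ (E j) ^ (-(1 / p.toReal)) := by
      rw [← ofReal_norm, RCLike.norm_ofReal, abs_of_nonneg (by positivity),
        ← ENNReal.ofReal_rpow_of_pos hpos, ENNReal.ofReal_toReal (ht j)]
    rw [h1, ← ENNReal.rpow_mul, show -(1 / p.toReal) * p.toReal = -1 by field_simp,
      ENNReal.rpow_neg_one, ENNReal.inv_mul_cancel (h0 j) (ht j)]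
  let h : lp (fun _ : J => 𝕜) p → Option J → 𝕜 := fun a o => o.elim 0 fun j => a j * t j
  have hF : ∀ a, eLpNorm (h a ∘ idx) p μ = ‖a‖ₑ := fun a => by
    rw [eLpNorm_eq_lintegral_rpow_enorm_toReal hp0 hp]
    have h1 := lintegral_map (μ := μ) (f := fun o => ‖h a o‖ₑ ^ p.toReal) (fun _ _ => trivial) hmeas
    simp only [Function.comp_apply]
    rw [← h1, lintegral_countable', ← (Option.some_injective J).tsum_eq]
    · have h2 : ∀ j, ‖h a (some j)‖ₑ ^ p.toReal * (μ.map idx) {some j} = ‖a j‖ₑ ^ p.toReal := by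
        intro j
        rw [Measure.map_apply hmeas trivial, hpre]
        change ‖a j * t j‖ₑ ^ p.toReal * _ = _
        rw [enorm_mul, ENNReal.mul_rpow_of_nonneg _ _ hP.le, mul_assoc, ht', mul_one]
      simp only [h2]
      rw [← lp.enorm_rpow_eq_tsum hP, ← ENNReal.rpow_mul, mul_one_div_cancel hP.ne',
        ENNReal.rpow_one]
    · intro o ho
      rcases o with _ | j
      · simp [h, hP] at ho
      · exact ⟨j, rfl⟩
  have hmem : ∀ a, MemLp (h a ∘ idx) p μ := fun a =>
    ⟨(Measurable.comp (g := h a) (fun _ _ => trivial) hmeas).aestronglyMeasurable, by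
      rw [hF]; exact enorm_lt_top⟩
  let L : lp (fun _ : J => 𝕜) p →ₗ[𝕜] Lp 𝕜 p μ :=
    { toFun := fun a => (hmem a).toLp _
      map_add' := fun a b => by
        rw [← MemLp.toLp_add]
        refine MemLp.toLp_congr _ _ (ae_of_all _ fun ω => ?_)
        simp only [h, Function.comp_apply, Pi.add_apply]
        rcases idx ω with _ | j
        · simp
        · exact add_mul _ _ _
      map_smul' := fun r a => by
        rw [RingHom.id_apply, ← MemLp.toLp_const_smul]
        refine MemLp.toLp_congr _ _ (ae_of_all _ fun ω => ?_)
        simp only [h, Function.comp_apply, Pi.smul_apply]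
        rcases idx ω with _ | j
        · simp
        · exact mul_assoc _ _ _ }
  have hL : ∀ a, ‖L a‖ ≤ 1 * ‖a‖ := fun a => by
    change ‖(hmem a).toLp _‖ ≤ _
    rw [Lp.norm_toLp, hF, toReal_enorm, one_mul]
  refine ⟨L.mkContinuous 1 hL, fun a => (hL a).trans_eq (one_mul _), fun a j => ?_⟩
  filter_upwards [ae_restrict_of_ae (hmem a).coeFn_toLp, ae_restrict_mem (hE j)] with ω h1 h2
  change (hmem a).toLp _ ω = _
  rw [h1, Function.comp_apply, (hidx j ω).2 h2]
  rfl

/-- Normalised averaging over countably many disjoint sets of finite measure maps `Lᵖ`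
contractively to `ℓᵖ`. -/
theorem MeasureTheory.Lp.exists_averaging_lp {𝕜 Ω J : Type*} [RCLike 𝕜] [Countable J]
    [MeasurableSpace Ω] {μ : Measure Ω} {p : ℝ≥0∞} [Fact (1 ≤ p)] (hp : p ≠ ⊤) {E : J → Set Ω}
    (hE : ∀ j, MeasurableSet (E j)) (hd : Pairwise (Function.onFun Disjoint E))
    (h0 : ∀ j, μ (E j) ≠ 0) (ht : ∀ j, μ (E j) ≠ ⊤) :
    ∃ π : Lp 𝕜 p μ →L[𝕜] lp (fun _ : J => 𝕜) p, (∀ f, ‖π f‖ ≤ ‖f‖) ∧ ∀ f j,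
      π f j = (((μ (E j)).toReal ^ (1 / p.toReal - 1) : ℝ) : 𝕜) * ∫ ω in E j, f ω ∂μ := by
  have hp0 : p ≠ 0 := (zero_lt_one.trans_le Fact.out).ne'
  have hP : 0 < p.toReal := ENNReal.toReal_pos hp0 hp
  have hfin : ∀ j, IsFiniteMeasure (μ.restrict (E j)) := fun j =>
    isFiniteMeasure_restrict.2 (ht j)
  let κ : J → 𝕜 := fun j => (((μ (E j)).toReal ^ (1 / p.toReal - 1) : ℝ) : 𝕜)
  have hκ : ∀ j, ‖κ j‖ₑ = μ (E j) ^ (1 / p.toReal - 1) := fun j => by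
    have hpos : 0 < (μ (E j)).toReal := ENNReal.toReal_pos (h0 j) (ht j)
    rw [← ofReal_norm, RCLike.norm_ofReal, abs_of_nonneg (by positivity),
      ← ENNReal.ofReal_rpow_of_pos hpos, ENNReal.ofReal_toReal (ht j)]
  have hloc : ∀ (f : Lp 𝕜 p μ) j, Integrable f (μ.restrict (E j)) := fun f j =>
    ((Lp.memLp f).mono_measure Measure.restrict_le_self).integrable Fact.out
  have hj : ∀ (f : Lp 𝕜 p μ) j, ‖κ j * ∫ ω in E j, f ω ∂μ‖ₑ ^ p.toReal ≤
      ∫⁻ ω in E j, ‖f ω‖ₑ ^ p.toReal ∂μ := fun f j => by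
    have h1 : ‖∫ ω in E j, f ω ∂μ‖ₑ ≤ eLpNorm f p (μ.restrict (E j)) *
        μ (E j) ^ (1 - 1 / p.toReal) := by
      refine (enorm_integral_le_lintegral_enorm _).trans ?_
      have h2 := eLpNorm_le_eLpNorm_mul_rpow_measure_univ (μ := μ.restrict (E j)) (f := f)
        (Fact.out : 1 ≤ p) (hloc f j).aestronglyMeasurable
      rwa [eLpNorm_one_eq_lintegral_enorm, Measure.restrict_apply_univ, ENNReal.toReal_one,
        div_one] at h2
    have h3 : ‖κ j * ∫ ω in E j, f ω ∂μ‖ₑ ≤ eLpNorm f p (μ.restrict (E j)) := by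
      rw [enorm_mul, hκ]
      calc _ ≤ μ (E j) ^ (1 / p.toReal - 1) * (eLpNorm f p (μ.restrict (E j)) *
            μ (E j) ^ (1 - 1 / p.toReal)) := by gcongr
        _ = eLpNorm f p (μ.restrict (E j)) *
            (μ (E j) ^ (1 / p.toReal - 1) * μ (E j) ^ (1 - 1 / p.toReal)) := by ring
        _ = _ := by
          rw [← ENNReal.rpow_add _ _ (h0 j) (ht j), sub_add_sub_cancel, sub_self,
            ENNReal.rpow_zero, mul_one]
    refine (ENNReal.rpow_le_rpow h3 hP.le).trans_eq ?_
    rw [eLpNorm_eq_lintegral_rpow_enorm_toReal hp0 hp, ← ENNReal.rpow_mul,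
      one_div_mul_cancel hP.ne', ENNReal.rpow_one]
  have key : ∀ (f : Lp 𝕜 p μ) (s : Finset J),
      ∑ j ∈ s, ‖κ j * ∫ ω in E j, f ω ∂μ‖ ^ p.toReal ≤ ‖f‖ ^ p.toReal := fun f s => by
    rw [← ENNReal.ofReal_le_ofReal_iff (by positivity),
      ENNReal.ofReal_sum_of_nonneg fun _ _ => by positivity]
    calc ∑ j ∈ s, ENNReal.ofReal (‖κ j * ∫ ω in E j, f ω ∂μ‖ ^ p.toReal)
        = ∑ j ∈ s, ‖κ j * ∫ ω in E j, f ω ∂μ‖ₑ ^ p.toReal := by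
          refine Finset.sum_congr rfl fun j _ => ?_
          rw [← ENNReal.ofReal_rpow_of_nonneg (norm_nonneg _) hP.le, ofReal_norm]
      _ ≤ ∑' j, ∫⁻ ω in E j, ‖f ω‖ₑ ^ p.toReal ∂μ :=
          (Finset.sum_le_sum fun j _ => hj f j).trans (ENNReal.sum_le_tsum s)
      _ = ∫⁻ ω in ⋃ j, E j, ‖f ω‖ₑ ^ p.toReal ∂μ := (lintegral_iUnion hE hd _).symm
      _ ≤ ∫⁻ ω, ‖f ω‖ₑ ^ p.toReal ∂μ := setLIntegral_le_lintegral _ _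
      _ = eLpNorm f p μ ^ p.toReal := by
          rw [eLpNorm_eq_lintegral_rpow_enorm_toReal hp0 hp, ← ENNReal.rpow_mul,
            one_div_mul_cancel hP.ne', ENNReal.rpow_one]
      _ = ENNReal.ofReal (‖f‖ ^ p.toReal) := by
          rw [← ENNReal.ofReal_rpow_of_nonneg (norm_nonneg _) hP.le, Lp.norm_def,
            ENNReal.ofReal_toReal (Lp.eLpNorm_lt_top f).ne]
  let L : Lp 𝕜 p μ →ₗ[𝕜] lp (fun _ : J => 𝕜) p :=
    { toFun := fun f => ⟨fun j => κ j * ∫ ω in E j, f ω ∂μ, memℓp_gen' (key f)⟩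
      map_add' := fun f g => by
        ext j
        change κ j * ∫ ω in E j, (f + g : Lp 𝕜 p μ) ω ∂μ =
          κ j * ∫ ω in E j, f ω ∂μ + κ j * ∫ ω in E j, g ω ∂μ
        rw [integral_congr_ae (ae_restrict_of_ae (Lp.coeFn_add f g)), ← mul_add]
        congr 1
        exact integral_add (hloc f j) (hloc g j)
      map_smul' := fun r f => by
        ext j
        change κ j * ∫ ω in E j, (r • f : Lp 𝕜 p μ) ω ∂μ = r * (κ j * ∫ ω in E j, f ω ∂μ)
        rw [integral_congr_ae (ae_restrict_of_ae (Lp.coeFn_smul r f)), mul_left_comm]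
        congr 1
        exact integral_const_mul r _ }
  have hL : ∀ f, ‖L f‖ ≤ ‖f‖ := fun f =>
    lp.norm_le_of_forall_sum_le hP (norm_nonneg _) (key f)
  exact ⟨L.mkContinuous 1 fun f => (hL f).trans_eq (one_mul _).symm, hL, fun _ _ => rfl⟩

theorem MeasureTheory.Lp.exists_shiftSystem {𝕜 Ω : Type*} [RCLike 𝕜]
    [MeasurableSpace Ω] {μ : Measure Ω} {p : ℝ≥0∞} [Fact (1 ≤ p)] (hp : p ≠ ⊤)
    {E : ℕ × ℤ → Set Ω} (hE : ∀ j, MeasurableSet (E j))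
    (hd : Pairwise (Function.onFun Disjoint E)) (h0 : ∀ j, μ (E j) ≠ 0) (ht : ∀ j, μ (E j) ≠ ⊤) :
    ∃ (e : ℕ × ℤ → Lp 𝕜 p μ) (c : ℕ × ℤ → Lp 𝕜 p μ →L[𝕜] 𝕜), ShiftSystem 𝕜 e c := by
  obtain ⟨ι, hι, hι'⟩ := Lp.exists_embedding_lp (𝕜 := 𝕜) hp hE hd h0 ht
  obtain ⟨π, hπ, hπ'⟩ := Lp.exists_averaging_lp (𝕜 := 𝕜) hp hE hd h0 ht
  refine ⟨_, _, ShiftSystem.of_retract hp ι π hι hπ fun a => ?_⟩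
  ext j
  have hpos : 0 < (μ (E j)).toReal := ENNReal.toReal_pos (h0 j) (ht j)
  rw [hπ', integral_congr_ae (hι' a j), setIntegral_const, measureReal_def, RCLike.real_smul_eq_coe_mul]
  have h1 : (μ (E j)).toReal ^ (1 / p.toReal - 1) * ((μ (E j)).toReal *
      (μ (E j)).toReal ^ (-(1 / p.toReal))) = 1 := by
    nth_rewrite 2 [← Real.rpow_one (μ (E j)).toReal]
    rw [← Real.rpow_add hpos, ← Real.rpow_add hpos]
    ring_nf
    exact Real.rpow_zero _
  rw [mul_left_comm _ (a j), mul_left_comm _ (a j), ← RCLike.ofReal_mul, ← RCLike.ofReal_mul, h1,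
    RCLike.ofReal_one, mul_one]

namespace MeasureTheory.Lp

variable {𝕜 Ω : Type*} [RCLike 𝕜] [MeasurableSpace Ω]

variable (𝕜) in
/-- The span in `Lᵖ` of the indicators of finite-measure measurable subsets of `A`. -/
def indicatorSpan (p : ℝ≥0∞) (μ : Measure Ω) (A : Set Ω) : Submodule 𝕜 (Lp 𝕜 p μ) :=
  Submodule.span 𝕜 {f | ∃ (s : Set Ω) (hs : MeasurableSet s) (hμ : μ s ≠ ⊤),
    s ⊆ A ∧ f = indicatorConstLp p hs hμ 1}

variable {p : ℝ≥0∞} {μ : Measure Ω}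

theorem indicatorConstLp_mem_indicatorSpan {A s : Set Ω} (hs : MeasurableSet s) (hμ : μ s ≠ ⊤)
    (h : s ⊆ A) : indicatorConstLp p hs hμ (1 : 𝕜) ∈ indicatorSpan 𝕜 p μ A :=
  Submodule.subset_span ⟨s, hs, hμ, h, rfl⟩

theorem indicatorSpan_mono {A B : Set Ω} (h : A ⊆ B) :
    indicatorSpan 𝕜 p μ A ≤ indicatorSpan 𝕜 p μ B :=
  Submodule.span_mono fun _ ⟨s, hs, hμ, hA, hf⟩ => ⟨s, hs, hμ, hA.trans h, hf⟩

theorem indicatorSpan_le_sup (A : Set Ω) {B : Set Ω} (hB : MeasurableSet B) :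
    indicatorSpan 𝕜 p μ A ≤ indicatorSpan 𝕜 p μ B ⊔ indicatorSpan 𝕜 p μ (A \ B) := by
  refine Submodule.span_le.2 ?_
  rintro _ ⟨s, hs, hμ, hA, rfl⟩
  have h1 : μ (s ∩ B) ≠ ⊤ := measure_ne_top_of_subset Set.inter_subset_left hμ
  have h2 : μ (s \ B) ≠ ⊤ := measure_ne_top_of_subset Set.sdiff_subset hμ
  have h := indicatorConstLp_disjoint_union (p := p) (hs.inter hB) (hs.diff hB) h1 h2
    (Set.disjoint_sdiff_inter.symm) (1 : 𝕜)
  simp only [Set.inter_union_sdiff] at h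
  rw [SetLike.mem_coe, h]
  exact Submodule.add_mem_sup (indicatorConstLp_mem_indicatorSpan _ _ Set.inter_subset_right)
    (indicatorConstLp_mem_indicatorSpan _ _ (Set.sdiff_subset_sdiff_left hA))

theorem indicatorSpan_univ [Fact (1 ≤ p)] (hp : p ≠ ⊤)
    (h : IsClosed (indicatorSpan 𝕜 p μ Set.univ : Set (Lp 𝕜 p μ))) :
    indicatorSpan 𝕜 p μ Set.univ = ⊤ := by
  rw [eq_top_iff]
  rintro f -
  refine Lp.induction hp (fun f => f ∈ indicatorSpan 𝕜 p μ Set.univ) (fun c s hs hμ => ?_)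
    (fun f g _ _ _ hf hg => add_mem hf hg) h f
  rw [Lp.simpleFunc.coe_indicatorConst]
  have : indicatorConstLp p hs hμ.ne c = c • indicatorConstLp p hs hμ.ne (1 : 𝕜) := by
    refine Lp.ext ?_
    filter_upwards [indicatorConstLp_coeFn (p := p) (hs := hs) (hμs := hμ.ne) (c := c),
      indicatorConstLp_coeFn (p := p) (hs := hs) (hμs := hμ.ne) (c := (1 : 𝕜)),
      Lp.coeFn_smul c (indicatorConstLp p hs hμ.ne (1 : 𝕜))] with ω h1 h2 h3
    rw [h1, h3, Pi.smul_apply, h2]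
    by_cases hω : ω ∈ s <;> simp [hω]
  rw [this]
  exact Submodule.smul_mem _ _ (indicatorConstLp_mem_indicatorSpan _ _ (Set.subset_univ _))

theorem measure_ne_zero_of_indicatorConstLp_ne_zero {s : Set Ω} {hs : MeasurableSet s}
    {hμ : μ s ≠ ⊤} (h : indicatorConstLp p hs hμ (1 : 𝕜) ≠ 0) : μ s ≠ 0 := fun h0 =>
  h ((indicatorConstLp_inj hs hμ .empty (by simp) one_ne_zero).2 (ae_eq_empty.2 h0) |>.trans
    indicatorConstLp_empty)

theorem exists_indicatorConstLp_notMem_span {A : Set Ω}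
    (hA : ¬ FiniteDimensional 𝕜 (indicatorSpan 𝕜 p μ A)) (f : Lp 𝕜 p μ) :
    ∃ (s : Set Ω) (hs : MeasurableSet s) (hμ : μ s ≠ ⊤), s ⊆ A ∧
      indicatorConstLp p hs hμ 1 ∉ Submodule.span 𝕜 {f} := by
  by_contra! h
  refine hA (Submodule.finiteDimensional_of_le (S₂ := Submodule.span 𝕜 {f})
    (Submodule.span_le.2 ?_))
  rintro _ ⟨s, hs, hμ, hsA, rfl⟩
  exact h s hs hμ hsA

theorem exists_disjoint_of_not_finiteDimensional {A : Set Ω}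
    (hA : ¬ FiniteDimensional 𝕜 (indicatorSpan 𝕜 p μ A)) :
    ∃ B C, (MeasurableSet B ∧ B ⊆ A ∧ μ B ≠ 0 ∧ μ B ≠ ⊤) ∧
      (MeasurableSet C ∧ C ⊆ A ∧ μ C ≠ 0 ∧ μ C ≠ ⊤) ∧ Disjoint B C := by
  obtain ⟨s, hs, hsμ, hsA, h1⟩ := exists_indicatorConstLp_notMem_span hA 0
  obtain ⟨t, ht, htμ, htA, h2⟩ :=
    exists_indicatorConstLp_notMem_span hA (indicatorConstLp p hs hsμ 1)
  have hs0 : μ s ≠ 0 := measure_ne_zero_of_indicatorConstLp_ne_zero (p := p) (𝕜 := 𝕜)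
    (hs := hs) (hμ := hsμ) fun h => h1 (by rw [h]; exact Submodule.zero_mem _)
  have ht0 : μ t ≠ 0 := measure_ne_zero_of_indicatorConstLp_ne_zero (p := p) (𝕜 := 𝕜)
    (hs := ht) (hμ := htμ) fun h => h2 (by rw [h]; exact Submodule.zero_mem _)
  by_cases h3 : μ (s \ t) = 0
  · by_cases h4 : μ (t \ s) = 0
    · refine (h2 ?_).elim
      rw [(indicatorConstLp_inj (p := p) ht htμ hs hsμ (one_ne_zero (α := 𝕜))).2
        ((ae_le_set.2 h4).antisymm (ae_le_set.2 h3))]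
      exact Submodule.mem_span_singleton_self _
    · exact ⟨t \ s, s, ⟨ht.diff hs, Set.sdiff_subset.trans htA, h4,
        measure_ne_top_of_subset Set.sdiff_subset htμ⟩, ⟨hs, hsA, hs0, hsμ⟩,
        Set.disjoint_sdiff_left⟩
  · exact ⟨s \ t, t, ⟨hs.diff ht, Set.sdiff_subset.trans hsA, h3,
      measure_ne_top_of_subset Set.sdiff_subset hsμ⟩, ⟨ht, htA, ht0, htμ⟩,
      Set.disjoint_sdiff_left⟩

theorem exists_sdiff_not_finiteDimensional {A : Set Ω}
    (hA : ¬ FiniteDimensional 𝕜 (indicatorSpan 𝕜 p μ A)) :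
    ∃ B, (MeasurableSet B ∧ B ⊆ A ∧ μ B ≠ 0 ∧ μ B ≠ ⊤) ∧
      ¬ FiniteDimensional 𝕜 (indicatorSpan 𝕜 p μ (A \ B)) := by
  obtain ⟨B, C, hB, hC, hBC⟩ := exists_disjoint_of_not_finiteDimensional hA
  by_cases h : FiniteDimensional 𝕜 (indicatorSpan 𝕜 p μ (A \ B))
  · refine ⟨C, hC, fun h' => hA ?_⟩
    have : FiniteDimensional 𝕜 (indicatorSpan 𝕜 p μ B) :=
      Submodule.finiteDimensional_of_le
        (indicatorSpan_mono (Set.subset_sdiff.2 ⟨hB.2.1, hBC⟩))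
    exact Submodule.finiteDimensional_of_le (indicatorSpan_le_sup A hB.1)
  · exact ⟨B, hB, h⟩

theorem exists_pairwise_disjoint [Fact (1 ≤ p)] (hp : p ≠ ⊤)
    (hinf : ¬ FiniteDimensional 𝕜 (Lp 𝕜 p μ)) :
    ∃ E : ℕ → Set Ω, (∀ i, MeasurableSet (E i)) ∧ Pairwise (Function.onFun Disjoint E) ∧
      (∀ i, μ (E i) ≠ 0) ∧ ∀ i, μ (E i) ≠ ⊤ := by
  have huniv : ¬ FiniteDimensional 𝕜 (indicatorSpan 𝕜 p μ Set.univ) := fun h => by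
    have h1 := indicatorSpan_univ (𝕜 := 𝕜) (μ := μ) hp (Submodule.closed_of_finiteDimensional _)
    rw [h1] at h
    exact hinf (Module.finite_def.2 (Submodule.fg_top _ |>.1 (Module.finite_def.1 h)))
  have hstep : ∀ A : {A : Set Ω // ¬ FiniteDimensional 𝕜 (indicatorSpan 𝕜 p μ A)}, ∃ B,
      (MeasurableSet B ∧ B ⊆ A.1 ∧ μ B ≠ 0 ∧ μ B ≠ ⊤) ∧
      ¬ FiniteDimensional 𝕜 (indicatorSpan 𝕜 p μ (A.1 \ B)) := fun A =>
    exists_sdiff_not_finiteDimensional A.2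
  choose B hB hB' using hstep
  obtain ⟨A, hA⟩ : ∃ A : ℕ → {A : Set Ω // ¬ FiniteDimensional 𝕜 (indicatorSpan 𝕜 p μ A)},
      ∀ n, (A (n + 1)).1 = (A n).1 \ B (A n) :=
    ⟨fun n => Nat.rec ⟨Set.univ, huniv⟩ (fun _ A => ⟨A.1 \ B A, hB' A⟩) n, fun _ => rfl⟩
  have hanti : Antitone fun n => (A n).1 :=
    antitone_nat_of_succ_le fun n => by rw [hA]; exact Set.sdiff_subset
  refine ⟨fun n => B (A n), fun n => (hB _).1, (pairwise_disjoint_on _).2 fun m n hmn => ?_,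
    fun n => (hB _).2.2.1, fun n => (hB _).2.2.2⟩
  have h1 : B (A n) ⊆ (A m).1 \ B (A m) := by
    rw [← hA]
    exact (hB _).2.1.trans (hanti (Nat.succ_le_of_lt hmn))
  exact Set.disjoint_sdiff_right.mono_right h1

end MeasureTheory.Lp

/-- For `p ∈ [1,∞)` and a measure space such that `Lᵖ(μ)` (scalar-valued, scalars `ℝ` or
`ℂ`) is separable and infinite-dimensional, the space `Lᵖ(μ)` admits, for every
`ε ∈ (0,1)`, a bounded operator which is ε-hypercyclic but not hypercyclic. -/
theorem Lp_admits_eps_hypercyclic_not_hypercyclic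
    {𝕜 : Type*} [RCLike 𝕜] {Ω : Type*} [MeasurableSpace Ω] (μ : Measure Ω)
    (p : ℝ≥0∞) [Fact (1 ≤ p)] (hp : p ≠ ⊤)
    [TopologicalSpace.SeparableSpace (Lp 𝕜 p μ)]
    (hinf : ¬ FiniteDimensional 𝕜 (Lp 𝕜 p μ))
    {ε : ℝ} (hε : ε ∈ Set.Ioo (0 : ℝ) 1) :
    ∃ T : Lp 𝕜 p μ →L[𝕜] Lp 𝕜 p μ,
      (∃ x, ∀ u, u ≠ 0 → ∃ n : ℕ, ‖(T ^ n) x - u‖ ≤ ε * ‖u‖) ∧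
      ¬ ∃ x, Dense (Set.range fun n : ℕ => (T ^ n) x) := by
  obtain ⟨E, hE, hd, h0, ht⟩ := Lp.exists_pairwise_disjoint hp hinf
  obtain ⟨e, c, S⟩ := Lp.exists_shiftSystem (𝕜 := 𝕜) hp
    (fun j : ℕ × ℤ => hE (Denumerable.eqv _ j))
    (fun i j hij => hd ((Denumerable.eqv (ℕ × ℤ)).injective.ne hij)) (fun _ => h0 _) fun _ => ht _
  exact S.exists_eps_hypercyclic_not_hypercyclic hε
end

section
/- Let X be a separable infinite-dimensional Banach space that contains a closed subspace isomorphic to c₀(ℕ). Then for every ε ∈ (0,1), X admits a bounded linear operator that is ε-hypercyclic but not hypercyclic. -/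
open Filter Topology

/-- Starting points of the blocks into which the coordinates are divided. -/
def blockStart : ℕ → ℕ
  | 0 => 0
  | k + 1 => 4 * blockStart k + 192

/-- The index of the block containing `i`. -/
def blockIndex (i : ℕ) : ℕ := Nat.findGreatest (fun k => blockStart k ≤ i) i

theorem blockStart_succ (k : ℕ) : blockStart (k + 1) = 4 * blockStart k + 192 := rfl

theorem sq_le_blockStart (k : ℕ) : 192 * k ^ 2 ≤ blockStart k := by
  induction k with
  | zero => simp
  | succ k ih =>
    have := Nat.le_self_pow (n := 2) (by norm_num) k
    simp only [blockStart]
    nlinarith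

theorem mul_le_blockStart (k : ℕ) : 192 * k ≤ blockStart k := by
  have := sq_le_blockStart k
  nlinarith [Nat.le_self_pow (n := 2) (by norm_num) k]

theorem blockStart_strictMono : StrictMono blockStart :=
  strictMono_nat_of_lt_succ fun k => by simp only [blockStart]; omega

theorem blockStart_blockIndex_le (i : ℕ) : blockStart (blockIndex i) ≤ i :=
  Nat.findGreatest_spec (P := fun k => blockStart k ≤ i) (Nat.zero_le i) (by simp [blockStart])

theorem blockIndex_le (i : ℕ) : blockIndex i ≤ i := Nat.findGreatest_le i

theorem lt_blockStart_succ (i : ℕ) : i < blockStart (blockIndex i + 1) := by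
  by_contra! h
  have h1 : blockIndex i + 1 ≤ i := by
    have := mul_le_blockStart (blockIndex i + 1)
    omega
  have := Nat.le_findGreatest (P := fun k => blockStart k ≤ i) h1 h
  change blockIndex i + 1 ≤ blockIndex i at this
  omega

theorem blockIndex_eq {i k : ℕ} (h₁ : blockStart k ≤ i) (h₂ : i < blockStart (k + 1)) :
    blockIndex i = k := by
  have h3 := blockStart_blockIndex_le i
  have h4 := lt_blockStart_succ i
  have h5 := blockStart_strictMono.lt_iff_lt.1 (h3.trans_lt h₂)
  have h6 := blockStart_strictMono.lt_iff_lt.1 (h₁.trans_lt h4)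
  omega

theorem blockIndex_blockStart (k : ℕ) : blockIndex (blockStart k) = k :=
  blockIndex_eq le_rfl (blockStart_strictMono (Nat.lt_succ_self k))

theorem two_zpow_le {a b : ℤ} (h : a ≤ b) : (2 : ℝ) ^ a ≤ 2 ^ b :=
  zpow_le_zpow_right₀ (by norm_num) h

theorem two_zpow_mul (a b : ℤ) : (2 : ℝ) ^ a * 2 ^ b = 2 ^ (a + b) :=
  (zpow_add₀ (by norm_num) a b).symm

section Moments

variable {𝕜 : Type*} [RCLike 𝕜]

/-- The coefficient of `e i` in `T ^ i (e 0)`. -/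
noncomputable def orbitCoeff (𝕜 : Type*) [RCLike 𝕜] (b : ℕ → ℝ) (i : ℕ) : 𝕜 :=
  ((b (blockIndex i) * 256 ^ (i - blockStart (blockIndex i)) : ℝ) : 𝕜)

/-- If `q k` is the polynomial with `q k (T) (e 0) = ∑ i < k, η k i • e i`, then
`targetEval η b k a` is the value at `q k` of the linear map sending `X ^ t` to `a t`. -/
noncomputable def targetEval {V : Type*} [AddCommGroup V] [Module 𝕜 V] (η : ℕ → ℕ → 𝕜)
    (b : ℕ → ℝ) : ℕ → (ℕ → V) → V
  | k, a => ∑ i : Fin k, (η k i * (orbitCoeff 𝕜 b i)⁻¹) •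
      (a i - targetEval η b (blockIndex i)
        fun t => a (i - blockStart (blockIndex i) + t))
termination_by k => k
decreasing_by exact (blockIndex_le _).trans_lt i.2

/-- The value, at the polynomial `p` with `p (T) (e 0) = e i`, of the linear map
sending `X ^ t` to `a t`. -/
noncomputable def basisEval {V : Type*} [AddCommGroup V] [Module 𝕜 V] (η : ℕ → ℕ → 𝕜)
    (b : ℕ → ℝ) (i : ℕ) (a : ℕ → V) : V :=
  (orbitCoeff 𝕜 b i)⁻¹ •
    (a i - targetEval η b (blockIndex i) fun t => a (i - blockStart (blockIndex i) + t))

variable {V W : Type*} [AddCommGroup V] [Module 𝕜 V] [AddCommGroup W] [Module 𝕜 W]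
  (η : ℕ → ℕ → 𝕜) (b : ℕ → ℝ)

theorem targetEval_eq_sum (k : ℕ) (a : ℕ → V) :
    targetEval η b k a = ∑ i ∈ Finset.range k, η k i • basisEval η b i a := by
  rw [targetEval, Finset.sum_range]
  simp only [basisEval, mul_smul]

theorem targetEval_zero (a : ℕ → V) : targetEval η b 0 a = 0 := by
  simp [targetEval_eq_sum]

theorem targetEval_congr (k : ℕ) {a a' : ℕ → V} (h : ∀ t < k, a t = a' t) :
    targetEval η b k a = targetEval η b k a' := by
  induction k using Nat.strong_induction_on generalizing a a' with
  | _ k ih =>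
    rw [targetEval_eq_sum, targetEval_eq_sum]
    refine Finset.sum_congr rfl fun i hi => ?_
    have hi := Finset.mem_range.1 hi
    have h1 := blockIndex_le i
    have h2 := blockStart_blockIndex_le i
    have h3 := mul_le_blockStart (blockIndex i)
    simp only [basisEval]
    rw [h i hi, ih _ (by omega) fun t ht => h _ (by omega)]

theorem basisEval_congr (i : ℕ) {a a' : ℕ → V} (h : ∀ t ≤ i, a t = a' t) :
    basisEval η b i a = basisEval η b i a' := by
  have h2 := blockStart_blockIndex_le i
  have h3 := mul_le_blockStart (blockIndex i)
  simp only [basisEval]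
  rw [h i le_rfl, targetEval_congr η b _ fun t ht => h _ (by omega)]

theorem map_targetEval (L : V →ₗ[𝕜] W) (k : ℕ) (a : ℕ → V) :
    L (targetEval η b k a) = targetEval η b k fun t => L (a t) := by
  induction k using Nat.strong_induction_on generalizing a with
  | _ k ih =>
    rw [targetEval_eq_sum, targetEval_eq_sum, map_sum]
    refine Finset.sum_congr rfl fun i hi => ?_
    have hi := Finset.mem_range.1 hi
    have h1 := blockIndex_le i
    simp only [basisEval, map_smul, map_sub]
    rw [ih _ (by omega)]

theorem map_basisEval (L : V →ₗ[𝕜] W) (i : ℕ) (a : ℕ → V) :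
    L (basisEval η b i a) = basisEval η b i fun t => L (a t) := by
  simp only [basisEval, map_smul, map_sub, map_targetEval]

theorem targetEval_const_zero (k : ℕ) : targetEval η b k (fun _ => (0 : V)) = 0 := by
  simpa using (map_targetEval η b (0 : V →ₗ[𝕜] V) k fun _ => 0).symm

theorem targetEval_sub (k : ℕ) (a a' : ℕ → V) :
    targetEval η b k (fun t => a t - a' t) = targetEval η b k a - targetEval η b k a' := by
  induction k using Nat.strong_induction_on generalizing a a' with
  | _ k ih =>
    rw [targetEval_eq_sum, targetEval_eq_sum, targetEval_eq_sum, ← Finset.sum_sub_distrib]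
    refine Finset.sum_congr rfl fun i hi => ?_
    have hi := Finset.mem_range.1 hi
    have h1 := blockIndex_le i
    simp only [basisEval]
    rw [ih _ (by omega), ← smul_sub, ← smul_sub]
    congr 2
    abel

/-- Shifting the moments by `m` inside a block. -/
theorem orbitCoeff_smul_basisEval_shift {i m : ℕ} (hm : blockIndex (m + i) = blockIndex i)
    (hc : orbitCoeff 𝕜 b i ≠ 0) (hc' : orbitCoeff 𝕜 b (m + i) ≠ 0) (a : ℕ → V) :
    orbitCoeff 𝕜 b i • basisEval η b i (fun t => a (m + t)) =
      orbitCoeff 𝕜 b (m + i) • basisEval η b (m + i) a := by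
  have h2 := blockStart_blockIndex_le i
  simp only [basisEval]
  rw [smul_inv_smul₀ hc, smul_inv_smul₀ hc', hm]
  congr 3
  ext t
  congr 1
  omega

end Moments

section Estimates

variable {𝕜 : Type*} [RCLike 𝕜]

/-- Size conditions on the coordinates `η k` of the targets and on the weights `b k`. -/
structure Admissible (η : ℕ → ℕ → 𝕜) (b : ℕ → ℝ) (A : ℝ) : Prop where
  nonneg : 0 ≤ A
  zero : b 0 = 1
  lower : ∀ k : ℕ, (2 : ℝ) ^ (-k : ℤ) ≤ b k
  upper : ∀ k : ℕ, b k ≤ (2 : ℝ) ^ (k : ℤ)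
  sum_le : ∀ k : ℕ, ∑ i ∈ Finset.range k, ‖η k i‖ ≤ (2 : ℝ) ^ (k : ℤ)
  le_mul : ∀ k i : ℕ, ‖η k i‖ ≤ A * b k

variable {η : ℕ → ℕ → 𝕜} {b : ℕ → ℝ} {A : ℝ}

theorem Admissible.pos (h : Admissible η b A) (k : ℕ) : 0 < b k :=
  lt_of_lt_of_le (by positivity) (h.lower k)

theorem norm_orbitCoeff (h : Admissible η b A) (i : ℕ) :
    ‖orbitCoeff 𝕜 b i‖ =
      b (blockIndex i) * 2 ^ (8 * ((i : ℤ) - blockStart (blockIndex i))) := by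
  have h2 := blockStart_blockIndex_le i
  have hp := h.pos (blockIndex i)
  rw [orbitCoeff, RCLike.norm_ofReal, abs_of_nonneg (by positivity), zpow_mul,
    ← Nat.cast_sub h2, zpow_natCast]
  norm_num

theorem orbitCoeff_ne_zero (h : Admissible η b A) (i : ℕ) : orbitCoeff 𝕜 b i ≠ 0 := by
  have hp := h.pos (blockIndex i)
  rw [← norm_pos_iff, norm_orbitCoeff h]
  positivity

theorem norm_orbitCoeff_le (h : Admissible η b A) (i : ℕ) :
    ‖orbitCoeff 𝕜 b i‖ ≤
      2 ^ (blockIndex i + 8 * ((i : ℤ) - blockStart (blockIndex i))) := by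
  rw [norm_orbitCoeff h, ← two_zpow_mul]
  gcongr
  exact h.upper _

theorem norm_inv_orbitCoeff_le (h : Admissible η b A) (i : ℕ) :
    ‖(orbitCoeff 𝕜 b i)⁻¹‖ ≤
      2 ^ (blockIndex i - 8 * ((i : ℤ) - blockStart (blockIndex i))) := by
  rw [norm_inv, norm_orbitCoeff h, mul_inv, sub_eq_add_neg (blockIndex i : ℤ), ← two_zpow_mul, zpow_neg]
  gcongr
  have := h.lower (blockIndex i)
  rw [zpow_neg] at this
  exact inv_le_of_inv_le₀ (by positivity) this

variable {V : Type*} [NormedAddCommGroup V] [NormedSpace 𝕜 V]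

theorem norm_basisEval_le (h : Admissible η b A) (i : ℕ) (a : ℕ → V) {M N : ℝ}
    (hM : ‖a i‖ ≤ M)
    (hN : ‖targetEval η b (blockIndex i) fun t => a (i - blockStart (blockIndex i) + t)‖ ≤ N) :
    ‖basisEval η b i a‖ ≤
      2 ^ (blockIndex i - 8 * ((i : ℤ) - blockStart (blockIndex i))) * (M + N) := by
  rw [basisEval, norm_smul]
  gcongr
  · exact norm_inv_orbitCoeff_le h i
  · exact (norm_sub_le _ _).trans (add_le_add hM hN)

theorem norm_targetEval_le_sum (k : ℕ) (a : ℕ → V) :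
    ‖targetEval η b k a‖ ≤ ∑ i ∈ Finset.range k, ‖η k i‖ * ‖basisEval η b i a‖ := by
  rw [targetEval_eq_sum]
  refine (norm_sum_le _ _).trans_eq ?_
  simp only [norm_smul]

theorem norm_targetEval_le (h : Admissible η b A) (k : ℕ) (a : ℕ → V) {M : ℝ} (hM : 0 ≤ M)
    (ha : ∀ t < k, ‖a t‖ ≤ M) :
    ‖targetEval η b k a‖ ≤ 2 ^ ((k : ℤ) ^ 2 + k) * M := by
  induction k using Nat.strong_induction_on generalizing a with
  | _ k ih =>
    have key : ∀ i ∈ Finset.range k, ‖η k i‖ * ‖basisEval η b i a‖ ≤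
        ‖η k i‖ * (2 ^ ((k : ℤ) ^ 2) * M) := by
      intro i hi
      have hi := Finset.mem_range.1 hi
      have h1 := blockIndex_le i
      have h2 := blockStart_blockIndex_le i
      have h3 := mul_le_blockStart (blockIndex i)
      gcongr
      refine (norm_basisEval_le h i a (ha i hi)
        (ih _ (by omega) _ fun t ht => ha _ (by omega))).trans ?_
      rw [show M + (2 : ℝ) ^ ((blockIndex i : ℤ) ^ 2 + blockIndex i) * M =
        (1 + (2 : ℝ) ^ ((blockIndex i : ℤ) ^ 2 + blockIndex i)) * M by ring, ← mul_assoc]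
      gcongr
      have e1 : (1 : ℝ) ≤ 2 ^ ((blockIndex i : ℤ) ^ 2 + blockIndex i) :=
        one_le_zpow₀ (by norm_num) (by positivity)
      calc (2 : ℝ) ^ (blockIndex i - 8 * ((i : ℤ) - blockStart (blockIndex i)))
            * (1 + 2 ^ ((blockIndex i : ℤ) ^ 2 + blockIndex i))
          ≤ 2 ^ (blockIndex i : ℤ) * (2 ^ (1 : ℤ) * 2 ^ ((blockIndex i : ℤ) ^ 2 + blockIndex i)) := by
            gcongr
            · norm_num
            · omega
            · rw [zpow_one]; linarith
        _ ≤ 2 ^ ((k : ℤ) ^ 2) := by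
            rw [two_zpow_mul, two_zpow_mul]
            apply two_zpow_le
            have : (blockIndex i : ℤ) + 1 ≤ k := by omega
            nlinarith
    calc ‖targetEval η b k a‖ ≤ _ := norm_targetEval_le_sum k a
      _ ≤ _ := Finset.sum_le_sum key
      _ ≤ 2 ^ (k : ℤ) * (2 ^ ((k : ℤ) ^ 2) * M) := by
        rw [← Finset.sum_mul]
        gcongr
        exact h.sum_le k
      _ = _ := by rw [← mul_assoc, two_zpow_mul, add_comm]

/-- A moment sequence following the recursion `a l = targetEval ..` outside a set of indices
where `‖a l‖ ≤ 2 ^ l` satisfies this bound everywhere. -/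
theorem norm_le_two_zpow (h : Admissible η b A) {a : ℕ → V}
    (ha : ∀ l : ℕ, ‖a l‖ ≤ 2 ^ (l : ℤ) ∨
      a l = targetEval η b (blockIndex l) fun t => a (l - blockStart (blockIndex l) + t))
    (l : ℕ) : ‖a l‖ ≤ 2 ^ (l : ℤ) := by
  induction l using Nat.strong_induction_on with
  | _ l ih =>
    rcases ha l with h0 | h0
    · exact h0
    have h2 := blockStart_blockIndex_le l
    have h3 := mul_le_blockStart (blockIndex l)
    have h4 := sq_le_blockStart (blockIndex l)
    rw [h0]
    refine (norm_targetEval_le h _ _ (M := 2 ^ ((l : ℤ) - blockStart (blockIndex l)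
      + blockIndex l)) (by positivity) ?_).trans ?_
    · intro t ht
      refine (ih _ (by omega)).trans (two_zpow_le (by omega))
    · rw [two_zpow_mul]
      apply two_zpow_le
      zify at *
      nlinarith

end Estimates

section Operator

variable {𝕜 X : Type*} [RCLike 𝕜] [NormedAddCommGroup X] [NormedSpace 𝕜 X]

/-- A copy `e` of the basis of `c₀` in `X`, with a bounded biorthogonal sequence of functionals
converging pointwise to zero. -/
structure C0System (e : ℕ → X) (f : ℕ → X →L[𝕜] 𝕜) (C : ℝ) : Prop where
  one_le : 1 ≤ C
  biorthogonal : ∀ i j, f i (e j) = if i = j then 1 else 0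
  tendsto : ∀ z, Tendsto (fun i => f i z) atTop (𝓝 0)
  bound : ∀ i z, ‖f i z‖ ≤ C * ‖z‖
  sum_le : ∀ (s : Finset ℕ) (a : ℕ → 𝕜) (M : ℝ), 0 ≤ M → (∀ i ∈ s, ‖a i‖ ≤ M) →
    ‖∑ i ∈ s, a i • e i‖ ≤ C * M

variable {e : ℕ → X} {f : ℕ → X →L[𝕜] 𝕜} {C : ℝ}

theorem C0System.norm_le (h : C0System e f C) (i : ℕ) : ‖e i‖ ≤ C := by
  simpa using h.sum_le {i} (fun _ => 1) 1 zero_le_one (by simp)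

theorem C0System.summable_smul [CompleteSpace X] (h : C0System e f C) {a : ℕ → 𝕜}
    (ha : Tendsto a atTop (𝓝 0)) : Summable fun i => a i • e i := by
  have hC : 0 < C := zero_lt_one.trans_le h.one_le
  rw [summable_iff_vanishing_norm]
  intro ε hε
  obtain ⟨N, hN⟩ := Metric.tendsto_atTop.1 ha (ε / (2 * C)) (by positivity)
  refine ⟨Finset.range N, fun t ht => ?_⟩
  refine (h.sum_le t a (ε / (2 * C)) (by positivity) fun i hi => ?_).trans_lt ?_
  · have hiN : N ≤ i := by
      by_contra! hlt
      exact Finset.disjoint_left.1 ht hi (Finset.mem_range.2 hlt)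
    simpa using (hN i hiN).le
  · rw [show C * (ε / (2 * C)) = ε / 2 by field_simp]
    linarith

theorem C0System.norm_tsum_le [CompleteSpace X] (h : C0System e f C) {a : ℕ → 𝕜}
    (ha : Tendsto a atTop (𝓝 0)) {M : ℝ} (hM : ∀ i, ‖a i‖ ≤ M) : ‖∑' i, a i • e i‖ ≤ C * M :=
  le_of_tendsto (h.summable_smul ha).hasSum.norm (Eventually.of_forall fun s =>
    h.sum_le s a M ((norm_nonneg _).trans (hM 0)) fun i _ => hM i)

theorem C0System.summable_smul_succ [CompleteSpace X] (h : C0System e f C) {w : ℕ → 𝕜} {B : ℝ}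
    (hw : ∀ i, ‖w i‖ ≤ B) (z : X) : Summable fun i => f i z • w i • e (i + 1) := by
  have h1 : Tendsto (fun j => f (j - 1) z * w (j - 1)) atTop (𝓝 0) := by
    rw [← tendsto_add_atTop_iff_nat 1]
    have h2 : Tendsto (fun i => ‖f i z‖ * B) atTop (𝓝 0) := by
      simpa using (h.tendsto z).norm.mul_const B
    refine squeeze_zero_norm (fun i => ?_) h2
    rw [Nat.add_sub_cancel, norm_mul]
    gcongr
    exact hw i
  refine ((summable_nat_add_iff 1).2 (h.summable_smul h1)).congr fun i => ?_
  rw [Nat.add_sub_cancel, mul_smul]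

/-- A small perturbation of a bounded weighted shift along `e` defines an operator. -/
theorem C0System.exists_operator [CompleteSpace X] (h : C0System e f C) {w : ℕ → 𝕜}
    {g r : ℕ → X} {B K : ℝ} (hw : ∀ i, ‖w i‖ ≤ B) (hr : ∀ i : ℕ, ‖r i‖ ≤ K * (1 / 2) ^ i)
    (hg : ∀ i, g i = w i • e (i + 1) + r i) :
    ∃ T : X →L[𝕜] X, ∀ z, HasSum (fun i => f i z • g i) (T z) := by
  have hs : ∀ z, Summable fun i => f i z • g i := by
    intro z
    have h1 : Summable fun i => f i z • r i := by
      refine Summable.of_norm_bounded (g := fun i => C * ‖z‖ * K * (1 / 2) ^ i)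
        (summable_geometric_two.mul_left _) fun i => ?_
      rw [norm_smul, mul_assoc]
      have := h.bound i z
      have hC := h.one_le
      gcongr
      exact hr i
    refine ((h.summable_smul_succ hw z).add h1).congr fun i => ?_
    rw [hg, smul_add]
  let S : ℕ → X →L[𝕜] X := fun n => ∑ i ∈ Finset.range n, (f i).smulRight (g i)
  have ht : Tendsto (fun n x => S n x) atTop (𝓝 fun z => ∑' i, f i z • g i) := by
    rw [tendsto_pi_nhds]
    intro z
    refine (hs z).hasSum.tendsto_sum_nat.congr fun n => ?_
    simp [S]
  exact ⟨continuousLinearMapOfTendsto S ht, fun z => (hs z).hasSum⟩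

/-- The orbit of `e 0` under the operator to be constructed. -/
noncomputable def orbitVec (η : ℕ → ℕ → 𝕜) (b : ℕ → ℝ) (e y : ℕ → X) : ℕ → X
  | l => orbitCoeff 𝕜 b l • e l + if l = blockStart (blockIndex l) then y (blockIndex l) else
      targetEval η b (blockIndex l) fun t => if _h : l - blockStart (blockIndex l) + t < l
        then orbitVec η b e y (l - blockStart (blockIndex l) + t) else 0
termination_by l => l

variable {η : ℕ → ℕ → 𝕜} {b : ℕ → ℝ} {A : ℝ} {y : ℕ → X}

theorem orbitVec_of_eq {l : ℕ} (hl : l = blockStart (blockIndex l)) :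
    orbitVec η b e y l = orbitCoeff 𝕜 b l • e l + y (blockIndex l) := by
  rw [orbitVec, if_pos hl]

theorem orbitVec_of_ne {l : ℕ} (hl : l ≠ blockStart (blockIndex l)) :
    orbitVec η b e y l = orbitCoeff 𝕜 b l • e l + targetEval η b (blockIndex l)
      fun t => orbitVec η b e y (l - blockStart (blockIndex l) + t) := by
  rw [orbitVec, if_neg hl]
  congr 1
  refine targetEval_congr _ _ _ fun t ht => dif_pos ?_
  have h2 := blockStart_blockIndex_le l
  have h3 := mul_le_blockStart (blockIndex l)
  omega

theorem orbitVec_blockStart (k : ℕ) :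
    orbitVec η b e y (blockStart k) = orbitCoeff 𝕜 b (blockStart k) • e (blockStart k) + y k := by
  rw [orbitVec_of_eq (by rw [blockIndex_blockStart]), blockIndex_blockStart]

theorem orbitCoeff_blockStart (k : ℕ) : orbitCoeff 𝕜 b (blockStart k) = (b k : 𝕜) := by
  simp [orbitCoeff, blockIndex_blockStart]

theorem blockIndex_zero : blockIndex 0 = 0 := by simp [blockIndex]

theorem orbitVec_zero (hb : Admissible η b A) (hy : y 0 = 0) : orbitVec η b e y 0 = e 0 := by
  have := orbitVec_blockStart (η := η) (b := b) (e := e) (y := y) 0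
  rw [orbitCoeff_blockStart, hb.zero, hy] at this
  simpa [blockStart] using this

theorem norm_orbitVec_le (h : C0System e f C) (hb : Admissible η b A)
    (hy : ∀ k : ℕ, ‖y k‖ ≤ 2 ^ (k : ℤ)) (l : ℕ) :
    ‖orbitVec η b e y l‖ ≤ (1 + C) * 2 ^ (8 * (l : ℤ) - 7 * blockStart (blockIndex l)) := by
  have hC := h.one_le
  induction l using Nat.strong_induction_on with
  | _ l ih =>
    have h2 := blockStart_blockIndex_le l
    have h3 := mul_le_blockStart (blockIndex l)
    have h4 := sq_le_blockStart (blockIndex l)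
    have hce : ‖orbitCoeff 𝕜 b l • e l‖ ≤
        2 ^ (blockIndex l + 8 * ((l : ℤ) - blockStart (blockIndex l))) * C := by
      rw [norm_smul]
      gcongr
      · exact norm_orbitCoeff_le hb l
      · exact h.norm_le l
    by_cases hl : l = blockStart (blockIndex l)
    · rw [orbitVec_of_eq hl]
      have e1 : (2 : ℝ) ^ (blockIndex l + 8 * ((l : ℤ) - blockStart (blockIndex l))) ≤
        2 ^ (8 * (l : ℤ) - 7 * blockStart (blockIndex l)) := two_zpow_le (by omega)
      have e2 : (2 : ℝ) ^ (blockIndex l : ℤ) ≤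
        2 ^ (8 * (l : ℤ) - 7 * blockStart (blockIndex l)) := two_zpow_le (by omega)
      refine (norm_add_le _ _).trans ((add_le_add hce (hy _)).trans ?_)
      nlinarith
    · rw [orbitVec_of_ne hl]
      rcases Nat.eq_zero_or_pos (blockIndex l) with h0 | h0
      · rw [h0, targetEval_zero, add_zero]
        rw [h0] at hce
        refine hce.trans ?_
        simp only [blockStart, Nat.cast_zero, sub_zero, zero_add, mul_zero]
        nlinarith [zpow_pos (two_pos : (0 : ℝ) < 2) (8 * (l : ℤ))]
      · have hD := norm_targetEval_le hb (blockIndex l)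
          (fun t => orbitVec η b e y (l - blockStart (blockIndex l) + t))
          (M := (1 + C) * 2 ^ (8 * ((l : ℤ) - blockStart (blockIndex l) + blockIndex l)))
          (by positivity) (fun t ht => by
            refine (ih _ (by omega)).trans ?_
            gcongr
            · norm_num
            · omega)
        refine (norm_add_le _ _).trans ((add_le_add hce hD).trans ?_)
        have e1 : (2 : ℝ) ^ (blockIndex l + 8 * ((l : ℤ) - blockStart (blockIndex l))) ≤
          2 ^ (8 * (l : ℤ) - 7 * blockStart (blockIndex l) - 1) := two_zpow_le (by omega)
        have e2 : (2 : ℝ) ^ ((blockIndex l : ℤ) ^ 2 + blockIndex l) *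
            2 ^ (8 * ((l : ℤ) - blockStart (blockIndex l) + blockIndex l)) ≤
          2 ^ (8 * (l : ℤ) - 7 * blockStart (blockIndex l) - 1) := by
          rw [two_zpow_mul]
          apply two_zpow_le
          zify at *
          nlinarith
        have e3 : (2 : ℝ) ^ (8 * (l : ℤ) - 7 * blockStart (blockIndex l)) =
          2 * 2 ^ (8 * (l : ℤ) - 7 * blockStart (blockIndex l) - 1) := by
          rw [zpow_sub_one₀ (by norm_num)]; ring
        rw [e3]
        have e4 := zpow_pos (two_pos : (0 : ℝ) < 2) (8 * (l : ℤ) - 7 * blockStart (blockIndex l) - 1)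
        calc _ ≤ 2 ^ (8 * (l : ℤ) - 7 * blockStart (blockIndex l) - 1) * C +
              (1 + C) * 2 ^ (8 * (l : ℤ) - 7 * blockStart (blockIndex l) - 1) := by
              refine add_le_add (by gcongr) ?_
              rw [mul_left_comm]
              gcongr
          _ ≤ _ := by nlinarith

theorem basisEval_orbitVec_of_ne (hb : Admissible η b A) {l : ℕ}
    (hl : l ≠ blockStart (blockIndex l)) : basisEval η b l (orbitVec η b e y) = e l := by
  rw [basisEval, orbitVec_of_ne hl, add_sub_cancel_right, inv_smul_smul₀ (orbitCoeff_ne_zero hb l)]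

theorem basisEval_orbitVec_of_blockIndex_eq (hb : Admissible η b A) {i : ℕ}
    (hi : blockIndex (1 + i) = blockIndex i) :
    basisEval η b i (fun t => orbitVec η b e y (1 + t)) =
      ((orbitCoeff 𝕜 b i)⁻¹ * orbitCoeff 𝕜 b (1 + i)) • e (i + 1) := by
  have h1 := orbitCoeff_smul_basisEval_shift η b hi (orbitCoeff_ne_zero hb i)
    (orbitCoeff_ne_zero hb _) (orbitVec η b e y)
  have h2 := blockStart_blockIndex_le i
  rw [basisEval_orbitVec_of_ne hb (by rw [hi]; omega)] at h1
  rw [mul_smul, add_comm i 1, ← h1, inv_smul_smul₀ (orbitCoeff_ne_zero hb i)]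

theorem norm_orbitCoeff_ratio_le (hb : Admissible η b A) {i : ℕ}
    (hi : blockIndex (1 + i) = blockIndex i) :
    ‖(orbitCoeff 𝕜 b i)⁻¹ * orbitCoeff 𝕜 b (1 + i)‖ ≤ 256 := by
  have h0 := norm_pos_iff.2 (orbitCoeff_ne_zero hb i)
  rw [norm_mul, norm_inv, inv_mul_le_iff₀ h0, norm_orbitCoeff hb, norm_orbitCoeff hb, hi,
    show 8 * (((1 + i : ℕ) : ℤ) - blockStart (blockIndex i)) =
      8 * ((i : ℤ) - blockStart (blockIndex i)) + 8 by push_cast; ring, ← two_zpow_mul]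
  apply le_of_eq
  norm_num
  ring

theorem blockStart_mono : Monotone blockStart := blockStart_strictMono.monotone

theorem blockIndex_mono : Monotone blockIndex := by
  intro i j hij
  have h1 := blockStart_blockIndex_le i
  have h2 := lt_blockStart_succ j
  have := blockStart_strictMono.lt_iff_lt.1 ((h1.trans hij).trans_lt h2)
  omega

theorem succ_eq_blockStart_of_ne {i : ℕ} (hi : blockIndex (1 + i) ≠ blockIndex i) :
    1 + i = blockStart (blockIndex i + 1) := by
  have h1 := lt_blockStart_succ i
  have h2 := blockStart_blockIndex_le i
  by_contra h
  exact hi (blockIndex_eq (by omega) (by omega))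

theorem norm_basisEval_orbitVec_le (h : C0System e f C) (hb : Admissible η b A)
    (hy : ∀ k : ℕ, ‖y k‖ ≤ 2 ^ (k : ℤ)) {i : ℕ} (hi : blockIndex (1 + i) ≠ blockIndex i) :
    ‖basisEval η b i (fun t => orbitVec η b e y (1 + t))‖ ≤
      (1 + C) * 2 ^ (200 : ℤ) * (1 / 2) ^ i := by
  have hC := h.one_le
  have h1 := succ_eq_blockStart_of_ne hi
  have h2 := blockStart_blockIndex_le i
  have h3 := mul_le_blockStart (blockIndex i)
  have h4 := sq_le_blockStart (blockIndex i)
  have h5 := blockStart_succ (blockIndex i)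
  have hκ : blockIndex (1 + i) = blockIndex i + 1 := by rw [h1, blockIndex_blockStart]
  have hM := norm_orbitVec_le h hb hy (1 + i)
  rw [hκ, ← h1] at hM
  have hD := norm_targetEval_le hb (blockIndex i)
    (fun t => orbitVec η b e y (1 + (i - blockStart (blockIndex i) + t)))
    (M := (1 + C) * 2 ^ (8 * ((i : ℤ) + 1 - blockStart (blockIndex i) + blockIndex i) -
      7 * blockStart (blockIndex i))) (by positivity) (fun t ht => by
        refine (norm_orbitVec_le h hb hy _).trans ?_
        have h6 : blockStart (blockIndex i) ≤
            blockStart (blockIndex (1 + (i - blockStart (blockIndex i) + t))) := by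
          rw [← blockIndex_blockStart (blockIndex i)]
          refine blockStart_mono (blockIndex_mono ?_)
          rw [blockIndex_blockStart]
          omega
        gcongr
        · norm_num
        · omega)
  refine (norm_basisEval_le hb i (fun t => orbitVec η b e y (1 + t)) hM hD).trans ?_
  have e0 : ((1 : ℝ) / 2) ^ i = 2 ^ (-(i : ℤ)) := by
    rw [zpow_neg, zpow_natCast, one_div, inv_pow]
  have e1 : (2 : ℝ) ^ (blockIndex i - 8 * ((i : ℤ) - blockStart (blockIndex i))) *
      2 ^ (8 * ((1 + i : ℕ) : ℤ) - 7 * ((1 + i : ℕ) : ℤ)) ≤ 2 ^ (199 - (i : ℤ)) := by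
    rw [two_zpow_mul]
    apply two_zpow_le
    push_cast
    linarith
  have e2 : (2 : ℝ) ^ (blockIndex i - 8 * ((i : ℤ) - blockStart (blockIndex i))) *
      (2 ^ ((blockIndex i : ℤ) ^ 2 + blockIndex i) *
        2 ^ (8 * ((i : ℤ) + 1 - blockStart (blockIndex i) + blockIndex i) -
          7 * blockStart (blockIndex i))) ≤ 2 ^ (199 - (i : ℤ)) := by
    rw [two_zpow_mul, two_zpow_mul]
    apply two_zpow_le
    rw [h5] at h1
    zify at h1 h2 h3 h4
    nlinarith only [h1, h2, h3, h4, Int.natCast_nonneg (blockStart (blockIndex i))]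
  have e3 : (2 : ℝ) ^ (199 - (i : ℤ)) + 2 ^ (199 - (i : ℤ)) = 2 ^ (200 : ℤ) * (1 / 2) ^ i := by
    rw [e0, two_zpow_mul, show 200 + -(i : ℤ) = (199 - i) + 1 by ring,
      zpow_add_one₀ (by norm_num)]
    ring
  rw [mul_assoc (1 + C), ← e3]
  have := add_le_add (mul_le_mul_of_nonneg_left e1 (by positivity : 0 ≤ 1 + C))
    (mul_le_mul_of_nonneg_left e2 (by positivity : 0 ≤ 1 + C))
  refine le_trans (le_of_eq ?_) (this.trans_eq (by ring))
  ring

/-- The operator with orbit `orbitVec η b e y`. -/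
theorem C0System.exists_operator_orbitVec [CompleteSpace X] (h : C0System e f C)
    (hb : Admissible η b A) (hy : ∀ k : ℕ, ‖y k‖ ≤ 2 ^ (k : ℤ)) (hy0 : y 0 = 0)
    (hη : ∀ k i, f i (y k) = η k i) (hη0 : ∀ k i, k ≤ i → η k i = 0) :
    ∃ T : X →L[𝕜] X, (∀ l, (T ^ l) (e 0) = orbitVec η b e y l) ∧
      ∀ n z, HasSum (fun i => f i z • basisEval η b i fun t => orbitVec η b e y (n + 1 + t))
        ((T ^ (n + 1)) z) := by
  set ξ := orbitVec η b e y with hξ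
  set g : ℕ → X := fun i => basisEval η b i (fun t => ξ (1 + t)) with hg
  obtain ⟨T, hT⟩ := h.exists_operator (g := g)
    (w := fun i => if blockIndex (1 + i) = blockIndex i then
      (orbitCoeff 𝕜 b i)⁻¹ * orbitCoeff 𝕜 b (1 + i) else 0)
    (r := fun i => if blockIndex (1 + i) = blockIndex i then 0 else g i)
    (B := 256) (K := (1 + C) * 2 ^ (200 : ℤ))
    (fun i => by
      split_ifs with hi
      · exact norm_orbitCoeff_ratio_le hb hi
      · simp)
    (fun i => by
      have hC := h.one_le
      split_ifs with hi
      · rw [norm_zero]; positivity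
      · exact norm_basisEval_orbitVec_le h hb hy hi)
    (fun i => by
      split_ifs with hi
      · rw [add_zero]; exact basisEval_orbitVec_of_blockIndex_eq hb hi
      · simp)
  have hTe : ∀ i, T (e i) = g i := fun i => by
    refine (hT (e i)).unique ?_
    convert hasSum_single i ?_ using 1
    · simp [h.biorthogonal]
    · intro j hj
      simp [h.biorthogonal, hj]
  have hTy : ∀ k, T (y k) = targetEval η b k fun t => ξ (1 + t) := fun k => by
    refine (hT (y k)).unique ?_
    rw [targetEval_eq_sum]
    have h1 := hasSum_sum_of_ne_finset_zero (f := fun i => f i (y k) • g i) (s := Finset.range k)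
      (fun i hi => by rw [hη, hη0 k i (by simpa using hi), zero_smul]) (L := .unconditional ℕ)
    simpa only [hη] using h1
  have hcg : ∀ l, orbitCoeff 𝕜 b l • g l = ξ (1 + l) - targetEval η b (blockIndex l)
      fun t => ξ (1 + (l - blockStart (blockIndex l) + t)) := fun l => by
    simp only [hg, basisEval]
    rw [smul_inv_smul₀ (orbitCoeff_ne_zero hb l)]
  have hmapD : ∀ (S : X →L[𝕜] X) k a, S (targetEval η b k a) = targetEval η b k fun t => S (a t) :=
    fun S => map_targetEval η b (S : X →ₗ[𝕜] X)
  have hmapE : ∀ (S : X →L[𝕜] X) i a, S (basisEval η b i a) = basisEval η b i fun t => S (a t) :=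
    fun S => map_basisEval η b (S : X →ₗ[𝕜] X)
  have hTξ : ∀ l, T (ξ l) = ξ (1 + l) := by
    intro l
    induction l using Nat.strong_induction_on with
    | _ l ih =>
      have h2 := blockStart_blockIndex_le l
      have h3 := mul_le_blockStart (blockIndex l)
      by_cases hl : l = blockStart (blockIndex l)
      · have e1 : l - blockStart (blockIndex l) = 0 := by omega
        rw [hξ, orbitVec_of_eq hl, ← hξ, map_add, map_smul, hTe, hTy, hcg, e1]
        simp
      · rw [hξ, orbitVec_of_ne hl, ← hξ, map_add, map_smul, hTe, hcg,
          hmapD, targetEval_congr η b (a := fun t => T (ξ (l - blockStart (blockIndex l) + t))) _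
            fun t ht => ih (l - blockStart (blockIndex l) + t) (by omega)]
        simp
  have hTpow : ∀ n l, (T ^ n) (ξ l) = ξ (n + l) := by
    intro n l
    induction n with
    | zero => simp
    | succ n ih =>
      rw [pow_succ', mul_apply_eq_comp, ih, hTξ]
      congr 1
      omega
  refine ⟨T, fun l => ?_, fun n z => ?_⟩
  · rw [← orbitVec_zero (e := e) hb hy0, ← hξ, hTpow, add_zero]
  · have h1 := (hT z).mapL (T ^ n)
    rw [pow_succ, mul_apply_eq_comp]
    convert h1 using 2 with i
    rw [map_smul, hg]
    simp only [hmapE, hTpow, add_assoc]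

end Operator

section Functionals

variable {𝕜 X : Type*} [RCLike 𝕜] [NormedAddCommGroup X] [NormedSpace 𝕜 X]
  {e : ℕ → X} {f : ℕ → X →L[𝕜] 𝕜} {C : ℝ} {η : ℕ → ℕ → 𝕜} {b : ℕ → ℝ} {A : ℝ} {y : ℕ → X}

theorem basisEval_eq_zero_iff (hb : Admissible η b A) {V : Type*} [AddCommGroup V] [Module 𝕜 V]
    (l : ℕ) (a : ℕ → V) :
    basisEval η b l a = 0 ↔
      a l = targetEval η b (blockIndex l) fun t => a (l - blockStart (blockIndex l) + t) := by
  rw [basisEval, smul_eq_zero_iff_right (inv_ne_zero (orbitCoeff_ne_zero hb l)), sub_eq_zero]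

theorem eq_of_basisEval_eq (hb : Admissible η b A) {V : Type*} [AddCommGroup V] [Module 𝕜 V]
    {N : ℕ} {a a' : ℕ → V} (h : ∀ l < N, basisEval η b l a = basisEval η b l a') :
    ∀ l < N, a l = a' l := by
  intro l
  induction l using Nat.strong_induction_on with
  | _ l ih =>
    intro hl
    have h2 := blockStart_blockIndex_le l
    have h3 := mul_le_blockStart (blockIndex l)
    have h1 := smul_right_injective V (inv_ne_zero (orbitCoeff_ne_zero hb l)) (h l hl)
    rw [targetEval_congr η b (a' := fun t => a' (l - blockStart (blockIndex l) + t)) _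
      fun t ht => ih _ (by omega) (by omega)] at h1
    exact sub_left_injective h1

theorem basisEval_const_zero {V : Type*} [AddCommGroup V] [Module 𝕜 V] (i : ℕ) :
    basisEval η b i (fun _ => (0 : V)) = 0 := by
  simp [basisEval, targetEval_const_zero]

/-- Bounds for the values of a moment sequence which grows at most like `2 ^ l`. -/
theorem norm_basisEval_shift_le (hb : Admissible η b A) {a : ℕ → 𝕜}
    (ha : ∀ l : ℕ, ‖a l‖ ≤ 2 ^ (l : ℤ)) (n i : ℕ) :
    ‖basisEval η b i fun t => a (n + t)‖ ≤
      2 ^ (blockIndex i - 8 * ((i : ℤ) - blockStart (blockIndex i)) + 1 + n + i) := by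
  have h2 := blockStart_blockIndex_le i
  have h4 := sq_le_blockStart (blockIndex i)
  have h3 := mul_le_blockStart (blockIndex i)
  have hD := norm_targetEval_le hb (blockIndex i)
    (fun t => a (n + (i - blockStart (blockIndex i) + t)))
    (M := 2 ^ ((n : ℤ) + (i - blockStart (blockIndex i) + blockIndex i))) (by positivity)
    (fun t ht => (ha _).trans (two_zpow_le (by omega)))
  refine (norm_basisEval_le hb i (fun t => a (n + t)) (ha _) hD).trans ?_
  have e1 : (2 : ℝ) ^ ((blockIndex i : ℤ) ^ 2 + blockIndex i) *
      2 ^ ((n : ℤ) + (i - blockStart (blockIndex i) + blockIndex i)) ≤ 2 ^ ((n + i : ℕ) : ℤ) := by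
    rw [two_zpow_mul]
    apply two_zpow_le
    push_cast
    zify at h2 h3 h4
    nlinarith only [h2, h3, h4]
  calc _ ≤ (2 : ℝ) ^ (blockIndex i - 8 * ((i : ℤ) - blockStart (blockIndex i))) *
        (2 ^ ((n + i : ℕ) : ℤ) + 2 ^ ((n + i : ℕ) : ℤ)) := by gcongr
    _ = _ := by
      rw [← mul_two, ← zpow_add_one₀ (by norm_num), two_zpow_mul]
      congr 1
      push_cast
      ring

theorem basisEval_shift_eq_zero (hb : Admissible η b A) {a : ℕ → 𝕜} {n i : ℕ}
    (hi : blockIndex (n + i) = blockIndex i) (ha : basisEval η b (n + i) a = 0) :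
    basisEval η b i (fun t => a (n + t)) = 0 := by
  have := orbitCoeff_smul_basisEval_shift η b hi (orbitCoeff_ne_zero hb i)
    (orbitCoeff_ne_zero hb _) a
  rw [ha, smul_zero] at this
  exact (smul_eq_zero_iff_right (orbitCoeff_ne_zero hb i)).1 this

/-- Evaluating a finite combination of the `f i` on the orbit. -/
theorem basisEval_map_orbitVec (hb : Admissible η b A) (Φ : X →L[𝕜] 𝕜)
    (hΦ : ∀ k, Φ (y k) = ∑ i ∈ Finset.range k, η k i * Φ (e i)) (l : ℕ) :
    basisEval η b l (fun t => Φ (orbitVec η b e y t)) = Φ (e l) := by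
  induction l using Nat.strong_induction_on with
  | _ l ih =>
    by_cases hl : l = blockStart (blockIndex l)
    · have h3 := mul_le_blockStart (blockIndex l)
      have h1 : targetEval η b (blockIndex l) (fun t => Φ (orbitVec η b e y t)) =
          Φ (y (blockIndex l)) := by
        rw [targetEval_eq_sum, hΦ]
        refine Finset.sum_congr rfl fun i hi => ?_
        have := Finset.mem_range.1 hi
        rw [ih i (by omega), smul_eq_mul]
      have h0 : l - blockStart (blockIndex l) = 0 := by omega
      simp only [basisEval, h0, zero_add]
      rw [h1, orbitVec_of_eq hl, map_add, add_sub_cancel_right, map_smul,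
        inv_smul_smul₀ (orbitCoeff_ne_zero hb l)]
    · rw [← basisEval_orbitVec_of_ne (e := e) (y := y) hb hl]
      exact (map_basisEval η b (Φ : X →ₗ[𝕜] 𝕜) l _).symm

theorem C0System.sum_apply (h : C0System e f C) (N : ℕ) (φ : ℕ → 𝕜) (l : ℕ) :
    (∑ i ∈ Finset.range N, φ i • f i) (e l) = if l < N then φ l else 0 := by
  simp [h.biorthogonal]

theorem C0System.basisEval_sum (h : C0System e f C) (hb : Admissible η b A)
    (hη : ∀ k i, f i (y k) = η k i) (hη0 : ∀ k i, k ≤ i → η k i = 0)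
    (N : ℕ) (φ : ℕ → 𝕜) (l : ℕ) :
    basisEval η b l (fun t => (∑ i ∈ Finset.range N, φ i • f i) (orbitVec η b e y t)) =
      if l < N then φ l else 0 := by
  rw [basisEval_map_orbitVec hb, h.sum_apply]
  intro k
  simp only [h.sum_apply]
  simp only [_root_.sum_apply, smul_apply, hη, smul_eq_mul,
    mul_ite, mul_zero]
  rw [← Finset.sum_filter]
  have h1 : ∀ i ∈ Finset.range N, i ∉ {i ∈ Finset.range k | i < N} → φ i * η k i = 0 := by
    intro i hi hik
    rw [hη0 k i, mul_zero]
    by_contra! hlt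
    exact hik (by simp at hi ⊢; omega)
  rw [← Finset.sum_subset _ h1]
  · exact Finset.sum_congr rfl fun i _ => mul_comm _ _
  · intro i hi
    simp at hi ⊢
    omega

theorem sum_half_pow_sub_le (m N : ℕ) :
    ∑ i ∈ Finset.range N, (if m ≤ i then ((1 : ℝ) / 2) ^ (i - m) else 0) ≤ 2 := by
  rw [← Finset.sum_filter]
  have : {i ∈ Finset.range N | m ≤ i} = Finset.Ico m N := by ext; simp; omega
  rw [this, Finset.sum_Ico_eq_sum_range]
  simpa using sum_geometric_two_le (N - m)

end Functionals

section FirstCoordinate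

variable {𝕜 : Type*} [RCLike 𝕜] {η : ℕ → ℕ → 𝕜} {b : ℕ → ℝ} {A : ℝ} {α : ℕ → 𝕜}

theorem orbitCoeff_zero (hb : Admissible η b A) : orbitCoeff 𝕜 b 0 = 1 := by
  simpa [blockStart, hb.zero] using orbitCoeff_blockStart (𝕜 := 𝕜) (b := b) 0

theorem norm_le_two_zpow_of_basisEval (hb : Admissible η b A)
    (hα : ∀ l, basisEval η b l α = if l = 0 then 1 else 0) (l : ℕ) : ‖α l‖ ≤ 2 ^ (l : ℤ) := by
  refine norm_le_two_zpow hb (fun l => ?_) l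
  rcases Nat.eq_zero_or_pos l with rfl | hl
  · left
    have := hα 0
    simp only [basisEval, blockIndex_zero, targetEval_zero, orbitCoeff_zero hb] at this
    simp at this
    simp [this]
  · right
    rw [← basisEval_eq_zero_iff hb, hα, if_neg hl.ne']

theorem norm_basisEval_shift_first_le (hb : Admissible η b A)
    (hα : ∀ l, basisEval η b l α = if l = 0 then 1 else 0) (l i : ℕ) :
    ‖basisEval η b i fun t => α (l + t)‖ ≤ 2 ^ (7 * (l : ℤ) - i) := by
  have h2 := blockStart_blockIndex_le i
  have h3 := mul_le_blockStart (blockIndex i)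
  by_cases hi : blockIndex (l + i) = blockIndex i
  · rcases Nat.eq_zero_or_pos (l + i) with h0 | h0
    · obtain ⟨rfl, rfl⟩ : l = 0 ∧ i = 0 := by omega
      simp [hα]
    · rw [basisEval_shift_eq_zero hb hi (by rw [hα, if_neg h0.ne']), norm_zero]
      positivity
  · refine (norm_basisEval_shift_le hb (norm_le_two_zpow_of_basisEval hb hα) l i).trans ?_
    apply two_zpow_le
    have h5 : blockStart (blockIndex i + 1) ≤ l + i := by
      by_contra! hlt
      exact hi (blockIndex_eq (by omega) hlt)
    simp only [blockStart] at h5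
    omega

theorem norm_targetEval_shift_first_le (hb : Admissible η b A)
    (hα : ∀ l, basisEval η b l α = if l = 0 then 1 else 0) (j l : ℕ) :
    ‖targetEval η b j fun t => α (l + t)‖ ≤ 2 * A * b j * 2 ^ (7 * (l : ℤ)) := by
  have hA := hb.nonneg
  have hbj := hb.pos j
  calc _ ≤ ∑ i ∈ Finset.range j, ‖η j i‖ * ‖basisEval η b i fun t => α (l + t)‖ :=
        norm_targetEval_le_sum j _
    _ ≤ ∑ i ∈ Finset.range j, A * b j * 2 ^ (7 * (l : ℤ)) * (1 / 2) ^ i := by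
        refine Finset.sum_le_sum fun i _ => ?_
        rw [mul_assoc (A * b j)]
        gcongr
        · exact hb.le_mul j i
        · refine (norm_basisEval_shift_first_le hb hα l i).trans_eq ?_
          rw [sub_eq_add_neg, ← two_zpow_mul, zpow_neg, zpow_natCast _ i, one_div, inv_pow]
    _ ≤ A * b j * 2 ^ (7 * (l : ℤ)) * 2 := by
        rw [← Finset.mul_sum]
        gcongr
        exact sum_geometric_two_le j
    _ = _ := by ring

/-- Coordinates of the functional whose moments are those of `f 0` up to `blockStart k` and zero
from there on. -/
theorem norm_basisEval_truncation_le (hb : Admissible η b A)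
    (hα : ∀ l, basisEval η b l α = if l = 0 then 1 else 0) {k i : ℕ} (hk : 1 ≤ k)
    (hik : blockStart k ≤ i) (hi : i < blockStart (k + 2)) :
    ‖basisEval η b i fun l => if l < blockStart k then α l else 0‖ ≤
      (2 * A + 1) * (1 / 2) ^ (i - blockStart (blockIndex i)) := by
  have hA := hb.nonneg
  have hj1 : blockIndex i ≤ k + 1 := by
    have := blockStart_strictMono.lt_iff_lt.1 ((blockStart_blockIndex_le i).trans_lt hi)
    omega
  have hj0 : k ≤ blockIndex i := by
    rw [← blockIndex_blockStart k]
    exact blockIndex_mono hik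
  have h2 := blockStart_blockIndex_le i
  have h3 := mul_le_blockStart k
  have h4 := sq_le_blockStart k
  set j := blockIndex i with hj
  obtain ⟨l, hl⟩ : ∃ l, i = blockStart j + l := ⟨i - blockStart j, by omega⟩
  have hl' : i - blockStart j = l := by omega
  have hD1 := norm_targetEval_shift_first_le hb hα j l
  have hsplit : (targetEval η b j fun t => if l + t < blockStart k then α (l + t) else 0) =
      targetEval η b j (fun t => α (l + t)) -
        targetEval η b j (fun t => if l + t < blockStart k then 0 else α (l + t)) := by
    rw [← targetEval_sub]
    congr 1
    ext t
    split_ifs <;> simp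
  have hD2 : ‖targetEval η b j (fun t => if l + t < blockStart k then 0 else α (l + t))‖ ≤
      2 ^ (7 * (l : ℤ) - j) := by
    by_cases hlj : l + j ≤ blockStart k
    · rw [targetEval_congr η b (a' := fun _ => 0) _ fun t ht => if_pos (by omega),
        targetEval_const_zero, norm_zero]
      positivity
    · refine (norm_targetEval_le hb j _ (M := 2 ^ ((l : ℤ) + j)) (by positivity) ?_).trans ?_
      · intro t ht
        split_ifs
        · rw [norm_zero]; positivity
        · exact (norm_le_two_zpow_of_basisEval hb hα _).trans (two_zpow_le (by omega))
      · rw [two_zpow_mul]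
        apply two_zpow_le
        have e1 : blockStart k < l + k + 1 := by omega
        have e2 : (j : ℤ) ^ 2 ≤ ((k : ℤ) + 1) ^ 2 := by
          apply pow_le_pow_left₀ (by positivity)
          omega
        zify at e1 h3 h4 hk hj1
        nlinarith only [e1, e2, h3, h4, hk, hj1]
  have hc : ‖(orbitCoeff 𝕜 b i)⁻¹‖ = (b j)⁻¹ * 2 ^ (-8 * (l : ℤ)) := by
    rw [norm_inv, norm_orbitCoeff hb, ← hj, mul_inv, ← zpow_neg]
    congr 2
    rw [hl]
    push_cast
    ring
  have hbj := hb.pos j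
  have hlow : (b j)⁻¹ ≤ 2 ^ (j : ℤ) := by
    have := hb.lower j
    rw [zpow_neg] at this
    exact inv_le_of_inv_le₀ (by positivity) this
  rw [basisEval, if_neg (by omega), zero_sub, ← hj, hl', norm_smul, norm_neg, hsplit, hc]
  calc _ ≤ (b j)⁻¹ * 2 ^ (-8 * (l : ℤ)) * (2 * A * b j * 2 ^ (7 * (l : ℤ)) +
        2 ^ (7 * (l : ℤ) - j)) := by
        gcongr
        exact (norm_sub_le _ _).trans (add_le_add hD1 hD2)
    _ = 2 * A * (2 ^ (-8 * (l : ℤ)) * 2 ^ (7 * (l : ℤ))) +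
        (b j)⁻¹ * (2 ^ (-8 * (l : ℤ)) * 2 ^ (7 * (l : ℤ) - j)) := by
        field_simp
    _ ≤ 2 * A * (2 ^ (-8 * (l : ℤ)) * 2 ^ (7 * (l : ℤ))) +
        2 ^ (j : ℤ) * (2 ^ (-8 * (l : ℤ)) * 2 ^ (7 * (l : ℤ) - j)) := by gcongr
    _ = _ := by
        rw [two_zpow_mul, two_zpow_mul, two_zpow_mul,
          show -8 * (l : ℤ) + 7 * l = -l by ring,
          show (j : ℤ) + (-8 * l + (7 * l - j)) = -l by ring, zpow_neg, zpow_natCast, one_div,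
          inv_pow]
        ring

end FirstCoordinate

section Separation

variable {𝕜 X : Type*} [RCLike 𝕜] [NormedAddCommGroup X] [NormedSpace 𝕜 X]
  {e : ℕ → X} {f : ℕ → X →L[𝕜] 𝕜} {C : ℝ} {η : ℕ → ℕ → 𝕜} {b : ℕ → ℝ} {A : ℝ} {y : ℕ → X}

/-- Uniformly bounded functionals separating `e 0` from late points of its orbit. -/
theorem C0System.exists_functional (h : C0System e f C) (hb : Admissible η b A)
    (hη : ∀ k i, f i (y k) = η k i) (hη0 : ∀ k i, k ≤ i → η k i = 0)
    {n : ℕ} (hn : blockStart 1 ≤ n) :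
    ∃ Φ : X →L[𝕜] 𝕜, Φ (e 0) = 1 ∧ Φ (orbitVec η b e y n) = 0 ∧
      (∀ z, ‖Φ z‖ ≤ (1 + 4 * (2 * A + 1)) * (C * ‖z‖)) ∧
      ∀ i : ℕ, ‖basisEval η b i fun t => Φ (orbitVec η b e y (n + t))‖ ≤ (1 / 2) ^ i := by
  have hA := hb.nonneg
  have hC := h.one_le
  set ξ := orbitVec η b e y with hξ
  set k := blockIndex n with hk
  have hk1 : 1 ≤ k := by
    rw [hk, ← blockIndex_blockStart 1]
    exact blockIndex_mono hn
  have hkn : blockStart k ≤ n := blockStart_blockIndex_le n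
  have hnk : n < blockStart (k + 1) := lt_blockStart_succ n
  have hk2 := blockStart_succ (k + 1)
  have hk0 : 192 * k ≤ blockStart k := mul_le_blockStart k
  obtain ⟨N, hN⟩ : ∃ N, N = blockStart (k + 2) := ⟨_, rfl⟩
  rw [← hN] at hk2
  set α : ℕ → 𝕜 := fun l => f 0 (ξ l) with hα'
  have hα : ∀ l, basisEval η b l α = if l = 0 then 1 else 0 := by
    intro l
    have := h.basisEval_sum hb hη hη0 1 (fun _ => 1) l
    simpa using this
  set a' : ℕ → 𝕜 := fun l => if l < blockStart k then α l else 0 with ha'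
  set φ : ℕ → 𝕜 := fun i => basisEval η b i a' with hφ
  have hφ_low : ∀ i < blockStart k, φ i = if i = 0 then 1 else 0 := by
    intro i hi
    rw [← hα i]
    exact basisEval_congr η b i fun t ht => if_pos (by omega)
  set Φ : X →L[𝕜] 𝕜 := ∑ i ∈ Finset.range N, φ i • f i with hΦ
  set a : ℕ → 𝕜 := fun l => Φ (ξ l) with ha
  have hE : ∀ l, basisEval η b l a = if l < N then φ l else 0 :=
    fun l => h.basisEval_sum hb hη hη0 N φ l
  have haa' : ∀ l < N, a l = a' l :=
    eq_of_basisEval_eq hb fun l hl => by rw [hE, if_pos hl]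
  have ha0 : ∀ l, blockStart k ≤ l → l < N → a l = 0 := fun l h1 h2 => by
    rw [haa' l h2]
    exact if_neg (by omega)
  have ha2 : ∀ l : ℕ, ‖a l‖ ≤ 2 ^ (l : ℤ) := by
    refine norm_le_two_zpow hb fun l => ?_
    by_cases hl : l < N
    · left
      rw [haa' l hl, ha']
      simp only
      split_ifs
      · exact norm_le_two_zpow_of_basisEval hb hα l
      · rw [norm_zero]; positivity
    · right
      rw [← basisEval_eq_zero_iff hb, hE, if_neg hl]
  refine ⟨Φ, ?_, ha0 n hkn (by omega), fun z => ?_, fun i => ?_⟩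
  · rw [hΦ, h.sum_apply, if_pos (by omega), hφ_low 0 (by omega), if_pos rfl]
  · have hφ_sum : ∑ i ∈ Finset.range N, ‖φ i‖ ≤ 1 + 4 * (2 * A + 1) := by
      have hpt : ∀ i ∈ Finset.range N, ‖φ i‖ ≤ (if i = 0 then 1 else 0) +
          ((2 * A + 1) * (if blockStart k ≤ i then ((1 : ℝ) / 2) ^ (i - blockStart k) else 0) +
          (2 * A + 1) *
            (if blockStart (k + 1) ≤ i then ((1 : ℝ) / 2) ^ (i - blockStart (k + 1)) else 0)) := by
        intro i hi
        have hi := Finset.mem_range.1 hi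
        rw [hN] at hi
        by_cases h1 : i < blockStart k
        · rw [hφ_low i h1]
          split_ifs <;> first | omega | simp
        · have h5 := norm_basisEval_truncation_le hb hα hk1 (not_lt.1 h1) hi
          have e0 : (0 : ℝ) ≤ if i = 0 then 1 else 0 := by split_ifs <;> norm_num
          by_cases h2 : i < blockStart (k + 1)
          · rw [blockIndex_eq (not_lt.1 h1) h2] at h5
            rw [if_pos (not_lt.1 h1), if_neg (not_le.2 h2), mul_zero, add_zero]
            exact h5.trans (le_add_of_nonneg_left e0)
          · rw [blockIndex_eq (k := k + 1) (not_lt.1 h2) hi] at h5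
            rw [if_pos (c := blockStart (k + 1) ≤ i) (not_lt.1 h2)]
            refine h5.trans ?_
            have : 0 ≤ (2 * A + 1) *
                (if blockStart k ≤ i then ((1 : ℝ) / 2) ^ (i - blockStart k) else 0) := by
              refine mul_nonneg (by linarith) ?_
              split_ifs
              exacts [pow_nonneg (by norm_num) _, le_rfl]
            linarith
      refine (Finset.sum_le_sum hpt).trans ?_
      rw [Finset.sum_add_distrib, Finset.sum_add_distrib, ← Finset.mul_sum, ← Finset.mul_sum]
      have e1 := sum_half_pow_sub_le (blockStart k) N
      have e2 := sum_half_pow_sub_le (blockStart (k + 1)) N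
      have e3 : ∑ i ∈ Finset.range N, (if i = 0 then (1 : ℝ) else 0) ≤ 1 := by
        rw [Finset.sum_ite_eq']
        split_ifs <;> norm_num
      nlinarith
    calc ‖Φ z‖ ≤ ∑ i ∈ Finset.range N, ‖φ i‖ * ‖f i z‖ := by
          rw [hΦ, _root_.sum_apply]
          refine (norm_sum_le _ _).trans_eq ?_
          simp
      _ ≤ ∑ i ∈ Finset.range N, ‖φ i‖ * (C * ‖z‖) := by
          gcongr with i
          exact h.bound i z
      _ ≤ _ := by
          rw [← Finset.sum_mul]
          gcongr
  · change ‖basisEval η b i fun t => a (n + t)‖ ≤ (1 / 2) ^ i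
    by_cases h1 : n + i < N
    · rw [basisEval_congr η b (a' := fun _ => 0) i fun t ht => ha0 _ (by omega) (by omega),
        basisEval_const_zero, norm_zero]
      positivity
    by_cases h2 : blockIndex (n + i) = blockIndex i
    · rw [basisEval_shift_eq_zero hb h2 (by rw [hE, if_neg h1]), norm_zero]
      positivity
    refine (norm_basisEval_shift_le hb ha2 n i).trans ?_
    rw [one_div, inv_pow, ← zpow_natCast, ← zpow_neg]
    apply two_zpow_le
    have h3 := blockStart_blockIndex_le i
    have h4 := mul_le_blockStart (blockIndex i)
    have h5 : blockStart (blockIndex i + 1) ≤ n + i := by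
      by_contra! hlt
      exact h2 (blockIndex_eq (by omega) hlt)
    have h6 : k + 1 ≤ blockIndex i := by
      rw [← blockIndex_blockStart (k + 1)]
      exact blockIndex_mono (by omega)
    have h7 := blockStart_mono h6
    rw [blockStart_succ] at h5
    omega

end Separation

section Extraction

variable {𝕜 X : Type*} [RCLike 𝕜] [NormedAddCommGroup X] [NormedSpace 𝕜 X]

/-- The unit vectors of `c₀`. -/
noncomputable def c0Single (𝕜 : Type*) [RCLike 𝕜] (i : ℕ) : ZeroAtInftyContinuousMap ℕ 𝕜 where
  toFun j := if j = i then 1 else 0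
  continuous_toFun := continuous_of_discreteTopology
  zero_at_infty' := by
    rw [cocompact_eq_cofinite]
    refine tendsto_const_nhds.congr' ?_
    filter_upwards [(Set.finite_singleton i).compl_mem_cofinite] with j hj
    exact (if_neg hj).symm

theorem c0Single_apply (i j : ℕ) : c0Single 𝕜 i j = if j = i then 1 else 0 := rfl

theorem ZeroAtInftyContinuousMap.norm_le_iff (g : ZeroAtInftyContinuousMap ℕ 𝕜) {M : ℝ}
    (hM : 0 ≤ M) : ‖g‖ ≤ M ↔ ∀ j, ‖g j‖ ≤ M := by
  rw [← ZeroAtInftyContinuousMap.norm_toBCF_eq_norm, BoundedContinuousFunction.norm_le hM]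
  rfl

/-- The coordinate functionals of `c₀`. -/
noncomputable def c0Coord (𝕜 : Type*) [RCLike 𝕜] (i : ℕ) :
    ZeroAtInftyContinuousMap ℕ 𝕜 →L[𝕜] 𝕜 :=
  LinearMap.mkContinuous
    { toFun := fun g => g i
      map_add' := fun _ _ => rfl
      map_smul' := fun _ _ => rfl } 1
    fun g => by
      rw [one_mul]
      exact (g.norm_le_iff (norm_nonneg g)).1 le_rfl i

theorem c0Coord_apply (i : ℕ) (g : ZeroAtInftyContinuousMap ℕ 𝕜) : c0Coord 𝕜 i g = g i := rfl

theorem norm_c0Coord_le (i : ℕ) : ‖c0Coord 𝕜 i‖ ≤ 1 := LinearMap.mkContinuous_norm_le _ zero_le_one _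

theorem norm_sum_c0Single_le {σ : ℕ → ℕ} (hσ : Function.Injective σ) (s : Finset ℕ) (a : ℕ → 𝕜)
    {M : ℝ} (hM : 0 ≤ M) (ha : ∀ i ∈ s, ‖a i‖ ≤ M) : ‖∑ i ∈ s, a i • c0Single 𝕜 (σ i)‖ ≤ M := by
  rw [ZeroAtInftyContinuousMap.norm_le_iff _ hM]
  intro j
  have h1 : (∑ i ∈ s, a i • c0Single 𝕜 (σ i)) j = ∑ i ∈ s, if j = σ i then a i else 0 := by
    rw [← c0Coord_apply, map_sum]
    refine Finset.sum_congr rfl fun i _ => ?_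
    rw [map_smul, c0Coord_apply, c0Single_apply, smul_eq_mul, mul_ite, mul_one, mul_zero]
  rw [h1]
  by_cases hj : ∃ i ∈ s, j = σ i
  · obtain ⟨i, hi, rfl⟩ := hj
    rw [Finset.sum_eq_single_of_mem i hi fun i' _ hi' => if_neg fun h => hi' (hσ h).symm, if_pos rfl]
    exact ha i hi
  · push Not at hj
    rw [Finset.sum_eq_zero fun i hi => if_neg (hj i hi), norm_zero]
    exact hM

/-- A separable space containing `c₀` contains a copy of its basis with biorthogonal functionals
converging pointwise to zero. -/
theorem exists_c0System [TopologicalSpace.SeparableSpace X] (V : Submodule 𝕜 X)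
    (ψ : V ≃L[𝕜] ZeroAtInftyContinuousMap ℕ 𝕜) :
    ∃ (e : ℕ → X) (f : ℕ → X →L[𝕜] 𝕜) (C : ℝ), C0System e f C := by
  have hext : ∀ i, ∃ g : X →L[𝕜] 𝕜, (∀ x : V, g x = ψ x i) ∧
      ‖g‖ ≤ ‖(ψ : V →L[𝕜] ZeroAtInftyContinuousMap ℕ 𝕜)‖ := by
    intro i
    obtain ⟨g, hg, hg'⟩ := exists_extension_norm_eq V
      ((c0Coord 𝕜 i).comp (ψ : V →L[𝕜] ZeroAtInftyContinuousMap ℕ 𝕜))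
    refine ⟨g, fun x => by rw [hg]; rfl, hg'.trans_le ((ContinuousLinearMap.opNorm_comp_le _ _).trans ?_)⟩
    exact mul_le_of_le_one_left (norm_nonneg _) (norm_c0Coord_le i)
  choose g hg hgM using hext
  set M := ‖(ψ : V →L[𝕜] ZeroAtInftyContinuousMap ℕ 𝕜)‖ with hM
  set M' := ‖(ψ.symm : ZeroAtInftyContinuousMap ℕ 𝕜 →L[𝕜] V)‖ with hM'
  obtain ⟨g', hg'mem, σ, hσ, hlim⟩ := WeakDual.isSeqCompact_closedBall 𝕜 X 0 M
    (x := fun i => StrongDual.toWeakDual (g i)) (fun i => by simpa using hgM i)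
  have hlim' : ∀ z, Tendsto (fun i => g (σ i) z) atTop (𝓝 (g' z)) := fun z =>
    ((WeakDual.eval_continuous z).tendsto g').comp hlim
  set G : X →L[𝕜] 𝕜 := WeakDual.toStrongDual g' with hG
  have hGM : ‖G‖ ≤ M := by simpa using hg'mem
  have hgv : ∀ i j, g i (ψ.symm (c0Single 𝕜 j)) = if i = j then 1 else 0 := fun i j => by
    rw [hg, ContinuousLinearEquiv.apply_symm_apply, c0Single_apply]
  have hGv : ∀ j, G (ψ.symm (c0Single 𝕜 j)) = 0 := fun j => by
    refine tendsto_nhds_unique (hlim' _) (tendsto_const_nhds.congr' ?_)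
    filter_upwards [eventually_gt_atTop j] with i hi
    rw [hgv, if_neg]
    have := hσ.id_le i
    simp only [id] at this
    omega
  have hM0 : 0 ≤ M := by rw [hM]; exact ContinuousLinearMap.opNorm_nonneg _
  have hM0' : 0 ≤ M' := by rw [hM']; exact ContinuousLinearMap.opNorm_nonneg _
  refine ⟨fun j => (ψ.symm (c0Single 𝕜 (σ j)) : X), fun i => g (σ i) - G, 1 + 2 * M + M', ?_, ?_,
    ?_, ?_, ?_⟩
  · linarith
  · intro i j
    rw [_root_.sub_apply, hgv, hGv, sub_zero]
    simp [hσ.injective.eq_iff]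
  · intro z
    simpa [hG] using (hlim' z).sub_const (g' z)
  · intro i z
    refine (ContinuousLinearMap.le_opNorm _ z).trans ?_
    gcongr
    linarith [norm_sub_le (g (σ i)) G, hgM (σ i)]
  · intro s a B hB ha
    have h1 : ∑ i ∈ s, a i • (ψ.symm (c0Single 𝕜 (σ i)) : X) =
        (ψ.symm (∑ i ∈ s, a i • c0Single 𝕜 (σ i)) : V) := by
      simp [map_sum]
    rw [h1]
    refine ((ψ.symm : ZeroAtInftyContinuousMap ℕ 𝕜 →L[𝕜] V).le_opNorm _).trans ?_
    calc _ ≤ M' * B := by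
          gcongr
          exact norm_sum_c0Single_le hσ.injective s a hB ha
      _ ≤ _ := by
          gcongr
          linarith

end Extraction

section Targets

variable {𝕜 X : Type*} [RCLike 𝕜] [NormedAddCommGroup X] [NormedSpace 𝕜 X]
  {e : ℕ → X} {f : ℕ → X →L[𝕜] 𝕜} {C : ℝ}

theorem C0System.dense_eventually_zero [CompleteSpace X] (h : C0System e f C) :
    Dense {u : X | ∃ s, ∀ i, s ≤ i → f i u = 0} := by
  have hC : 0 < C := zero_lt_one.trans_le h.one_le
  rw [Metric.dense_iff]
  intro u r hr
  obtain ⟨s, hs⟩ := Metric.tendsto_atTop.1 (h.tendsto u) (r / (2 * C)) (by positivity)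
  set a : ℕ → 𝕜 := fun i => if s ≤ i then f i u else 0 with ha
  have ha0 : Tendsto a atTop (𝓝 0) := (h.tendsto u).congr' (by
    filter_upwards [eventually_ge_atTop s] with i hi
    rw [ha]
    exact (if_pos hi).symm)
  have hM : ∀ i, ‖a i‖ ≤ r / (2 * C) := by
    intro i
    simp only [ha]
    split_ifs with hi
    · simpa using (hs i hi).le
    · rw [norm_zero]; positivity
  refine ⟨u - ∑' i, a i • e i, ?_, s, fun j hj => ?_⟩
  · rw [Metric.mem_ball, dist_eq_norm, sub_sub_cancel_left, norm_neg]
    refine (h.norm_tsum_le ha0 hM).trans_lt ?_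
    rw [show C * (r / (2 * C)) = r / 2 by field_simp]
    linarith
  · have h1 : f j (∑' i, a i • e i) = a j := by
      refine ((h.summable_smul ha0).hasSum.mapL (f j)).unique ?_
      convert hasSum_single j ?_ using 1
      · simp [h.biorthogonal]
      · intro i hi
        simp [h.biorthogonal, hi.symm]
    rw [map_sub, h1, ha]
    simp [hj]

/-- A sequence of targets, approximating every vector, with suitable coordinates and weights. -/
theorem C0System.exists_targets [CompleteSpace X] [TopologicalSpace.SeparableSpace X]
    (h : C0System e f C) {δ : ℝ} (hδ : 0 < δ) :
    ∃ (y : ℕ → X) (b : ℕ → ℝ), Admissible (fun k i => f i (y k)) b (C / δ) ∧ y 0 = 0 ∧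
      (∀ k : ℕ, ‖y k‖ ≤ 2 ^ (k : ℤ)) ∧ (∀ k i, k ≤ i → f i (y k) = 0) ∧
      ∀ u : X, ∀ r, 0 < r → r < ‖u‖ → ∃ k, ‖y k - u‖ < r ∧ b k = δ * ‖y k‖ := by
  classical
  have hC : 0 < C := zero_lt_one.trans_le h.one_le
  have := UniformSpace.secondCountable_of_separable X
  set D := {u : X | ∃ s, ∀ i, s ≤ i → f i u = 0} with hD
  have : Nonempty D := ⟨⟨0, 0, fun i _ => map_zero _⟩⟩
  obtain ⟨d, hd⟩ := TopologicalSpace.exists_dense_seq D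
  set v : ℕ → X := fun k => d (Nat.unpair k).1 with hv
  let P : ℕ → Prop := fun k => 1 ≤ k ∧ (∀ i, k ≤ i → f i (v k) = 0) ∧ ‖v k‖ ≤ 2 ^ (k : ℤ) ∧
    (2 : ℝ) ^ (-k : ℤ) ≤ δ * ‖v k‖ ∧ δ * ‖v k‖ ≤ 2 ^ (k : ℤ) ∧
    ∑ i ∈ Finset.range k, ‖f i (v k)‖ ≤ 2 ^ (k : ℤ)
  have one_le (k : ℕ) : (1 : ℝ) ≤ 2 ^ (k : ℤ) := one_le_zpow₀ (by norm_num) (by positivity)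
  obtain ⟨y, b, hyb⟩ : ∃ (y : ℕ → X) (b : ℕ → ℝ), ∀ k,
      (P k ∧ y k = v k ∧ b k = δ * ‖v k‖) ∨ (¬ P k ∧ y k = 0 ∧ b k = 1) := by
    refine ⟨fun k => if P k then v k else 0, fun k => if P k then δ * ‖v k‖ else 1, fun k => ?_⟩
    by_cases hP : P k
    · exact Or.inl ⟨hP, if_pos hP, if_pos hP⟩
    · exact Or.inr ⟨hP, if_neg hP, if_neg hP⟩
  have hP0 : y 0 = 0 ∧ b 0 = 1 := (hyb 0).elim (fun hP => absurd hP.1.1 (by norm_num)) And.right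
  refine ⟨y, b, ⟨by positivity, hP0.2, fun k => ?_, fun k => ?_, fun k => ?_, fun k i => ?_⟩, hP0.1,
    fun k => ?_, fun k i hki => ?_, fun u r hr hru => ?_⟩
  · rcases hyb k with ⟨hP, -, hbk⟩ | ⟨-, -, hbk⟩ <;> rw [hbk]
    · exact hP.2.2.2.1
    · rw [zpow_neg]
      exact inv_le_one_of_one_le₀ (one_le k)
  · rcases hyb k with ⟨hP, -, hbk⟩ | ⟨-, -, hbk⟩ <;> rw [hbk]
    · exact hP.2.2.2.2.1
    · exact one_le k
  · rcases hyb k with ⟨hP, hyk, -⟩ | ⟨-, hyk, -⟩ <;> simp only [hyk]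
    · exact hP.2.2.2.2.2
    · simp
  · rcases hyb k with ⟨hP, hyk, hbk⟩ | ⟨-, hyk, hbk⟩ <;> simp only [hyk, hbk]
    · refine (h.bound i _).trans_eq ?_
      field_simp
    · simp only [map_zero, norm_zero]
      positivity
  · rcases hyb k with ⟨hP, hyk, -⟩ | ⟨-, hyk, -⟩ <;> rw [hyk]
    · exact hP.2.2.1
    · simp
  · rcases hyb k with ⟨hP, hyk, -⟩ | ⟨-, hyk, -⟩ <;> rw [hyk]
    · exact hP.2.1 i hki
    · simp
  · have hdense : DenseRange fun j => (d j : X) :=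
      h.dense_eventually_zero.denseRange_val.comp hd continuous_subtype_val
    obtain ⟨j, hj⟩ := hdense.exists_dist_lt u hr
    rw [dist_comm, dist_eq_norm] at hj
    have hpos : 0 < ‖(d j : X)‖ := by
      have := norm_sub_norm_le u (d j)
      rw [norm_sub_rev] at this
      linarith
    obtain ⟨s₀, hs₀⟩ := (d j).2
    have hpow : Tendsto (fun k : ℕ => (2 : ℝ) ^ k) atTop atTop :=
      tendsto_pow_atTop_atTop_of_one_lt (by norm_num)
    obtain ⟨s, hs⟩ := ((hpow.eventually_ge_atTop ‖(d j : X)‖).and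
      ((hpow.eventually_ge_atTop (δ * ‖(d j : X)‖)⁻¹).and
      ((hpow.eventually_ge_atTop (δ * ‖(d j : X)‖)).and
      ((hpow.eventually_ge_atTop (∑ i ∈ Finset.range s₀, ‖f i (d j)‖)).and
      ((eventually_ge_atTop 1).and (eventually_ge_atTop s₀)))))).exists_forall_of_atTop
    obtain ⟨h1, h2, h3, h4, h5, h6⟩ := hs (Nat.pair j s) (Nat.right_le_pair j s)
    have hvk : v (Nat.pair j s) = d j := by simp [hv]
    have hP : P (Nat.pair j s) := by
      simp only [P, hvk, zpow_neg, zpow_natCast]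
      refine ⟨h5, fun i hi => hs₀ i (h6.trans hi), h1, inv_le_of_inv_le₀ (by positivity) h2, h3, ?_⟩
      rwa [← Finset.sum_subset (Finset.range_mono h6) fun i _ hi => by
        rw [hs₀ i (by simpa using hi), norm_zero]]
    obtain ⟨-, hyk, hbk⟩ := (hyb (Nat.pair j s)).resolve_right fun hn => hn.1 hP
    exact ⟨Nat.pair j s, by rwa [hyk, hvk], by rw [hbk, hyk]⟩

end Targets

/-- If a separable infinite-dimensional Banach space `X` contains a closed subspace
isomorphic to `c₀(ℕ)`, then for every `ε ∈ (0,1)` the space `X` admits a bounded operator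
which is ε-hypercyclic but not hypercyclic. -/
theorem eps_hypercyclic_not_hypercyclic_of_contains_c0
    {𝕜 X : Type*} [RCLike 𝕜] [NormedAddCommGroup X] [NormedSpace 𝕜 X]
    [CompleteSpace X] [TopologicalSpace.SeparableSpace X]
    (hinf : ¬ FiniteDimensional 𝕜 X)
    (V : Submodule 𝕜 X) (hV : IsClosed (V : Set X))
    (hiso : Nonempty (V ≃L[𝕜] ZeroAtInftyContinuousMap ℕ 𝕜))
    {ε : ℝ} (hε : ε ∈ Set.Ioo (0 : ℝ) 1) :
    ∃ T : X →L[𝕜] X,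
      (∃ x : X, ∀ u : X, u ≠ 0 → ∃ n : ℕ, ‖(T ^ n) x - u‖ ≤ ε * ‖u‖) ∧
      ¬ ∃ x : X, Dense (Set.range fun n : ℕ => (T ^ n) x) := by
  obtain ⟨ψ⟩ := hiso
  obtain ⟨hε0, hε1⟩ := hε
  obtain ⟨e, f, C, h⟩ := exists_c0System V ψ
  have hC : 0 < C := zero_lt_one.trans_le h.one_le
  have hδ : 0 < ε / (4 * C) := by positivity
  obtain ⟨y, b, hb, hy0, hy, hη0, happrox⟩ := h.exists_targets hδ
  obtain ⟨T, hT, hTsum⟩ := h.exists_operator_orbitVec hb hy hy0 (fun _ _ => rfl) hη0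
  refine ⟨T, ⟨e 0, fun u hu => ?_⟩, ?_⟩
  · have hu0 := norm_pos_iff.2 hu
    obtain ⟨k, hk, hbk⟩ := happrox u (ε / 2 * ‖u‖) (by positivity) (by nlinarith)
    refine ⟨blockStart k, ?_⟩
    rw [hT, orbitVec_blockStart, orbitCoeff_blockStart, hbk, add_sub_assoc]
    have hyk : ‖y k‖ ≤ 2 * ‖u‖ := by
      have := norm_sub_norm_le (y k) u
      nlinarith
    calc _ ≤ ε / (4 * C) * ‖y k‖ * ‖e (blockStart k)‖ + ‖y k - u‖ := by
          refine (norm_add_le _ _).trans_eq ?_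
          rw [norm_smul, RCLike.norm_ofReal, abs_of_nonneg (by positivity)]
      _ ≤ ε / (4 * C) * (2 * ‖u‖) * C + ε / 2 * ‖u‖ := by
          gcongr
          exact h.norm_le _
      _ = ε * ‖u‖ := by
          field_simp
          ring
  · rintro ⟨x, hx⟩
    set A := C / (ε / (4 * C)) with hA
    have hA0 : 0 ≤ A := by positivity
    set K := (1 + 4 * (2 * A + 1)) * C + 2 * C with hK
    have hK0 : 0 < K := by positivity
    have hsep : ∀ n, blockStart 1 ≤ n → ∃ Φ : X →L[𝕜] 𝕜, Φ (e 0) = 1 ∧ Φ ((T ^ n) (e 0)) = 0 ∧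
        (∀ z, ‖Φ z‖ ≤ K * ‖z‖) ∧ ∀ z, ‖Φ ((T ^ n) z)‖ ≤ K * ‖z‖ := by
      intro n hn
      obtain ⟨Φ, h1, h2, h3, h4⟩ := h.exists_functional hb (fun _ _ => rfl) hη0 hn
      refine ⟨Φ, h1, by rw [hT, h2], fun z => (h3 z).trans ?_, fun z => ?_⟩
      · rw [← mul_assoc]
        gcongr
        linarith
      · obtain ⟨n, rfl⟩ : ∃ m, n = m + 1 := ⟨n - 1, by simp only [blockStart] at hn; omega⟩
        have hs := (hTsum n z).mapL Φ
        have hmap : ∀ i a, Φ (basisEval (fun k i => f i (y k)) b i a) =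
            basisEval (fun k i => f i (y k)) b i fun t => Φ (a t) :=
          map_basisEval _ b (Φ : X →ₗ[𝕜] 𝕜)
        have hs2 := summable_geometric_two.hasSum.mul_left (C * ‖z‖)
        rw [tsum_geometric_two] at hs2
        refine (hs.norm_le_of_bounded hs2 fun i => ?_).trans ?_
        · rw [map_smul, norm_smul, hmap]
          exact mul_le_mul (h.bound i z) (h4 i) (norm_nonneg _) (by positivity)
        · have : 0 ≤ (1 + 4 * (2 * A + 1)) * C * ‖z‖ := by positivity
          rw [hK]
          linarith
    have hnt : Nontrivial X := by
      refine ⟨e 0, 0, fun h0 => ?_⟩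
      have := h.biorthogonal 0 0
      simp [h0] at this
    set p : X := ((3 * K : ℝ) : 𝕜) • e 0 with hp
    obtain ⟨_, ⟨m, rfl⟩, hm⟩ := hx.exists_mem_open (Metric.isOpen_ball (x := p) (ε := 1))
      (Metric.nonempty_ball.2 one_pos)
    have := Module.punctured_nhds_neBot 𝕜 X
    have hfin : ((fun n : ℕ => (T ^ n) x) '' Set.Iio (m + blockStart 1)).Finite :=
      (Set.finite_Iio _).image _
    obtain ⟨_, ⟨⟨m', rfl⟩, hm'1⟩, hm'⟩ := (hx.sdiff_finite hfin).exists_mem_open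
      (Metric.isOpen_ball (x := p) (ε := 1)) (Metric.nonempty_ball.2 one_pos)
    have hmm' : m + blockStart 1 ≤ m' := by
      by_contra! hlt
      exact hm'1 ⟨m', hlt, rfl⟩
    obtain ⟨n, rfl⟩ : ∃ n, m' = n + m := ⟨m' - m, by omega⟩
    obtain ⟨Φ, h1, h2, h3, h4⟩ := hsep n (by omega)
    simp only [Metric.mem_ball, dist_eq_norm] at hm hm'
    have e1 : Φ ((T ^ n) ((T ^ m) x - p)) = Φ ((T ^ (n + m)) x - p) + ((3 * K : ℝ) : 𝕜) := by
      rw [pow_add, mul_apply_eq_comp, map_sub, map_sub, map_sub, hp, map_smul, map_smul, map_smul,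
        h1, h2]
      simp
    have e2 : ((3 * K : ℝ) : 𝕜) = Φ ((T ^ n) ((T ^ m) x - p)) - Φ ((T ^ (n + m)) x - p) := by
      rw [e1, add_sub_cancel_left]
    have e3 : 3 * K ≤ K * 1 + K * 1 := by
      calc 3 * K = ‖((3 * K : ℝ) : 𝕜)‖ := by
            rw [RCLike.norm_ofReal, abs_of_nonneg (by positivity)]
        _ ≤ _ := by
            rw [e2]
            refine (norm_sub_le _ _).trans (add_le_add ((h4 _).trans ?_) ((h3 _).trans ?_)) <;>
              gcongr
    linarith
end

section
/- Let K be an infinite compact metrizable topological space. Then for every ε ∈ (0,1), the Banach space C(K) of continuous scalar-valued functions on K, equipped with the supremum norm, admits a bounded linear operator that is ε-hypercyclic but not hypercyclic. -/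
open Filter Topology

namespace EpsHypercyclic

open TopologicalSpace
open scoped ZeroAtInfty

section NullFamilies

variable {ι 𝕜 : Type*} [RCLike 𝕜]

/-- A family tending to zero along the cofinite filter, as an element of `C₀(ι, 𝕜)`. -/
def nullFamily [TopologicalSpace ι] [DiscreteTopology ι] (f : ι → 𝕜)
    (hf : Tendsto f cofinite (𝓝 0)) : C₀(ι, 𝕜) where
  toFun := f
  continuous_toFun := continuous_of_discreteTopology
  zero_at_infty' := by rwa [cocompact_eq_cofinite]

@[simp]
theorem nullFamily_apply [TopologicalSpace ι] [DiscreteTopology ι] (f : ι → 𝕜)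
    (hf : Tendsto f cofinite (𝓝 0)) (i : ι) :
    nullFamily f hf i = f i := rfl

theorem norm_apply_le [TopologicalSpace ι] (a : C₀(ι, 𝕜)) (i : ι) : ‖a i‖ ≤ ‖a‖ :=
  a.toBCF.norm_coe_le_norm i

theorem norm_le_of_forall [TopologicalSpace ι] (a : C₀(ι, 𝕜)) {C : ℝ} (hC : 0 ≤ C)
    (h : ∀ i, ‖a i‖ ≤ C) : ‖a‖ ≤ C :=
  (BoundedContinuousFunction.norm_le (f := a.toBCF) hC).2 h

theorem tendsto_cofinite_zero_iff {f : ι → 𝕜} :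
    Tendsto f cofinite (𝓝 0) ↔ ∀ δ > 0, {i | δ ≤ ‖f i‖}.Finite := by
  simp [Metric.tendsto_nhds, eventually_cofinite]

theorem finite_le_norm [TopologicalSpace ι] [DiscreteTopology ι] (a : C₀(ι, 𝕜))
    {δ : ℝ} (hδ : 0 < δ) : {i | δ ≤ ‖a i‖}.Finite := by
  have h := a.zero_at_infty'
  rw [cocompact_eq_cofinite] at h
  exact tendsto_cofinite_zero_iff.1 h δ hδ

theorem tendsto_zero_of_finite_support {f : ι → 𝕜} (hf : f.support.Finite) :
    Tendsto f cofinite (𝓝 0) :=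
  tendsto_cofinite_zero_iff.2 fun δ hδ => hf.subset fun i (hi : δ ≤ ‖f i‖) =>
    norm_pos_iff.1 (hδ.trans_le hi)

/-- Finitely supported families are dense in `C₀(ι, 𝕜)`. -/
theorem exists_finite_support_norm_sub_le [TopologicalSpace ι] [DiscreteTopology ι] (a : C₀(ι, 𝕜))
    {δ : ℝ} (hδ : 0 < δ) :
    ∃ c : C₀(ι, 𝕜), (Function.support c).Finite ∧ ‖a - c‖ ≤ δ := by
  classical
  have hfin : (Function.support fun i => if δ ≤ ‖a i‖ then a i else 0).Finite :=
    (finite_le_norm a hδ).subset fun i hi => by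
      by_contra h
      simp_all
  refine ⟨nullFamily _ (tendsto_zero_of_finite_support hfin), hfin,
    norm_le_of_forall _ hδ.le fun i => ?_⟩
  by_cases h : δ ≤ ‖a i‖
  · simp [h, hδ.le]
  · simpa [h] using (not_le.1 h).le

end NullFamilies

section TaggedShift

variable {𝕜 : Type*} [RCLike 𝕜]

/-- The weight with which coordinate `(n, j + 1)` is moved to coordinate `(n, j)`. -/
def weight (𝕜 : Type*) [RCLike 𝕜] (n j : ℕ) : 𝕜 := if n = j + 1 then (2 ^ n)⁻¹ else 2

theorem norm_weight_le (n j : ℕ) : ‖weight 𝕜 n j‖ ≤ 2 := by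
  unfold weight
  split_ifs
  · rw [norm_inv, norm_pow, RCLike.norm_ofNat]
    exact (inv_le_one_of_one_le₀ (one_le_pow₀ one_le_two)).trans one_le_two
  · simp

theorem prod_weight (n j m : ℕ) : ∏ i ∈ Finset.range m, weight 𝕜 n (j + i) =
    if j < n ∧ n ≤ j + m then 2 ^ m / 2 ^ (n + 1) else 2 ^ m := by
  induction m with
  | zero => rw [if_neg (by omega)]; simp
  | succ m ih =>
    rw [Finset.prod_range_succ, ih, weight]
    by_cases h1 : n = j + m + 1
    · rw [if_neg (by omega), if_pos h1, if_pos (by omega)]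
      field_simp
      ring
    · rw [if_neg h1]
      by_cases h2 : j < n ∧ n ≤ j + m
      · rw [if_pos h2, if_pos (by omega)]
        ring
      · rw [if_neg h2, if_neg (by omega)]
        ring

theorem prod_weight_ne_zero (n j m : ℕ) : ∏ i ∈ Finset.range m, weight 𝕜 n (j + i) ≠ 0 := by
  rw [prod_weight]
  split_ifs <;> simp

theorem norm_inv_prod_weight_le (n j m : ℕ) :
    ‖(∏ i ∈ Finset.range m, weight 𝕜 n (j + i))⁻¹‖ ≤ 2 ^ (n + 1) / 2 ^ m := by
  rw [prod_weight]
  split_ifs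
  · simp
  · rw [norm_inv, norm_pow, RCLike.norm_ofNat, ← one_div]
    gcongr
    exact one_le_pow₀ one_le_two

theorem tendsto_taggedShift (η : 𝕜) (a : C₀(ℕ × ℕ, 𝕜)) :
    Tendsto (fun p : ℕ × ℕ => weight 𝕜 p.1 p.2 * a (p.1, p.2 + 1) +
      if p.1 = p.2 + 1 then 2 * η * a (0, p.2 + 1) else 0) cofinite (𝓝 0) := by
  rw [← add_zero (0 : 𝕜)]
  refine Tendsto.add (tendsto_cofinite_zero_iff.2 fun δ hδ => ?_)
    (tendsto_cofinite_zero_iff.2 fun δ hδ => ?_)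
  · refine ((finite_le_norm a (half_pos hδ)).image fun p => (p.1, p.2 - 1)).subset ?_
    rintro ⟨n, j⟩ h
    refine ⟨(n, j + 1), ?_, rfl⟩
    simp only [Set.mem_ofPred_eq, norm_mul] at h ⊢
    nlinarith [norm_weight_le (𝕜 := 𝕜) n j, norm_nonneg (a (n, j + 1))]
  · have hpos : 0 < δ / (2 * ‖η‖ + 1) := by positivity
    refine ((finite_le_norm a hpos).image fun p => (p.2, p.2 - 1)).subset ?_
    rintro ⟨n, j⟩ h
    simp only [Set.mem_ofPred_eq] at h
    split_ifs at h with hn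
    · refine ⟨(0, j + 1), ?_, by simp [hn]⟩
      simp only [Set.mem_ofPred_eq, norm_mul, RCLike.norm_ofNat] at h ⊢
      rw [div_le_iff₀ (by positivity)]
      nlinarith [norm_nonneg (a (0, j + 1))]
    · simp at h
      linarith

/-- The backward shift on each row of `ℕ × ℕ`, where row `0` moreover leaves a multiple of
coordinate `(0, n)` in row `n`. -/
noncomputable def taggedShift (η : 𝕜) : C₀(ℕ × ℕ, 𝕜) →L[𝕜] C₀(ℕ × ℕ, 𝕜) :=
  LinearMap.mkContinuous
    { toFun := fun a => nullFamily _ (tendsto_taggedShift η a)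
      map_add' := fun a b => by
        ext p
        simp only [nullFamily_apply, ZeroAtInftyContinuousMap.add_apply]
        split_ifs <;> ring
      map_smul' := fun r a => by
        ext p
        simp only [nullFamily_apply, ZeroAtInftyContinuousMap.smul_apply, smul_eq_mul,
          RingHom.id_apply]
        split_ifs <;> ring }
    (2 + 2 * ‖η‖) fun a => by
      refine norm_le_of_forall _ (by positivity) fun p => ?_
      simp only [LinearMap.coe_mk, AddHom.coe_mk, nullFamily_apply]
      refine (norm_add_le _ _).trans ?_
      rw [add_mul]
      refine add_le_add ?_ ?_
      · rw [norm_mul]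
        gcongr
        · exact norm_weight_le _ _
        · exact norm_apply_le a _
      · split_ifs
        · rw [norm_mul, norm_mul, RCLike.norm_ofNat]
          gcongr
          exact norm_apply_le a _
        · rw [norm_zero]
          positivity

theorem taggedShift_apply (η : 𝕜) (a : C₀(ℕ × ℕ, 𝕜)) (n j : ℕ) :
    taggedShift η a (n, j) = weight 𝕜 n j * a (n, j + 1) +
      if n = j + 1 then 2 * η * a (0, j + 1) else 0 := rfl

/-- The coordinates with respect to which `taggedShift η` is a weighted backward shift on each
row. -/
def untag (η : 𝕜) (a : C₀(ℕ × ℕ, 𝕜)) (n j : ℕ) : 𝕜 :=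
  a (n, j) - if j < n then η * a (0, j) else 0

theorem untag_taggedShift (η : 𝕜) (a : C₀(ℕ × ℕ, 𝕜)) (n j : ℕ) :
    untag η (taggedShift η a) n j = weight 𝕜 n j * untag η a n (j + 1) := by
  simp only [untag, taggedShift_apply, weight]
  rcases lt_trichotomy n (j + 1) with h | h | h
  · simp [h.ne, show ¬ j < n by omega, show ¬ j + 1 < n by omega]
  · subst h
    simp
    ring
  · simp [h.ne', h, show j < n by omega]
    ring

theorem untag_taggedShift_pow (η : 𝕜) (a : C₀(ℕ × ℕ, 𝕜)) (n j m : ℕ) :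
    untag η ((taggedShift η ^ m) a) n j =
      (∏ i ∈ Finset.range m, weight 𝕜 n (j + i)) * untag η a n (j + m) := by
  induction m generalizing a with
  | zero => simp
  | succ m ih =>
    rw [pow_succ, mul_apply_eq_comp, ih, untag_taggedShift, Finset.prod_range_succ]
    ring_nf

theorem untag_row_zero (η : 𝕜) (a : C₀(ℕ × ℕ, 𝕜)) (j : ℕ) : untag η a 0 j = a (0, j) := by
  simp [untag]

theorem taggedShift_pow_apply_zero (η : 𝕜) (a : C₀(ℕ × ℕ, 𝕜)) (j m : ℕ) :
    (taggedShift η ^ m) a (0, j) = 2 ^ m * a (0, j + m) := by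
  rw [← untag_row_zero η, untag_taggedShift_pow, prod_weight, untag_row_zero]
  simp

theorem taggedShift_pow_apply (η : 𝕜) (a : C₀(ℕ × ℕ, 𝕜)) (n j m : ℕ) :
    (taggedShift η ^ m) a (n, j) =
      (∏ i ∈ Finset.range m, weight 𝕜 n (j + i)) * untag η a n (j + m) +
        if j < n then η * (2 ^ m * a (0, j + m)) else 0 := by
  rw [← untag_taggedShift_pow, untag, taggedShift_pow_apply_zero]
  ring

/-- Finitely supported families are annihilated by the large powers of `taggedShift η`. -/
theorem eventually_taggedShift_pow_eq_zero (η : 𝕜) {a : C₀(ℕ × ℕ, 𝕜)}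
    (ha : (Function.support a).Finite) : ∀ᶠ m in atTop, (taggedShift η ^ m) a = 0 := by
  obtain ⟨N, hN⟩ := (ha.image Prod.snd).bddAbove
  have hz : ∀ n j, N < j → a (n, j) = 0 := fun n j hj => by
    by_contra h
    exact absurd (hN ⟨(n, j), h, rfl⟩) (not_le.2 hj)
  filter_upwards [eventually_gt_atTop N] with m hm
  ext ⟨n, j⟩
  rw [taggedShift_pow_apply, untag, hz _ _ (show N < j + m by omega),
    hz _ _ (show N < j + m by omega)]
  simp

theorem norm_untag_return_le (η : 𝕜) (a : C₀(ℕ × ℕ, 𝕜)) {n : ℕ} (hn : 0 < n) :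
    ‖(taggedShift η ^ n) a (n, 0) - η * (taggedShift η ^ n) a (0, 0)‖ ≤ ‖a‖ / 2 := by
  have h := untag_taggedShift_pow η a n 0 n
  rw [prod_weight, if_pos (by omega)] at h
  simp only [untag, if_pos hn, zero_add, lt_irrefl, if_false, sub_zero] at h
  rw [h, norm_mul, norm_div, norm_pow, norm_pow, RCLike.norm_ofNat]
  have := norm_apply_le a (n, n)
  rw [pow_succ]
  field_simp
  linarith

/-- No orbit of `taggedShift η` is dense. -/
theorem not_dense_range_taggedShift_pow {η : 𝕜} (hη : η ≠ 0) (hη1 : ‖η‖ ≤ 1) (a : C₀(ℕ × ℕ, 𝕜)) :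
    ¬ Dense (Set.range fun n : ℕ => (taggedShift η ^ n) a) := by
  intro hd
  have hpos : 0 < ‖η‖ := norm_pos_iff.2 hη
  have hfin : (Function.support fun p : ℕ × ℕ => if p = (0, 0) then (1 : 𝕜) else 0).Finite :=
    (Set.finite_singleton (0, 0)).subset fun p hp => by simp_all
  set b : C₀(ℕ × ℕ, 𝕜) := nullFamily _ (tendsto_zero_of_finite_support hfin) with hb
  have hb0 : b (0, 0) = 1 := by simp [hb]
  have : Nontrivial C₀(ℕ × ℕ, 𝕜) := ⟨b, 0, fun h => by simp [h] at hb0⟩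
  obtain ⟨_, ⟨m, rfl⟩, hm⟩ := hd.exists_dist_lt 0 (show 0 < ‖η‖ / 4 by positivity)
  have : ∀ x : C₀(ℕ × ℕ, 𝕜), NeBot (𝓝[≠] x) := fun x => Module.punctured_nhds_neBot 𝕜 _ x
  obtain ⟨_, ⟨⟨n, rfl⟩, hnm⟩, hn⟩ := (hd.sdiff_finite
    ((Set.finite_Iic m).image fun n : ℕ => (taggedShift η ^ n) a)).exists_dist_lt b
      (show 0 < ‖η‖ / 4 by positivity)
  have hlt : m < n := not_le.1 fun h => hnm ⟨n, h, rfl⟩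
  obtain ⟨k, rfl⟩ := Nat.exists_eq_add_of_lt hlt
  have hk := norm_untag_return_le η ((taggedShift η ^ m) a) (Nat.succ_pos k)
  have hmul : (taggedShift η ^ (k + 1)) ((taggedShift η ^ m) a) =
      (taggedShift η ^ (m + k + 1)) a := by
    rw [← mul_apply_eq_comp, ← pow_add]
    congr 2
    omega
  rw [Nat.succ_eq_add_one, hmul] at hk
  set y := (taggedShift η ^ (m + k + 1)) a
  rw [dist_zero_left] at hm
  rw [dist_eq_norm] at hn
  have h1 := (norm_apply_le (b - y) (0, 0)).trans hn.le
  have h2 := (norm_apply_le (b - y) (k + 1, 0)).trans hn.le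
  have hbk : b (k + 1, 0) = 0 := by simp [hb]
  rw [ZeroAtInftyContinuousMap.sub_apply] at h1 h2
  rw [hb0] at h1
  rw [hbk] at h2
  have key : η = -((y (k + 1, 0) - η * y (0, 0)) + (0 - y (k + 1, 0)) - η * (1 - y (0, 0))) := by
    ring
  have h3 : ‖η‖ ≤ ‖y (k + 1, 0) - η * y (0, 0)‖ + ‖0 - y (k + 1, 0)‖ + ‖η‖ * ‖1 - y (0, 0)‖ := by
    rw [← norm_mul]
    conv_lhs => rw [key, norm_neg]
    exact (norm_sub_le _ _).trans (add_le_add_left (norm_add_le _ _) _)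
  nlinarith [norm_nonneg (1 - y (0, 0))]

/-- Up to an error controlled by `η`, every finitely supported family `c` is reached after `m + 1`
steps from a small family, whose entry in column `0` after `m` steps is prescribed outside of
row `0`. -/
theorem eventually_exists_source (η : 𝕜) {c : C₀(ℕ × ℕ, 𝕜)} (hc : (Function.support c).Finite)
    (k : ℕ) (τ : 𝕜) {δ : ℝ} (hδ : 0 < δ) :
    ∀ᶠ m in atTop, ∃ b : C₀(ℕ × ℕ, 𝕜), ‖b‖ ≤ δ ∧
      ‖(taggedShift η ^ (m + 1)) b - c‖ ≤ ‖η‖ * ‖c‖ ∧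
      ∀ n, (taggedShift η ^ m) b (n + 1, 0) = if n = k then τ else 0 := by
  obtain ⟨N, hN⟩ := (hc.image Prod.fst).bddAbove
  have hz : ∀ n j, N < n → c (n, j) = 0 := fun n j hj => by
    by_contra h
    exact absurd (hN ⟨(n, j), h, rfl⟩) (not_le.2 hj)
  set A : ℝ := 2 ^ (N + 1) * ‖c‖ + 2 ^ (k + 2) * ‖τ‖ with hA
  have hlim : Tendsto (fun m : ℕ => A * (1 / 2 : ℝ) ^ m) atTop (𝓝 0) := by
    simpa using (tendsto_pow_atTop_nhds_zero_of_lt_one (r := (1 / 2 : ℝ)) (by norm_num)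
      (by norm_num)).const_mul A
  filter_upwards [hlim.eventually_le_const hδ] with m hm
  let W : ℕ → ℕ → ℕ → 𝕜 := fun n j m => ∏ i ∈ Finset.range m, weight 𝕜 n (j + i)
  have hW : ∀ n j m, W n j m ≠ 0 := fun n j m => prod_weight_ne_zero n j m
  let f : ℕ × ℕ → 𝕜 := fun p =>
    (if m + 1 ≤ p.2 then (W p.1 (p.2 - (m + 1)) (m + 1))⁻¹ * c (p.1, p.2 - (m + 1)) else 0) +
      if p = (k + 1, m) then (W (k + 1) 0 m)⁻¹ * τ else 0
  have hfin : f.support.Finite := by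
    refine ((hc.image fun p => (p.1, p.2 + (m + 1))).union
      (Set.finite_singleton (k + 1, m))).subset ?_
    rintro ⟨n, i⟩ h
    by_contra hni
    simp only [Set.mem_union, Set.mem_singleton_iff, not_or] at hni
    apply h
    simp only [f, if_neg hni.2, add_zero]
    split_ifs with hi
    · rw [mul_eq_zero]
      by_contra hne
      exact hni.1 ⟨(n, i - (m + 1)), fun h0 => hne (Or.inr h0), by simp; omega⟩
    · rfl
  set b : C₀(ℕ × ℕ, 𝕜) := nullFamily f (tendsto_zero_of_finite_support hfin)
  have hb1 : ∀ n j, b (n, j + (m + 1)) = (W n j (m + 1))⁻¹ * c (n, j) := fun n j => by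
    have : (n, j + (m + 1)) ≠ (k + 1, m) := fun h => by
      rw [Prod.mk.injEq] at h
      omega
    have hle : m + 1 ≤ j + (m + 1) := by omega
    simp only [b, nullFamily_apply, f, if_neg this, if_pos hle, add_zero, Nat.add_sub_cancel]
  have hb2 : ∀ n, b (n, m) = if n = k + 1 then (W (k + 1) 0 m)⁻¹ * τ else 0 := fun n => by
    simp [b, f]
  have hW0 : ∀ j m, W 0 j m = 2 ^ m := fun j m => by simp [W, prod_weight]
  refine ⟨b, ?_, ?_, fun n => ?_⟩
  · refine (norm_le_of_forall _ (by positivity) fun p => ?_).trans hm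
    obtain ⟨n, i⟩ := p
    rw [hA, add_mul]
    refine (norm_add_le _ _).trans (add_le_add ?_ ?_)
    · split_ifs with hi
      · by_cases hn : N < n
        · simp only [hz n _ hn, mul_zero, norm_zero]
          positivity
        · rw [norm_mul]
          calc _ ≤ (2 ^ (n + 1) / 2 ^ (m + 1)) * ‖c‖ :=
                mul_le_mul (norm_inv_prod_weight_le _ _ _) (norm_apply_le c _) (norm_nonneg _)
                  (by positivity)
            _ ≤ (2 ^ (N + 1) / 2 ^ m) * ‖c‖ := by
                gcongr
                · norm_num
                · omega
                · norm_num
                · omega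
            _ = _ := by
                rw [div_pow, one_pow]
                ring
      · rw [norm_zero]
        positivity
    · split_ifs
      · rw [norm_mul]
        calc _ ≤ (2 ^ (k + 2) / 2 ^ m) * ‖τ‖ :=
              mul_le_mul_of_nonneg_right (norm_inv_prod_weight_le _ _ _) (norm_nonneg _)
          _ = _ := by
              rw [div_pow, one_pow]
              ring
      · rw [norm_zero]
        positivity
  · refine norm_le_of_forall _ (by positivity) fun p => ?_
    obtain ⟨n, j⟩ := p
    have key : ((taggedShift η ^ (m + 1)) b - c) (n, j) =
        (if j < n then η * c (0, j) else 0) - if j + (m + 1) < n then η * c (0, j) else 0 := by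
      rw [ZeroAtInftyContinuousMap.sub_apply, taggedShift_pow_apply, untag, hb1, hb1, hW0]
      change W n j (m + 1) * _ + _ - _ = _
      by_cases h : j + (m + 1) < n
      · have : W n j (m + 1) = 2 ^ (m + 1) := by
          simp only [W]
          rw [prod_weight, if_neg (by omega)]
        rw [if_pos h, if_pos h, this]
        field_simp
        ring
      · rw [if_neg h, if_neg h, sub_zero, mul_inv_cancel_left₀ (hW _ _ _)]
        field_simp
        ring
    have hle : ‖η * c (0, j)‖ ≤ ‖η‖ * ‖c‖ := by
      rw [norm_mul]
      gcongr
      exact norm_apply_le c _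
    have hnn : 0 ≤ ‖η‖ * ‖c‖ := by positivity
    rw [key]
    split_ifs <;> simp_all
  · rw [taggedShift_pow_apply, untag, zero_add, hb2, hb2]
    change W (n + 1) 0 m * _ + _ = _
    by_cases h : n = k
    · subst h
      simp [mul_inv_cancel_left₀ (hW _ _ _)]
    · simp [h]

end TaggedShift

section ComplementedNullFamilies

variable {𝕜 X : Type*} [RCLike 𝕜] [NormedAddCommGroup X] [NormedSpace 𝕜 X] [CompleteSpace X]

theorem exists_hasSum_smul {v : ℕ → X} (hv : Summable fun k => ‖v k‖) :
    ∃ R : C₀(ℕ × ℕ, 𝕜) →L[𝕜] X, ∀ a, HasSum (fun k => a (k + 1, 0) • v k) (R a) := by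
  have hle : ∀ (a : C₀(ℕ × ℕ, 𝕜)) k, ‖a (k + 1, 0) • v k‖ ≤ ‖a‖ * ‖v k‖ := fun a k => by
    rw [norm_smul]
    gcongr
    exact norm_apply_le a _
  have hs : ∀ a : C₀(ℕ × ℕ, 𝕜), Summable fun k => a (k + 1, 0) • v k := fun a =>
    .of_norm_bounded (hv.mul_left _) (hle a)
  refine ⟨LinearMap.mkContinuous
    { toFun := fun a => ∑' k, a (k + 1, 0) • v k
      map_add' := fun a b => by
        simp only [ZeroAtInftyContinuousMap.add_apply, add_smul]
        exact (hs a).tsum_add (hs b)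
      map_smul' := fun r a => by
        simp only [ZeroAtInftyContinuousMap.smul_apply, smul_assoc, RingHom.id_apply]
        exact (hs a).tsum_const_smul r } (∑' k, ‖v k‖) fun a => ?_, fun a => (hs a).hasSum⟩
  rw [mul_comm]
  exact tsum_of_norm_bounded (hv.hasSum.mul_left _) (hle a)

/-- A separable Banach space with a complemented copy of `c₀` carries, for every `ε ∈ (0, 1)`, an
`ε`-hypercyclic operator which is not hypercyclic. -/
theorem exists_eps_hypercyclic_not_hypercyclic [SeparableSpace X] {ε : ℝ}
    (hε : ε ∈ Set.Ioo (0 : ℝ) 1) (J : C₀(ℕ × ℕ, 𝕜) →L[𝕜] X) (P : X →L[𝕜] C₀(ℕ × ℕ, 𝕜))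
    (hPJ : ∀ a, P (J a) = a) :
    ∃ T : X →L[𝕜] X,
      (∃ x : X, ∀ u : X, u ≠ 0 → ∃ n : ℕ, ‖(T ^ n) x - u‖ ≤ ε * ‖u‖) ∧
      ¬ ∃ x : X, Dense (Set.range fun n : ℕ => (T ^ n) x) := by
  obtain ⟨hε0, hε1⟩ := hε
  have hd := denseRange_denseSeq X
  set d := denseSeq X
  set z : ℕ → X := fun k => d k - J (P (d k)) with hz
  have hPz : ∀ k, P (z k) = 0 := fun k => by simp [hz, hPJ]
  set r : ℕ → ℝ := fun k => (1 / 2) ^ k / (1 + ‖z k‖) with hr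
  have hr0 : ∀ k, 0 < r k := fun k => by positivity
  have hv : Summable fun k => ‖(r k : 𝕜) • z k‖ := by
    refine .of_nonneg_of_le (fun _ => norm_nonneg _) (fun k => ?_) summable_geometric_two
    rw [norm_smul, RCLike.norm_ofReal, abs_of_pos (hr0 k), hr]
    dsimp only
    rw [div_mul_eq_mul_div, div_le_iff₀ (by positivity)]
    gcongr
    linarith
  obtain ⟨R, hR⟩ := exists_hasSum_smul (𝕜 := 𝕜) hv
  have hPR : ∀ a, P (R a) = 0 := fun a => by
    have h := P.hasSum (hR a)
    simp only [map_smul, hPz, smul_zero] at h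
    exact h.unique hasSum_zero
  set s : ℝ := ε / (8 * (‖J‖ * ‖P‖ + 1)) with hs
  have hs0 : 0 < s := by positivity
  have hsJP : ‖J‖ * ‖P‖ * s ≤ ε / 8 := by
    rw [hs, mul_div_assoc', div_le_div_iff₀ (by positivity) (by positivity)]
    nlinarith
  have hs1 : s ≤ 1 := by
    rw [hs, div_le_one (by positivity)]
    nlinarith [mul_nonneg (norm_nonneg J) (norm_nonneg P)]
  have hns : ‖(s : 𝕜)‖ = s := by rw [RCLike.norm_ofReal, abs_of_pos hs0]
  set B := taggedShift (s : 𝕜) with hB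
  set T : X →L[𝕜] X := (J ∘L B + R) ∘L P with hT
  have hPT : ∀ m x, P ((T ^ m) x) = (B ^ m) (P x) := fun m => by
    induction m with
    | zero => simp
    | succ m ih =>
      intro x
      rw [pow_succ', pow_succ', mul_apply_eq_comp, mul_apply_eq_comp, ← ih]
      simp [hT, hPJ, hPR]
  have hTpow : ∀ m x, (T ^ (m + 1)) x = J ((B ^ (m + 1)) (P x)) + R ((B ^ m) (P x)) := fun m x => by
    rw [pow_succ', pow_succ', mul_apply_eq_comp, mul_apply_eq_comp, ← hPT]
    rfl
  refine ⟨T, ?_, ?_⟩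
  · have hopen : ∀ u : X, IsOpen {x | ∃ n : ℕ, ‖(T ^ n) x - u‖ < ε / 2 * ‖u‖} := fun u => by
      simp only [Set.ofPred_exists]
      exact isOpen_iUnion fun n => isOpen_lt (by fun_prop) continuous_const
    have hdense : ∀ u : X, u ≠ 0 → Dense {x | ∃ n : ℕ, ‖(T ^ n) x - u‖ < ε / 2 * ‖u‖} := by
      intro u hu
      have hu0 : 0 < ‖u‖ := norm_pos_iff.2 hu
      rw [Metric.dense_iff]
      intro x δ hδ
      have hJ1 : 0 < ‖J‖ + 1 := by positivity
      obtain ⟨a, ha, hax⟩ := exists_finite_support_norm_sub_le (P x)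
        (show 0 < δ / 4 / (‖J‖ + 1) by positivity)
      set γ : ℝ := ε / 4 * ‖u‖ / (2 * ‖J‖ + ‖J‖ * ‖P‖ + 1) with hγ
      have hγ0 : 0 < γ := by positivity
      have hγe : γ * (2 * ‖J‖ + ‖J‖ * ‖P‖ + 1) = ε / 4 * ‖u‖ := by
        rw [hγ]
        field_simp
      obtain ⟨c, hc, hcu⟩ := exists_finite_support_norm_sub_le (P u) hγ0
      obtain ⟨k, hk⟩ := hd.exists_dist_lt u hγ0
      obtain ⟨m, ⟨b, hb, hbc, hbk⟩, hm1, hm2⟩ := ((eventually_exists_source (s : 𝕜) hc k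
        ((r k : 𝕜)⁻¹) (show 0 < δ / 4 / (‖J‖ + 1) by positivity)).and
          ((eventually_taggedShift_pow_eq_zero (s : 𝕜) ha).and
            ((tendsto_add_atTop_nat 1).eventually
              (eventually_taggedShift_pow_eq_zero (s : 𝕜) ha)))).exists
      have hJle : ∀ y : C₀(ℕ × ℕ, 𝕜), ‖y‖ ≤ δ / 4 / (‖J‖ + 1) → ‖J y‖ ≤ δ / 4 := fun y hy =>
        calc ‖J y‖ ≤ (‖J‖ + 1) * (δ / 4 / (‖J‖ + 1)) :=
              (J.le_opNorm y).trans (mul_le_mul (by linarith) hy (norm_nonneg _) hJ1.le)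
          _ = δ / 4 := by field_simp
      refine ⟨x - J (P x - a) + J b, ?_, m + 1, ?_⟩
      · rw [Metric.mem_ball, dist_eq_norm]
        calc ‖x - J (P x - a) + J b - x‖ = ‖J b - J (P x - a)‖ := by
              congr 1
              abel
          _ ≤ δ / 4 + δ / 4 := (norm_sub_le _ _).trans (add_le_add (hJle _ hb) (hJle _ hax))
          _ < δ := by linarith
      · have hP : P (x - J (P x - a) + J b) = a + b := by
          rw [map_add, map_sub, hPJ, hPJ]
          abel
        have hRb : R ((B ^ m) b) = z k := by
          refine (hR _).unique ?_
          convert hasSum_ite_eq k (z k) using 2 with n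
          rw [hB, hbk]
          split_ifs with hn
          · subst hn
            rw [inv_smul_smul₀]
            exact_mod_cast (hr0 _).ne'
          · rw [zero_smul]
        rw [hTpow, hP, map_add (B ^ (m + 1)), map_add (B ^ m), hm1, hm2, zero_add, zero_add, hRb]
        have hdk : ‖d k - u‖ < γ := by rwa [← dist_eq_norm, dist_comm]
        have heq : J ((B ^ (m + 1)) b) + z k - u =
            J ((B ^ (m + 1)) b - c) - J (P u - c) + (d k - u) - J (P (d k - u)) := by
          simp only [hz, map_sub]
          abel
        have hcn : ‖c‖ ≤ ‖P‖ * ‖u‖ + γ := by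
          have h1 : c = P u - (P u - c) := by abel
          rw [h1]
          exact (norm_sub_le _ _).trans (add_le_add (P.le_opNorm u) hcu)
        rw [hns] at hbc
        have e1 : ‖J ((B ^ (m + 1)) b - c)‖ ≤ ‖J‖ * (s * (‖P‖ * ‖u‖ + γ)) :=
          J.le_opNorm_of_le (hbc.trans (by gcongr))
        have e2 : ‖J (P u - c)‖ ≤ ‖J‖ * γ := J.le_opNorm_of_le hcu
        have e3 : ‖J (P (d k - u))‖ ≤ ‖J‖ * (‖P‖ * γ) :=
          J.le_opNorm_of_le (P.le_opNorm_of_le hdk.le)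
        have e4 : ‖J‖ * (s * (‖P‖ * ‖u‖ + γ)) ≤ ε / 8 * ‖u‖ + ‖J‖ * γ := by
          have h1 := mul_le_mul_of_nonneg_right hsJP hu0.le
          have h2 := mul_le_mul_of_nonneg_right hs1 (mul_nonneg (norm_nonneg J) hγ0.le)
          linarith
        rw [heq]
        have e5 := (norm_sub_le (J ((B ^ (m + 1)) b - c) - J (P u - c) + (d k - u))
          (J (P (d k - u)))).trans (add_le_add_left ((norm_add_le _ _).trans
            (add_le_add_left (norm_sub_le _ _) _)) _)
        have e6 : 0 < ε * ‖u‖ := by positivity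
        linarith
    obtain ⟨x, hx⟩ := (dense_iInter_of_isOpen (fun i : {k // d k ≠ 0} => hopen (d i))
      fun i => hdense (d i) i.2).nonempty
    refine ⟨x, fun u hu => ?_⟩
    have hu0 : 0 < ‖u‖ := norm_pos_iff.2 hu
    obtain ⟨k, hk⟩ := hd.exists_dist_lt u (show 0 < ε / 4 * ‖u‖ by positivity)
    rw [dist_eq_norm] at hk
    have hdk : d k ≠ 0 := fun h => by
      rw [h, sub_zero] at hk
      nlinarith
    obtain ⟨n, hn⟩ := Set.mem_iInter.1 hx ⟨k, hdk⟩
    refine ⟨n, ?_⟩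
    have h1 := norm_sub_le_norm_sub_add_norm_sub ((T ^ n) x) (d k) u
    have h2 : ‖d k‖ ≤ ‖u‖ + ε / 4 * ‖u‖ := by
      have := norm_sub_norm_le (d k) u
      rw [norm_sub_rev] at this
      linarith
    rw [norm_sub_rev (d k) u] at h1
    have h3 := mul_le_mul_of_nonneg_left h2 (half_pos hε0).le
    have h4 := mul_le_mul_of_nonneg_right hε1.le (mul_pos hε0 hu0).le
    dsimp only at hn
    linarith [mul_pos hε0 hu0]
  · rintro ⟨x, hx⟩
    have hsurj : Function.Surjective P := fun a => ⟨J a, hPJ a⟩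
    have h := hsurj.denseRange.comp hx P.continuous
    have hcomp : (P ∘ fun n : ℕ => (T ^ n) x) = fun n : ℕ => (B ^ n) (P x) :=
      funext fun n => hPT n x
    rw [hcomp] at h
    exact not_dense_range_taggedShift_pow (by exact_mod_cast hs0.ne') (hns.trans_le hs1) _ h

end ComplementedNullFamilies

section ContinuousFunctions

variable {𝕜 K : Type*} [RCLike 𝕜] [TopologicalSpace K] [CompactSpace K]

/-- A sequence of bumps with disjoint supports, peaking along a convergent sequence. -/
theorem exists_disjoint_bumps [MetrizableSpace K] [Infinite K] :
    ∃ (p : ℕ → K) (q : K) (φ : ℕ → C(K, ℝ)), Tendsto p atTop (𝓝 q) ∧ (∀ n, φ n (p n) = 1) ∧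
      (∀ n, φ n q = 0) ∧ (∀ n x, φ n x ∈ Set.Icc (0 : ℝ) 1) ∧
      ∀ m n x, φ m x ≠ 0 → φ n x ≠ 0 → m = n := by
  obtain ⟨U, hUinf, hUo, hUd⟩ := exists_seq_infinite_isOpen_pairwise_disjoint K
  choose p₀ hp₀ using fun n => (hUinf n).nonempty
  obtain ⟨q, σ, hσ, hq⟩ := CompactSpace.tendsto_subseq p₀
  have hdisj : ∀ m n x, x ∈ U m → x ∈ U n → m = n := fun m n x hm hn => by
    by_contra h
    exact Set.disjoint_left.1 (hUd h) hm hn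
  have hqU : ∀ n, q ∉ U n := fun n hn => by
    obtain ⟨m, hm⟩ := eventually_atTop.1 (hq.eventually ((hUo n).mem_nhds hn))
    have h1 := hdisj _ _ _ (hm m le_rfl) (hp₀ (σ m))
    have h2 := hdisj _ _ _ (hm (m + 1) (Nat.le_succ m)) (hp₀ (σ (m + 1)))
    exact absurd (hσ.injective (h1.symm.trans h2)) (by omega)
  have hex : ∀ n, ∃ f : C(K, ℝ), Set.EqOn f 0 (U (σ n))ᶜ ∧ Set.EqOn f 1 {p₀ (σ n)} ∧
      ∀ x, f x ∈ Set.Icc (0 : ℝ) 1 := fun n =>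
    exists_continuous_zero_one_of_isClosed (hUo _).isClosed_compl isClosed_singleton
      (Set.disjoint_singleton_right.2 fun h => h (hp₀ _))
  choose φ hφ0 hφ1 hφ using hex
  refine ⟨p₀ ∘ σ, q, φ, hq, fun n => hφ1 n rfl, fun n => hφ0 n (hqU _), hφ, fun m n x hm hn => ?_⟩
  have hmem : ∀ i, φ i x ≠ 0 → x ∈ U (σ i) := fun i hi => by
    by_contra h
    exact hi (hφ0 i h)
  exact hσ.injective (hdisj _ _ _ (hmem m hm) (hmem n hn))

/-- If the finite combinations of `ψ` are bounded by the supremum of their coefficients, then `ψ`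
can be summed against every family in `C₀(ι, 𝕜)`. -/
theorem exists_hasSum_of_norm_sum_le {ι 𝕜 X : Type*} [RCLike 𝕜] [TopologicalSpace ι]
    [DiscreteTopology ι] [NormedAddCommGroup X] [NormedSpace 𝕜 X] [CompleteSpace X] {ψ : ι → X}
    (hψ : ∀ (a : ι → 𝕜) (C : ℝ) (t : Finset ι), 0 ≤ C → (∀ i ∈ t, ‖a i‖ ≤ C) →
      ‖∑ i ∈ t, a i • ψ i‖ ≤ C) :
    ∃ J : C₀(ι, 𝕜) →L[𝕜] X, ∀ a, HasSum (fun i => a i • ψ i) (J a) := by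
  have hs : ∀ a : C₀(ι, 𝕜), Summable fun i => a i • ψ i := fun a =>
    summable_iff_vanishing_norm.2 fun δ hδ =>
      ⟨(finite_le_norm a (half_pos hδ)).toFinset, fun t ht =>
        (hψ a (δ / 2) t (half_pos hδ).le fun i hi => by
          have := Finset.disjoint_left.1 ht hi
          simp only [Set.Finite.mem_toFinset, Set.mem_ofPred_eq, not_le] at this
          exact this.le).trans_lt (half_lt_self hδ)⟩
  refine ⟨LinearMap.mkContinuous
    { toFun := fun a => ∑' i, a i • ψ i
      map_add' := fun a b => by
        simp only [ZeroAtInftyContinuousMap.add_apply, add_smul]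
        exact (hs a).tsum_add (hs b)
      map_smul' := fun r a => by
        simp only [ZeroAtInftyContinuousMap.smul_apply, smul_assoc, RingHom.id_apply]
        exact (hs a).tsum_const_smul r } 1 fun a => ?_, fun a => (hs a).hasSum⟩
  rw [one_mul]
  exact le_of_tendsto (hs a).hasSum.norm
    (Eventually.of_forall fun t => hψ a _ t (norm_nonneg a) fun i _ => norm_apply_le a i)

/-- Along a null family of points, differences of values define an operator into `C₀(ι, 𝕜)`. -/
theorem exists_sub_apply {ι : Type*} [TopologicalSpace ι] [DiscreteTopology ι] {p : ι → K} {q : K}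
    (hp : Tendsto p cofinite (𝓝 q)) :
    ∃ P : C(K, 𝕜) →L[𝕜] C₀(ι, 𝕜), ∀ f i, P f i = f (p i) - f q := by
  have hnull : ∀ f : C(K, 𝕜), Tendsto (fun i => f (p i) - f q) cofinite (𝓝 0) := fun f => by
    rw [← sub_self (f q)]
    exact ((f.continuous.tendsto q).comp hp).sub tendsto_const_nhds
  refine ⟨LinearMap.mkContinuous
    { toFun := fun f => nullFamily _ (hnull f)
      map_add' := fun f g => by
        ext i
        simp only [nullFamily_apply, ContinuousMap.add_apply, ZeroAtInftyContinuousMap.add_apply]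
        ring
      map_smul' := fun r f => by
        ext i
        simp only [nullFamily_apply, ContinuousMap.smul_apply,
          ZeroAtInftyContinuousMap.smul_apply, smul_eq_mul, RingHom.id_apply]
        ring } 2 fun f => ?_, fun f i => rfl⟩
  refine norm_le_of_forall _ (by positivity) fun i => (norm_sub_le _ _).trans ?_
  linarith [f.norm_coe_le_norm (p i), f.norm_coe_le_norm q]

theorem norm_sum_smul_le_of_disjoint {ι : Type*} {ψ : ι → C(K, 𝕜)} (hψ : ∀ i x, ‖ψ i x‖ ≤ 1)
    (hd : ∀ i j x, ψ i x ≠ 0 → ψ j x ≠ 0 → i = j) {a : ι → 𝕜} {C : ℝ} {t : Finset ι}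
    (hC : 0 ≤ C) (ht : ∀ i ∈ t, ‖a i‖ ≤ C) : ‖∑ i ∈ t, a i • ψ i‖ ≤ C := by
  refine (ContinuousMap.norm_le _ hC).2 fun x => ?_
  rw [ContinuousMap.sum_apply]
  simp only [ContinuousMap.smul_apply, smul_eq_mul]
  by_cases h : ∃ i ∈ t, ψ i x ≠ 0
  · obtain ⟨i, hi, hix⟩ := h
    have hz : ∀ j ∈ t, j ≠ i → a j * ψ j x = 0 := fun j _ hj => by
      rw [mul_eq_zero]
      by_contra h
      exact hj (hd j i x (fun h0 => h (Or.inr h0)) hix)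
    rw [Finset.sum_eq_single_of_mem i hi hz, norm_mul]
    exact (mul_le_of_le_one_right (norm_nonneg _) (hψ i x)).trans (ht i hi)
  · push Not at h
    rw [Finset.sum_eq_zero fun i hi => by rw [h i hi, mul_zero], norm_zero]
    exact hC

/-- The space of continuous functions on an infinite compact metrizable space contains a
complemented copy of `c₀`. -/
theorem exists_complemented_nullFamilies (𝕜 K ι : Type*) [RCLike 𝕜] [TopologicalSpace K]
    [CompactSpace K] [MetrizableSpace K] [Infinite K] [TopologicalSpace ι] [DiscreteTopology ι]
    (e : ι ≃ ℕ) :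
    ∃ (J : C₀(ι, 𝕜) →L[𝕜] C(K, 𝕜)) (P : C(K, 𝕜) →L[𝕜] C₀(ι, 𝕜)), ∀ a, P (J a) = a := by
  classical
  obtain ⟨p, q, φ, hp, hφp, hφq, hφ, hφd⟩ := exists_disjoint_bumps (K := K)
  obtain ⟨ψ, hψ⟩ : ∃ ψ : ι → C(K, 𝕜), ∀ i x, ψ i x = (φ (e i) x : 𝕜) :=
    ⟨fun i => ⟨fun x => (φ (e i) x : 𝕜), by fun_prop⟩, fun _ _ => rfl⟩
  have hψ1 : ∀ i x, ‖ψ i x‖ ≤ 1 := fun i x => by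
    rw [hψ, RCLike.norm_ofReal, abs_of_nonneg (hφ _ x).1]
    exact (hφ _ x).2
  have hψd : ∀ i j x, ψ i x ≠ 0 → ψ j x ≠ 0 → i = j := fun i j x hi hj => by
    rw [hψ, RCLike.ofReal_ne_zero] at hi hj
    exact e.injective (hφd _ _ x hi hj)
  obtain ⟨J, hJ⟩ := exists_hasSum_of_norm_sum_le
    fun a C t => norm_sum_smul_le_of_disjoint (t := t) hψ1 hψd
  have he : Tendsto e cofinite atTop := by
    rw [← Nat.cofinite_eq_atTop]
    exact e.injective.tendsto_cofinite
  obtain ⟨P, hP⟩ := exists_sub_apply (𝕜 := 𝕜) (hp.comp he)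
  refine ⟨J, P, fun a => ?_⟩
  have hval : ∀ x, HasSum (fun i => a i * (φ (e i) x : 𝕜)) (J a x) := fun x => by
    simpa [hψ] using (ContinuousMap.evalCLM 𝕜 x).hasSum (hJ a)
  ext i
  rw [hP, Function.comp_apply]
  have h1 : J a q = 0 := (hval q).unique (by simp [hφq])
  have h2 : J a (p (e i)) = a i := (hval _).unique (by
    convert hasSum_ite_eq i (a i) using 2 with j
    split_ifs with hj
    · rw [hj, hφp, RCLike.ofReal_one, mul_one]
    · have : φ (e j) (p (e i)) = 0 := by
        by_contra h
        exact hj (e.injective (hφd _ _ _ h (by rw [hφp]; exact one_ne_zero)))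
      rw [this, RCLike.ofReal_zero, mul_zero])
  rw [h1, h2, sub_zero]

end ContinuousFunctions

end EpsHypercyclic

/-- For an infinite compact metrizable space `K`, the Banach space `C(K)` of continuous
scalar-valued (`ℝ` or `ℂ`) functions with the sup norm admits, for every `ε ∈ (0,1)`, a
bounded operator which is ε-hypercyclic but not hypercyclic. -/
theorem CK_admits_eps_hypercyclic_not_hypercyclic
    {𝕜 K : Type*} [RCLike 𝕜] [TopologicalSpace K] [CompactSpace K]
    [TopologicalSpace.MetrizableSpace K] [Infinite K]
    {ε : ℝ} (hε : ε ∈ Set.Ioo (0 : ℝ) 1) :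
    ∃ T : C(K, 𝕜) →L[𝕜] C(K, 𝕜),
      (∃ x : C(K, 𝕜), ∀ u : C(K, 𝕜), u ≠ 0 → ∃ n : ℕ, ‖(T ^ n) x - u‖ ≤ ε * ‖u‖) ∧
      ¬ ∃ x : C(K, 𝕜), Dense (Set.range fun n : ℕ => (T ^ n) x) := by
  obtain ⟨J, P, hPJ⟩ := EpsHypercyclic.exists_complemented_nullFamilies 𝕜 K (ℕ × ℕ)
    Nat.pairEquiv
  let := TopologicalSpace.metrizableSpaceMetric K
  exact EpsHypercyclic.exists_eps_hypercyclic_not_hypercyclic hε J P hPJ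
end

section
/- Let X be an infinite-dimensional separable Banach space, T a bounded linear operator on X, and ε ∈ (0,1). Let D₁ be a dense subset of X, and let D₂ be a subset of X such that D₂ ∩ B(x, ε‖x‖) is nonempty for every x ∈ X \ {0} (where B(x,r) is the closed ball of center x and radius r). Suppose there exist an increasing sequence (n(k))_k of natural numbers and maps S_{n(k)} : D₂ → X such that (1) lim_{k→∞} ‖T^{n(k)} x‖ = 0 for all x ∈ D₁, (2) lim_{k→∞} ‖S_{n(k)} y‖ = 0 for all y ∈ D₂, and (3) lim_{k→∞} ‖T^{n(k)} S_{n(k)} y − y‖ = 0 for all y ∈ D₂. Then T satisfies the Hypercyclicity Criterion. -/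
open Filter Topology

/-- The vectors `y` that are limits of `A k (u k)` for some null sequence `u`. -/
def nullLimitSubmodule {𝕜 X : Type*} [NormedField 𝕜] [NormedAddCommGroup X] [NormedSpace 𝕜 X]
    (A : ℕ → X →L[𝕜] X) : Submodule 𝕜 X where
  carrier := {y | ∃ u : ℕ → X, Tendsto u atTop (𝓝 0) ∧
    Tendsto (fun k => A k (u k)) atTop (𝓝 y)}
  zero_mem' := ⟨fun _ => 0, tendsto_const_nhds, by simp⟩
  add_mem' := by
    rintro y z ⟨u, hu, huy⟩ ⟨v, hv, hvz⟩
    exact ⟨fun k => u k + v k, by simpa using hu.add hv, by simpa using huy.add hvz⟩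
  smul_mem' := by
    rintro c y ⟨u, hu, huy⟩
    exact ⟨fun k => c • u k, by simpa using hu.const_smul c, by simpa using huy.const_smul c⟩

/-- By Riesz's lemma, a subspace that approximates every nonzero `x` up to `ε * ‖x‖`, for a
fixed `ε < 1`, is dense. -/
theorem Submodule.dense_of_forall_exists_norm_sub_le {𝕜 X : Type*} [NormedField 𝕜]
    [NormedAddCommGroup X] [NormedSpace 𝕜 X] (p : Submodule 𝕜 X) {ε : ℝ} (hε : ε < 1)
    (h : ∀ x : X, x ≠ 0 → ∃ y ∈ p, ‖x - y‖ ≤ ε * ‖x‖) : Dense (p : Set X) := by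
  intro x
  by_contra hx
  obtain ⟨δ, hεδ, hδ⟩ := exists_between hε
  obtain ⟨x₀, hx₀, hfar⟩ := riesz_lemma (F := p.topologicalClosure)
    p.isClosed_topologicalClosure ⟨x, hx⟩ hδ
  have hne : x₀ ≠ 0 := fun h0 => hx₀ (h0 ▸ zero_mem _)
  obtain ⟨y, hy, hxy⟩ := h x₀ hne
  have hlt : ε * ‖x₀‖ < δ * ‖x₀‖ := mul_lt_mul_of_pos_right hεδ (norm_pos_iff.mpr hne)
  linarith [hfar y (p.le_topologicalClosure hy)]

/-- If the hypotheses of the ε-Hypercyclicity Criterion hold with a set `D₂` which merely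
meets the closed ball `B(x, ε‖x‖)` for every nonzero `x` (with conditions (2) and (3)
holding for every point of `D₂`), then `T` satisfies the Hypercyclicity Criterion. -/
theorem naive_epsilon_criterion_implies_hypercyclicity_criterion
    {𝕜 X : Type*} [RCLike 𝕜] [NormedAddCommGroup X] [NormedSpace 𝕜 X]
    [CompleteSpace X] [TopologicalSpace.SeparableSpace X]
    (hinf : ¬ FiniteDimensional 𝕜 X)
    (T : X →L[𝕜] X) {ε : ℝ} (hε : ε ∈ Set.Ioo (0 : ℝ) 1)
    (D₁ : Set X) (hD₁ : Dense D₁)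
    (D₂ : Set X)
    (hD₂ : ∀ x : X, x ≠ 0 → (D₂ ∩ Metric.closedBall x (ε * ‖x‖)).Nonempty)
    (n : ℕ → ℕ) (hn : StrictMono n)
    (S : ℕ → X → X)
    (h1 : ∀ x ∈ D₁, Tendsto (fun k => ‖(T ^ n k) x‖) atTop (𝓝 0))
    (h2 : ∀ y ∈ D₂, Tendsto (fun k => ‖S k y‖) atTop (𝓝 0))
    (h3 : ∀ y ∈ D₂, Tendsto (fun k => ‖(T ^ n k) (S k y) - y‖) atTop (𝓝 0)) :
    ∃ m : ℕ → ℕ, StrictMono m ∧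
      ∃ E₁ E₂ : Set X, Dense E₁ ∧ Dense E₂ ∧
        ∃ U : ℕ → X → X,
          (∀ x ∈ E₁, Tendsto (fun k => (T ^ m k) x) atTop (𝓝 0)) ∧
          (∀ y ∈ E₂, Tendsto (fun k => U k y) atTop (𝓝 0)) ∧
          (∀ y ∈ E₂, Tendsto (fun k => (T ^ m k) (U k y)) atTop (𝓝 y)) := by
  have hdense : Dense (nullLimitSubmodule (fun k => T ^ n k) : Set X) := by
    refine Submodule.dense_of_forall_exists_norm_sub_le _ hε.2 fun x hx => ?_
    obtain ⟨y, hy, hxy⟩ := hD₂ x hx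
    refine ⟨y, ⟨fun k => S k y, tendsto_zero_iff_norm_tendsto_zero.mpr (h2 y hy),
      tendsto_iff_norm_sub_tendsto_zero.mpr (h3 y hy)⟩, ?_⟩
    rwa [Metric.mem_closedBall, dist_comm, dist_eq_norm] at hxy
  have hU : ∀ y : X, ∃ u : ℕ → X, y ∈ nullLimitSubmodule (fun k => T ^ n k) →
      Tendsto u atTop (𝓝 0) ∧ Tendsto (fun k => (T ^ n k) (u k)) atTop (𝓝 y) := by
    intro y
    by_cases hy : y ∈ nullLimitSubmodule (fun k => T ^ n k)
    · obtain ⟨u, hu⟩ := hy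
      exact ⟨u, fun _ => hu⟩
    · exact ⟨fun _ => 0, fun h => absurd h hy⟩
  choose U hU using hU
  exact ⟨n, hn, D₁, _, hD₁, hdense, fun k y => U y k,
    fun x hx => tendsto_zero_iff_norm_tendsto_zero.mpr (h1 x hx),
    fun y hy => (hU y hy).1, fun y hy => (hU y hy).2⟩
end
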